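/- Let I : T*U → ℝ be a smooth function which is a homogeneous polynomial in momenta of degree 6 satisfying {H, I} = 0, {p_φ, I} = 0 and {p_t, I} = 0. Then there exist real constants α, β_0, β_1, β_2, ν_0, …, ν_4, η_0, …, η_6 such that I = α·H³ + H²·Σ_{i=0}^{2} β_i·p_φ^i·p_t^{2−i} + H·Σ_{j=0}^{4} ν_j·p_φ^j·p_t^{4−j} + Σ_{k=0}^{6} η_k·p_φ^k·p_t^{6−k} identically on T*U; in particular, the real vector space of homogeneous degree-6 polynomial-in-momenta integrals of H commuting with p_φ and p_t is exactly 16-dimensional. -/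

import Mathlib

open Real Finset

noncomputable section

/-- A phase-space point `(x, y, φ, t, p_x, p_y, p_φ, p_t)` of `T*U ⊂ ℝ⁴ × ℝ⁴`. -/
abbrev PhasePt := Fin 8 → ℝ

/-- The phase space `T*U` over `U = {x > 1, -1 < y < 1}`. -/
def TStar : Set PhasePt := {z | 1 < z 0 ∧ -1 < z 1 ∧ z 1 < 1}

/-- The base domain `U`. -/
def Ubase : Set (Fin 4 → ℝ) := {w | 1 < w 0 ∧ -1 < w 1 ∧ w 1 < 1}

/-- Projection to the base coordinates `(x, y, φ, t)`. -/
def basePt (z : PhasePt) : Fin 4 → ℝ := fun q => z ⟨q.1, by omega⟩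

/-- Partial derivative in the `i`-th coordinate. -/
def pd (i : Fin 8) (f : PhasePt → ℝ) (z : PhasePt) : ℝ :=
  fderiv ℝ f z (Pi.single i 1)

/-- The canonical Poisson bracket on `T*U`. -/
def pois (f g : PhasePt → ℝ) (z : PhasePt) : ℝ :=
    (pd 0 f z * pd 4 g z - pd 4 f z * pd 0 g z)
  + (pd 1 f z * pd 5 g z - pd 5 f z * pd 1 g z)
  + (pd 2 f z * pd 6 g z - pd 6 f z * pd 2 g z)
  + (pd 3 f z * pd 7 g z - pd 7 f z * pd 3 g z)

/-- The geodesic Hamiltonian of the Zipoy-Voorhees metric with parameter `δ = 2`. -/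
def Ham (z : PhasePt) : ℝ :=
  (1/2) * ( (((z 0)^2 - 1) * (z 4)^2 + (1 - (z 1)^2) * (z 5)^2)
      / ((((z 0 + 1)/(z 0 - 1))^2) * (((z 0)^2 - 1)^4 / ((z 0)^2 - (z 1)^2)^3))
    + (z 6)^2 / ((((z 0 + 1)/(z 0 - 1))^2) * (((z 0)^2 - 1) * (1 - (z 1)^2)))
    - ((z 0 + 1)/(z 0 - 1))^2 * (z 7)^2 )

/-- The momentum `p_φ`. -/
def Pphi (z : PhasePt) : ℝ := z 6

/-- The momentum `p_t`. -/
def Ptm (z : PhasePt) : ℝ := z 7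

/-- `I` is polynomial in momenta of degree `≤ d`, with smooth coefficients. -/
def IsPolyMom (d : ℕ) (I : PhasePt → ℝ) : Prop :=
  ∃ c : ℕ → ℕ → ℕ → ℕ → ((Fin 4 → ℝ) → ℝ),
    (∀ i j k m, ContDiffOn ℝ (⊤ : ℕ∞) (c i j k m) Ubase) ∧
    ∀ z ∈ TStar, I z =
      ∑ i ∈ Finset.range (d+1), ∑ j ∈ Finset.range (d+1),
      ∑ k ∈ Finset.range (d+1), ∑ m ∈ Finset.range (d+1),
        (if i + j + k + m ≤ d then
          c i j k m (basePt z) * (z 4)^i * (z 5)^j * (z 6)^k * (z 7)^m else 0)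

/-- `I` is a homogeneous polynomial in momenta of degree `d`, with smooth coefficients. -/
def IsHomPolyMom (d : ℕ) (I : PhasePt → ℝ) : Prop :=
  ∃ c : ℕ → ℕ → ℕ → ℕ → ((Fin 4 → ℝ) → ℝ),
    (∀ i j k m, ContDiffOn ℝ (⊤ : ℕ∞) (c i j k m) Ubase) ∧
    ∀ z ∈ TStar, I z =
      ∑ i ∈ Finset.range (d+1), ∑ j ∈ Finset.range (d+1),
      ∑ k ∈ Finset.range (d+1), ∑ m ∈ Finset.range (d+1),
        (if i + j + k + m = d then
          c i j k m (basePt z) * (z 4)^i * (z 5)^j * (z 6)^k * (z 7)^m else 0)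

/-- Functional independence: the differentials are linearly independent at every point
of a dense subset of `T*U`. -/
def FunIndep (f₁ f₂ f₃ f₄ : PhasePt → ℝ) : Prop :=
  ∃ S : Set PhasePt, S ⊆ TStar ∧ TStar ⊆ closure S ∧
    ∀ z ∈ S, LinearIndependent ℝ
      ![fderiv ℝ f₁ z, fderiv ℝ f₂ z, fderiv ℝ f₃ z, fderiv ℝ f₄ z]


namespace ZV

/-! ### Part 1: a verified elimination modulo `31`

A solution of the truncated jet system is written as a linear function of finitely many
parameters.  Linear forms in the parameters are packed into natural numbers in base `2 ^ 24`. -/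


/-- Evaluate the first argument before passing it on. -/
def force {β : Type} (n : ℕ) (f : ℕ → β) : β :=
  Nat.rec (motive := fun _ => β) (f 0) (fun m _ => f (Nat.succ m)) n

/-- Optional packed rows. -/
inductive ORow where
  | none : ORow
  | some (r : ℕ) : ORow

/-- Binary tries holding rows, together with their keys. -/
inductive Tr where
  | leaf : Tr
  | node (l r : Tr) : Tr
  | tip (k x : ℕ) : Tr

/-- Look up a row. -/
def tget (k0 : ℕ) (d : ℕ) : ℕ → Tr → ORow :=
  Nat.rec (motive := fun _ => ℕ → Tr → ORow)
    (fun _ t => Tr.rec (motive := fun _ => ORow) ORow.none (fun _ _ _ _ => ORow.none)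
      (fun k x => Bool.rec (motive := fun _ => ORow) ORow.none (ORow.some x) (Nat.beq k k0)) t)
    (fun _ ih k t => Tr.rec (motive := fun _ => ORow) ORow.none
      (fun l r _ _ => Nat.rec (motive := fun _ => ORow) (ih (Nat.div k 2) l)
        (fun _ _ => ih (Nat.div k 2) r) (Nat.mod k 2)) (fun _ _ => ORow.none) t) d

/-- Rebuild a node after forcing the left child. -/
def mkL (x r : Tr) : Tr :=
  Tr.rec (motive := fun _ => Tr) (Tr.node Tr.leaf r)
    (fun a b _ _ => Tr.node (Tr.node a b) r) (fun k y => Tr.node (Tr.tip k y) r) x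

/-- Rebuild a node after forcing the right child. -/
def mkR (l x : Tr) : Tr :=
  Tr.rec (motive := fun _ => Tr) (Tr.node l Tr.leaf)
    (fun a b _ _ => Tr.node l (Tr.node a b)) (fun k y => Tr.node l (Tr.tip k y)) x

/-- Insert a row. -/
def tins (k0 x : ℕ) (d : ℕ) : ℕ → Tr → Tr :=
  Nat.rec (motive := fun _ => ℕ → Tr → Tr)
    (fun _ _ => force x fun x => force k0 fun k0 => Tr.tip k0 x)
    (fun _ ih k t =>
      Nat.rec (motive := fun _ => Tr)
        (Tr.rec (motive := fun _ => Tr) (mkL (ih (Nat.div k 2) Tr.leaf) Tr.leaf)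
          (fun l r _ _ => mkL (ih (Nat.div k 2) l) r) (fun _ _ => Tr.leaf) t)
        (fun _ _ =>
          Tr.rec (motive := fun _ => Tr) (mkR Tr.leaf (ih (Nat.div k 2) Tr.leaf))
          (fun l r _ _ => mkR l (ih (Nat.div k 2) r)) (fun _ _ => Tr.leaf) t)
        (Nat.mod k 2)) d

/-- Reduce all digits modulo `31`. -/
def norm (D : ℕ) : ℕ → ℕ :=
  Nat.rec (motive := fun _ => ℕ → ℕ) (fun _ => 0)
    (fun _ ih x => Nat.add (Nat.mod (Nat.mod x 16777216) 31)
      (Nat.mul 16777216 (force (Nat.div x 16777216) ih))) D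

/-- Encoding of the jet variable `(j, I, S)`. -/
def jkey (j I S : ℕ) : ℕ :=
  Nat.add (Nat.mul (Nat.add (Nat.mul (Nat.add I S) 8) j) 16) I

/-- Coefficient tables modulo 31 : lists of `(k, l, c)`. -/
inductive Tab where
  | nil : Tab
  | cons (k l c : ℕ) (t : Tab) : Tab

/-- Loop of `genT`. -/
def genL (T : Tr) (w dx dy j i s : ℕ) (tab : Tab) : ℕ → ORow :=
  Tab.rec (motive := fun _ => ℕ → ORow) (fun acc => ORow.some acc)
    (fun k l c _ ih acc =>
      Bool.rec (motive := fun _ => ORow) (ih acc)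
        (force (jkey j (Nat.add (Nat.sub i k) dx) (Nat.add (Nat.sub s l) dy)) fun key =>
          ORow.rec (motive := fun _ => ORow) ORow.none
          (fun r => ih (Nat.add acc (Nat.mul
          (Nat.mod (Nat.mul (Nat.mul w c)
              (Nat.mul (Nat.add 1 (Nat.mul dx (Nat.sub i k)))
                (Nat.add 1 (Nat.mul dy (Nat.sub s l))))) 31) r)))
          (tget key 11 key T))
        (Bool.rec (motive := fun _ => Bool) false (Nat.ble l s) (Nat.ble k i))) tab

/-- Add one term of the equation `(e, i, s)` to a row. -/
def genT (n : ℕ) (T : Tr) (w dx dy j i s : ℕ) (tab : Tab) (a : ORow) : ORow :=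
  ORow.rec (motive := fun _ => ORow) ORow.none
    (fun acc => Bool.rec (motive := fun _ => ORow) (ORow.some acc)
      (genL T w dx dy j i s tab acc)
      (Bool.rec (motive := fun _ => Bool) false (Nat.ble j n) (Nat.ble 1 w))) a

def tab1 : Tab := .cons 0 0 6 <| .cons 1 0 23 <| .cons 0 2 12 <| .cons 2 0 28 <| .cons 1 2 25 <|
  .cons 3 0 13 <| .cons 2 2 16 <| .cons 4 0 2 <| .cons 3 2 3 .nil
def tab2 : Tab := .cons 0 0 25 <| .cons 1 0 24 <| .cons 0 2 12 <| .cons 2 0 27 <| .cons 1 2 11 <|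
  .cons 3 0 30 <| .cons 0 4 25 <| .cons 2 2 4 <| .cons 1 4 27 <| .cons 3 2 1 .nil
def tab3 : Tab := .cons 1 0 23 <| .cons 0 2 9 <| .cons 2 0 24 <| .cons 1 2 24 <|
  .cons 3 0 11 <| .cons 2 2 22 <| .cons 4 0 4 <| .cons 3 2 8 <| .cons 5 0 19 <| .cons 4 2 1 <|
  .cons 6 0 30 .nil
def top3 : Tab := .cons 0 0 26 .nil
def tab4 : Tab := .cons 0 1 4 <| .cons 1 1 21 <| .cons 2 1 27 <| .cons 3 1 7 <| .cons 4 1 28 .nil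
def tab5 : Tab := .cons 0 1 10 <| .cons 1 1 22 <| .cons 0 3 12 <| .cons 2 1 5 <| .cons 1 3 16 <|
  .cons 3 1 23 <| .cons 2 3 4 <| .cons 4 1 30 .nil
def tab6 : Tab := .cons 1 0 3 <| .cons 0 2 15 <| .cons 2 0 8 <| .cons 1 2 1 <|
  .cons 3 0 23 <| .cons 0 4 28 <| .cons 2 2 24 <| .cons 4 0 30 <| .cons 1 4 27 <| .cons 3 2 8 <|
  .cons 2 4 30 <| .cons 4 2 1 .nil
def top6 : Tab := .cons 0 0 19 .nil

/-- Everything in the equation `(e, i, s)` except for the terms of highest order. -/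
def base (n : ℕ) (T : Tr) (e i s : ℕ) : ORow :=
  genT n T (Nat.sub n e) 0 0 e i s tab1 <|
  genT n T (Nat.mul (Nat.sub (Nat.add n 2) e) (Nat.min 1 (Nat.sub e 1))) 0 0 (Nat.sub e 2) i s tab2 <|
  genT n T 1 1 0 e i s tab3 <|
  genT n T (Nat.add e 1) 0 0 (Nat.add e 1) i s tab4 <|
  genT n T (Nat.sub e 1) 0 0 (Nat.sub e 1) i s tab5 <|
  genT n T (Nat.min 1 e) 0 1 (Nat.sub e 1) i s tab6 <| ORow.some 0

/-- Store a solved row. -/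
def store (D : ℕ) (T : Tr) (key cf : ℕ) (a : ORow) : Tr :=
  ORow.rec (motive := fun _ => Tr) Tr.leaf
    (fun x => force (Nat.mod (Nat.mul 30 (Nat.pow cf 29)) 31) fun c =>
      Bool.rec (motive := fun _ => Tr) Tr.leaf
        (force (norm D (Nat.mul c x)) fun y => tins key y 11 key T)
        (Nat.beq (Nat.mod (Nat.mul c cf) 31) 30)) a

/-- Solve the equation `(e, i, s)` for `(e, i + 1, s)`. -/
def stepF (D n : ℕ) (T : Tr) (e i s : ℕ) : Tr :=
  store D T (jkey e (Nat.succ i) s) (Nat.mul 26 (Nat.succ i))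
    (genT n T (Nat.min 1 e) 0 1 (Nat.sub e 1) i s top6 (base n T e i s))

/-- Solve the equation `(e, i, s)` for `(e - 1, i, s + 1)`. -/
def stepB (D n : ℕ) (T : Tr) (e i s : ℕ) : Tr :=
  store D T (jkey (Nat.sub e 1) i (Nat.succ s)) (Nat.mul 19 (Nat.succ s))
    (genT n T 1 1 0 e i s top3 (base n T e i s))

/-- Pass on an evaluated trie. -/
def forceT (T : Tr) (f : Tr → Tr) : Tr :=
  Tr.rec (motive := fun _ => Tr) (f Tr.leaf) (fun l r _ _ => f (Tr.node l r))
    (fun k x => f (Tr.tip k x)) T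

/-- Forward steps for `i < c`. -/
def fwdI (D n m e : ℕ) (c : ℕ) : Tr → Tr :=
  Nat.rec (motive := fun _ => Tr → Tr) (fun T => T)
    (fun i ih T => Bool.rec (motive := fun _ => Tr) (ih T)
      (forceT (ih T) fun T => stepF D n T e i (Nat.sub m i))
      (or (Nat.ble e i) (Nat.ble (Nat.add m e) (Nat.add i n)))) c

def fwdE (D n m : ℕ) (c : ℕ) : Tr → Tr :=
  Nat.rec (motive := fun _ => Tr → Tr) (fun T => T)
    (fun e ih T => fwdI D n m e (Nat.succ m) (ih T)) c

/-- Backward steps for `i < c`. -/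
def bwdI (D n m e : ℕ) (c : ℕ) : Tr → Tr :=
  Nat.rec (motive := fun _ => Tr → Tr) (fun T => T)
    (fun i ih T => Bool.rec (motive := fun _ => Tr) (ih T)
      (forceT (ih T) fun T => stepB D n T e i (Nat.sub m i))
      (and (Nat.blt i e) (Nat.blt (Nat.add i n) (Nat.add m e)))) c

def bwdE (D n m : ℕ) (c : ℕ) : Tr → Tr :=
  Nat.rec (motive := fun _ => Tr → Tr) (fun T => T)
    (fun d ih T => bwdI D n m (Nat.sub (Nat.succ n) d) (Nat.succ m) (ih T)) c

/-- Handle all orders `m < c`. -/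
def loopM (D n : ℕ) (c : ℕ) : Tr → Tr :=
  Nat.rec (motive := fun _ => Tr → Tr) (fun T => T)
    (fun m ih T => forceT (ih T) fun T => bwdE D n m (Nat.succ n) (fwdE D n m (Nat.succ n) T)) c

/-- The parameters: `(j, S)` stands for the jet variable `(j, 0, S)`. -/
def freeList (n : ℕ) : List (ℕ × ℕ) :=
  (List.range (n + 1)).flatMap fun S => (List.range (n + 1 - S)).map fun j => (j, S)

/-- The trie holding the parameters. -/
def insFree : List (ℕ × ℕ) → ℕ → Tr → Tr
  | [], _, T => T
  | (j, S) :: L, x, T => insFree L (x * 16777216) (tins (jkey j 0 S) x 11 (jkey j 0 S) T)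

/-- A full equation with `e = n + 1`. -/
def residual (D n : ℕ) (T : Tr) (i s : ℕ) : ℕ :=
  ORow.rec (motive := fun _ => ℕ) 0 (fun x => norm D x)
    (genT n T (Nat.min 1 (Nat.succ n)) 0 1 n i s top6
      (genT n T 1 1 0 (Nat.succ n) i s top3 (base n T (Nat.succ n) i s)))

/-- The list of residual rows. -/
def residuals (D n : ℕ) (T : Tr) : List (ℕ × ℕ) → (List ℕ → Bool) → Bool
  | [], f => f []
  | (i, s) :: L, f => force (residual D n T i s) fun x => residuals D n T L fun l => f (x :: l)

/-- Linear combination of rows; the coefficients are packed in base `32`. -/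
def comb : List ℕ → ℕ → ℕ
  | [], _ => 0
  | x :: l, c => (c % 32) * x + comb l (c / 32)

/-- Is the row the `t`-th unit vector modulo `31`? -/
def isUnit : ℕ → ℕ → ℕ → Bool
  | 0, _, _ => true
  | D + 1, 0, y => Nat.beq (y % 16777216 % 31) 1 && isUnit D D (y / 16777216)
  | D + 1, t + 1, y => Nat.beq (y % 16777216 % 31) 0 && isUnit D t (y / 16777216)

/-- All parameters vanish. -/
def units (D : ℕ) (l : List ℕ) : List ℕ → ℕ → Bool
  | [], t => Nat.beq t D
  | c :: L, t => isUnit D t (comb l c) && units D l L (t + 1)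

/-- All keys of order at most `N` are present. -/
def present (n N : ℕ) (T : Tr) : Bool :=
  (List.range (n + 1)).all fun j => (List.range (N + 1)).all fun I =>
    (List.range (N + 1 - I)).all fun S =>
      ORow.rec (motive := fun _ => Bool) false (fun _ => true) (tget (jkey j I S) 11 (jkey j I S) T)

/-- The final check. -/
def check (n N : ℕ) (cons : List (ℕ × ℕ)) (cert : List ℕ) : Bool :=
  let D := (freeList n).length
  let fin := fun T => present n N T && residuals D n T cons fun l =>
      units D (bif Nat.beq (n % 2) 0 then 1 :: l else l) cert 0
  Tr.rec (motive := fun _ => Bool) false (fun l r _ _ => fin (Tr.node l r)) (fun _ _ => false)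
    (loopM D n N (insFree (freeList n) 1 Tr.leaf))

def cons1 : List (ℕ × ℕ) := [(2, 0), (2, 1), (3, 1)]
def cert1 : List ℕ := [7,
  1344,
  224]
def cons2 : List (ℕ × ℕ) := [(3, 0), (3, 1), (4, 0), (4, 1), (3, 3)]
def cert2 : List ℕ := [1,
  393280,
  204493845,
  426080,
  98583552,
  308308999]
def cons3 : List (ℕ × ℕ) := [(4, 0), (4, 1), (5, 0), (4, 2), (5, 1), (6, 0), (4, 3), (6, 1), (5, 3), (7, 1)]
def cert3 : List ℕ := [497665,
  82367835276128,
  704971798,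
  275016419639680,
  549315589177504,
  202237982,
  699169152959424,
  973484039,
  604061388768064,
  165477574771392]
def cons4 : List (ℕ × ℕ) := [(5, 0), (5, 1), (6, 0), (5, 2), (6, 1), (7, 0), (5, 3), (6, 2), (7, 1), (8, 0), (6, 3), (8, 1), (5, 5), (7, 3)]
def cert4 : List ℕ := [1,
  25901210450690368,
  22682902011246513518603,
  5637199360197280,
  11919551279778899187719,
  5641625330385376,
  6057738379183817505792,
  9036887163142656,
  35870342545630851790848,
  10863619683878208295950,
  32654395833942176,
  9942506966503269608467,
  31549390947255040,
  26382375587312916511744,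
  14931090090118191537182]
def cons5 : List (ℕ × ℕ) := [(6, 0), (6, 1), (7, 0), (6, 2), (7, 1), (8, 0), (6, 3), (7, 2), (8, 1), (9, 0), (6, 4), (7, 3), (8, 2), (9, 1), (10, 0), (6, 5), (8, 3), (10, 1), (7, 5), (9, 3), (11, 1)]
def cert5 : List ℕ := [24810902621615200153617,
  25137729555033389381839852929664,
  15381139164052467589129,
  24776716689635895644196786143296,
  29521713852797608934415,
  30587724159244714240259701867232,
  37257569041571405086963675430944,
  23634921419969550581775,
  2921986400320032557740417089792,
  33068106488036372782085,
  38299296037423472307218205901312,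
  22458925617256293846029,
  30514600052199636439661388234912,
  23645296271055036431370,
  176287905420661220442033357600,
  30638876530866491872285128917600,
  7097405401329976889359,
  16485477083509012328662760948000,
  28335373773909007493128,
  3007970796262740273798922109280,
  6344772739119382425940060537376]
def cons6 : List (ℕ × ℕ) := [(7, 0), (7, 1), (8, 0), (7, 2), (8, 1), (9, 0), (7, 3), (8, 2), (9, 1), (10, 0), (7, 4), (8, 3), (9, 2), (10, 1), (11, 0), (7, 5), (8, 4), (9, 3), (10, 2), (11, 1), (12, 0), (8, 5), (10, 3), (12, 1), (7, 7), (9, 5), (11, 3)]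
def cert6 : List ℕ := [1,
  811931370317495055836025483264608,
  1028215793000625192038206844098594654390273,
  1015309367490349601926994627887232,
  318014999363816806128304739519661518906389,
  203180700517279422739415105569088,
  290617218021182251381925979916179731384343,
  690038610704816293648318091887168,
  341386895679120937711681743039434535734272,
  446649579253370536546113730052576,
  412231498772150051009320257971533197099008,
  1177489144716013449977857248428480,
  139872603263418813592793516541744393499648,
  352251561380331295836426562419795444113429,
  365876660960392923893083888025888,
  993572764998959045937477128494639115933716,
  1095289887572105668316324181770400,
  455291593077974898073627020786335915986971,
  41713937804385584407462476087424,
  833967250305931995980960844073916908438528,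
  122249635724293491745001854075744,
  343394594635307083056162053990733488075776,
  541982186622905781442774330140606198713354,
  40724320913377590617931528634624,
  732912993093529596118250766831916385595412,
  447362361802761412868642890187648,
  234485419042531323164611254801448008944640,
  197597720844525902536269125177402349068308]

set_option maxRecDepth 100000 in
theorem check1 : check 1 5 cons1 cert1 = true := by decide +kernel
set_option maxRecDepth 100000 in
theorem check2 : check 2 7 cons2 cert2 = true := by decide +kernel
set_option maxRecDepth 100000 in
theorem check3 : check 3 9 cons3 cert3 = true := by decide +kernel
set_option maxRecDepth 100000 in
theorem check4 : check 4 11 cons4 cert4 = true := by decide +kernel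
set_option maxRecDepth 100000 in
theorem check5 : check 5 13 cons5 cert5 = true := by decide +kernel
set_option maxRecDepth 100000 in
theorem check6 : check 6 15 cons6 cert6 = true := by decide +kernel


/-! ### Part 2: soundness of the elimination -/

/-- The prime field used for the elimination. -/
abbrev F31 := ZMod 31

/-- `x` packs a linear form with digits at most `b`, whose value at `us` is `w`. -/
def Rp : List F31 → ℕ → ℕ → F31 → Prop
  | [], _, x, w => x = 0 ∧ w = 0
  | u :: us, b, x, w => ∃ f x' : ℕ, ∃ w' : F31, f ≤ b ∧ x = f + 16777216 * x' ∧
      w = f * u + w' ∧ Rp us b x' w'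

theorem Rp.mono {us : List F31} {b b' x : ℕ} {w : F31} (h : Rp us b x w) (hb : b ≤ b') :
    Rp us b' x w := by
  induction us generalizing x w with
  | nil => exact h
  | cons u us ih =>
    obtain ⟨f, x', w', h1, h2, h3, h4⟩ := h
    exact ⟨f, x', w', h1.trans hb, h2, h3, ih h4⟩

theorem Rp.zero (us : List F31) : Rp us 0 0 0 := by
  induction us with
  | nil => exact ⟨rfl, rfl⟩
  | cons u us ih => exact ⟨0, 0, 0, le_rfl, rfl, by simp, ih⟩

theorem Rp.addMul {us : List F31} {b b' x r : ℕ} {w w' : F31} (h : Rp us b x w)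
    (h' : Rp us b' r w') (c : ℕ) : Rp us (b + c * b') (x + c * r) (w + c * w') := by
  induction us generalizing x w r w' with
  | nil =>
    obtain ⟨rfl, rfl⟩ := h
    obtain ⟨rfl, rfl⟩ := h'
    exact ⟨by simp, by simp⟩
  | cons u us ih =>
    obtain ⟨f, x1, w1, h1, h2, h3, h4⟩ := h
    obtain ⟨g, x2, w2, g1, g2, g3, g4⟩ := h'
    refine ⟨f + c * g, x1 + c * x2, w1 + c * w2, ?_, ?_, ?_, ih h4 g4⟩
    · gcongr
    · rw [h2, g2]; ring
    · rw [h3, g3]; push_cast; ring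

theorem cast_mod31 (a : ℕ) : ((a % 31 : ℕ) : F31) = a := by
  exact ZMod.natCast_mod a 31

theorem Rp.norm {us : List F31} {b x : ℕ} {w : F31} (h : Rp us b x w) (hb : b < 16777216) :
    Rp us 30 (norm us.length x) w := by
  induction us generalizing x w with
  | nil => exact ⟨rfl, h.2⟩
  | cons u us ih =>
    obtain ⟨f, x1, w1, h1, h2, h3, h4⟩ := h
    have e1 : x % 16777216 = f := by omega
    have e2 : x / 16777216 = x1 := by omega
    refine ⟨f % 31, ZV.norm us.length x1, w1, by omega, ?_, ?_, ih h4⟩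
    · have : ZV.norm (us.length + 1) x = x % 16777216 % 31 +
        16777216 * (force (x / 16777216) (ZV.norm us.length)) := rfl
      rw [List.length_cons, this, e1, e2]
      congr 2
      cases x1 <;> rfl
    · rw [h3, cast_mod31]

theorem Rp.unit {us : List F31} {b x t : ℕ} {w : F31} (h : Rp us b x w) (hb : b < 16777216)
    (hu : isUnit us.length t x = true) : w = us.getD t 0 := by
  have key : ∀ (us : List F31) (t x : ℕ) (w : F31), Rp us b x w →
      isUnit us.length t x = true → w = us.getD t 0 := by
    clear h hu
    intro us
    induction us with
    | nil => intro t x w h _; simpa using h.2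
    | cons u us ih =>
      intro t x w h hu
      obtain ⟨f, x1, w1, h1, h2, h3, h4⟩ := h
      have e1 : x % 16777216 = f := by omega
      have e2 : x / 16777216 = x1 := by omega
      cases t with
      | zero =>
        simp only [List.length_cons, isUnit, e1, e2, Bool.and_eq_true, Nat.beq_eq] at hu
        have := ih _ _ _ h4 hu.2
        have hf : (f : F31) = 1 := by rw [← cast_mod31, hu.1]; simp
        rw [h3, hf, this]; simp
      | succ t =>
        simp only [List.length_cons, isUnit, e1, e2, Bool.and_eq_true, Nat.beq_eq] at hu
        have := ih _ _ _ h4 hu.2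
        have hf : (f : F31) = 0 := by rw [← cast_mod31, hu.1]; simp
        rw [h3, hf, this]; simp
  exact key us t x w h hu

theorem force_eq {β : Type} (n : ℕ) (f : ℕ → β) : force n f = f n := by cases n <;> rfl

theorem forceT_eq (T : Tr) (f : Tr → Tr) : forceT T f = f T := by cases T <;> rfl

/-- All stored rows satisfy a predicate. -/
def Tr.All (P : ℕ → ℕ → Prop) : Tr → Prop
  | .leaf => True
  | .node l r => l.All P ∧ r.All P
  | .tip k x => P k x

theorem tget_sound {P : ℕ → ℕ → Prop} {k0 r : ℕ} : ∀ (d k : ℕ) (T : Tr), T.All P →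
    tget k0 d k T = .some r → P k0 r
  | 0, k, .leaf, _, h => by cases h
  | 0, k, .node _ _, _, h => by cases h
  | 0, k, .tip k1 x, hT, h => by
    have e : tget k0 0 k (.tip k1 x) =
      Bool.rec (motive := fun _ => ORow) ORow.none (ORow.some x) (Nat.beq k1 k0) := rfl
    rw [e] at h
    cases hb : Nat.beq k1 k0 with
    | false => rw [hb] at h; cases h
    | true =>
      rw [hb] at h
      cases h
      have := Nat.eq_of_beq_eq_true hb
      subst this; exact hT
  | d + 1, k, .leaf, _, h => by cases h
  | d + 1, k, .tip _ _, _, h => by cases h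
  | d + 1, k, .node l r', hT, h => by
    have e : tget k0 (d + 1) k (.node l r') =
      Nat.rec (motive := fun _ => ORow) (tget k0 d (Nat.div k 2) l)
        (fun _ _ => tget k0 d (Nat.div k 2) r') (Nat.mod k 2) := rfl
    rw [e] at h
    cases hb : Nat.mod k 2 with
    | zero => rw [hb] at h; exact tget_sound d _ _ hT.1 h
    | succ m => rw [hb] at h; exact tget_sound d _ _ hT.2 h

theorem mkL_eq (x r : Tr) : mkL x r = .node x r := by cases x <;> rfl
theorem mkR_eq (l x : Tr) : mkR l x = .node l x := by cases x <;> rfl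

theorem tins_sound {P : ℕ → ℕ → Prop} {k0 x : ℕ} (hx : P k0 x) : ∀ (d k : ℕ) (T : Tr), T.All P →
    (tins k0 x d k T).All P
  | 0, k, T, hT => by
    have e : tins k0 x 0 k T = force x fun x => force k0 fun k0 => Tr.tip k0 x := rfl
    rw [e, force_eq, force_eq]; exact hx
  | d + 1, k, T, hT => by
    have e : tins k0 x (d + 1) k T = Nat.rec (motive := fun _ => Tr)
        (Tr.rec (motive := fun _ => Tr) (mkL (tins k0 x d (Nat.div k 2) Tr.leaf) Tr.leaf)
          (fun l r _ _ => mkL (tins k0 x d (Nat.div k 2) l) r) (fun _ _ => Tr.leaf) T)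
        (fun _ _ =>
          Tr.rec (motive := fun _ => Tr) (mkR Tr.leaf (tins k0 x d (Nat.div k 2) Tr.leaf))
          (fun l r _ _ => mkR l (tins k0 x d (Nat.div k 2) r)) (fun _ _ => Tr.leaf) T)
        (Nat.mod k 2) := rfl
    rw [e]
    cases hb : Nat.mod k 2 with
    | zero =>
      cases T with
      | leaf => simp only [mkL_eq]; exact ⟨tins_sound hx d _ _ trivial, trivial⟩
      | node l r => simp only [mkL_eq]; exact ⟨tins_sound hx d _ _ hT.1, hT.2⟩
      | tip _ _ => trivial
    | succ m =>
      cases T with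
      | leaf => simp only [mkR_eq]; exact ⟨trivial, tins_sound hx d _ _ trivial⟩
      | node l r => simp only [mkR_eq]; exact ⟨hT.1, tins_sound hx d _ _ hT.2⟩
      | tip _ _ => trivial

/-- The jet variable with a given key. -/
def vkey (v : ℕ → ℕ → ℕ → F31) (key : ℕ) : F31 :=
  v (key / 16 % 8) (key % 16) (key / 128 - key % 16)

theorem vkey_jkey (v : ℕ → ℕ → ℕ → F31) {j I S : ℕ} (hj : j < 8) (hI : I < 16) :
    vkey v (jkey j I S) = v j I S := by
  have e : jkey j I S = ((I + S) * 8 + j) * 16 + I := rfl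
  unfold vkey
  rw [e]
  have e1 : (((I + S) * 8 + j) * 16 + I) / 16 = (I + S) * 8 + j := by omega
  have e2 : (((I + S) * 8 + j) * 16 + I) / 128 = I + S := by omega
  have e3 : (((I + S) * 8 + j) * 16 + I) % 16 = I := by omega
  have e4 : ((I + S) * 8 + j) % 8 = j := by omega
  rw [e1, e2, e3, e4, Nat.add_sub_cancel_left]

/-- Number of entries. -/
def Tab.len : Tab → ℕ
  | .nil => 0
  | .cons _ _ _ t => t.len + 1

/-- Meaning of one term of the equations. -/
def gsum (v : ℕ → ℕ → ℕ → F31) (w dx dy j i s : ℕ) : Tab → F31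
  | .nil => 0
  | .cons k l c t => (if k ≤ i ∧ l ≤ s then
      ((w * c * ((1 + dx * (i - k)) * (1 + dy * (s - l))) : ℕ) : F31) *
        v j (i - k + dx) (s - l + dy) else 0) + gsum v w dx dy j i s t

/-- The optional row `a` represents `w`. -/
def OK (us : List F31) (b : ℕ) (a : ORow) (w : F31) : Prop := ∀ x, a = .some x → Rp us b x w

/-- The invariant of the tries. -/
def Good (us : List F31) (v : ℕ → ℕ → ℕ → F31) (T : Tr) : Prop :=
  T.All fun key x => Rp us 30 x (vkey v key)

theorem genL_sound {us : List F31} {v : ℕ → ℕ → ℕ → F31} {T : Tr} (hT : Good us v T)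
    {w dx dy j i s : ℕ} (hj : j < 8) (hi : i + dx < 16) : ∀ (tab : Tab) (acc b : ℕ) (a : F31),
    Rp us b acc a → OK us (b + 900 * tab.len) (genL T w dx dy j i s tab acc)
      (a + gsum v w dx dy j i s tab)
  | .nil, acc, b, a, h => by
    intro x hx
    cases hx
    simpa [gsum, Tab.len] using h
  | .cons k l c t, acc, b, a, h => by
    intro x hx
    have e : genL T w dx dy j i s (.cons k l c t) acc =
      Bool.rec (motive := fun _ => ORow) (genL T w dx dy j i s t acc)
        (force (jkey j (Nat.add (Nat.sub i k) dx) (Nat.add (Nat.sub s l) dy)) fun key =>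
          ORow.rec (motive := fun _ => ORow) ORow.none
          (fun r => genL T w dx dy j i s t (Nat.add acc (Nat.mul
          (Nat.mod (Nat.mul (Nat.mul w c)
              (Nat.mul (Nat.add 1 (Nat.mul dx (Nat.sub i k)))
                (Nat.add 1 (Nat.mul dy (Nat.sub s l))))) 31) r)))
          (tget key 11 key T))
        (Bool.rec (motive := fun _ => Bool) false (Nat.ble l s) (Nat.ble k i)) := rfl
    rw [e, force_eq] at hx
    have skip : ¬ (k ≤ i ∧ l ≤ s) → genL T w dx dy j i s t acc = .some x →
        Rp us (b + 900 * (Tab.cons k l c t).len) x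
          (a + gsum v w dx dy j i s (.cons k l c t)) := by
      intro hn hx
      have := genL_sound hT hj hi t acc b a h x hx
      simp only [gsum, if_neg hn, zero_add]
      exact this.mono (by simp [Tab.len])
    cases h1 : Nat.ble k i with
    | false =>
      rw [h1] at hx
      refine skip (fun hh => ?_) hx
      rw [Nat.ble_eq_true_of_le hh.1] at h1; cases h1
    | true =>
      cases h2 : Nat.ble l s with
      | false =>
        rw [h1, h2] at hx
        refine skip (fun hh => ?_) hx
        rw [Nat.ble_eq_true_of_le hh.2] at h2; cases h2
      | true =>
        rw [h1, h2] at hx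
        have hki := Nat.le_of_ble_eq_true h1
        have hls := Nat.le_of_ble_eq_true h2
        dsimp only at hx
        cases h3 : tget (jkey j (Nat.add (Nat.sub i k) dx) (Nat.add (Nat.sub s l) dy)) 11
            (jkey j (Nat.add (Nat.sub i k) dx) (Nat.add (Nat.sub s l) dy)) T with
        | none => rw [h3] at hx; cases hx
        | some r =>
          rw [h3] at hx
          dsimp only at hx
          have hr := tget_sound _ _ _ hT h3
          rw [vkey_jkey v hj (by show i - k + dx < 16; omega)] at hr
          have := genL_sound hT hj hi t _ _ _ (h.addMul hr _) x hx
          have e2 : a + gsum v w dx dy j i s (.cons k l c t) =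
            a + ((w * c * ((1 + dx * (i - k)) * (1 + dy * (s - l))) % 31 : ℕ) : F31) *
              v j (i - k + dx) (s - l + dy) + gsum v w dx dy j i s t := by
            rw [cast_mod31]
            simp only [gsum, if_pos (And.intro hki hls)]
            ring
          rw [e2]
          refine this.mono ?_
          have hm : (Nat.mod (Nat.mul (Nat.mul w c)
              (Nat.mul (Nat.add 1 (Nat.mul dx (Nat.sub i k)))
                (Nat.add 1 (Nat.mul dy (Nat.sub s l))))) 31) < 31 := Nat.mod_lt _ (by norm_num)
          simp only [Tab.len]
          omega

theorem genT_sound {us : List F31} {v : ℕ → ℕ → ℕ → F31} {T : Tr} (hT : Good us v T) {n : ℕ}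
    (hn : n < 8) (hv : ∀ j, n < j → v j = 0)
    {w dx dy j i s : ℕ} (hi : i + dx < 16) (tab : Tab) {a : ORow} {b : ℕ} {z : F31}
    (ha : OK us b a z) : OK us (b + 900 * tab.len) (genT n T w dx dy j i s tab a)
      (z + gsum v w dx dy j i s tab) := by
  intro x hx
  cases a with
  | none => cases hx
  | some acc =>
    have hacc := ha acc rfl
    have e : genT n T w dx dy j i s tab (.some acc) =
      Bool.rec (motive := fun _ => ORow) (ORow.some acc)
      (genL T w dx dy j i s tab acc)
      (Bool.rec (motive := fun _ => Bool) false (Nat.ble j n) (Nat.ble 1 w)) := rfl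
    rw [e] at hx
    have zero : (w = 0 ∨ n < j) → gsum v w dx dy j i s tab = 0 := by
      intro h
      clear hx e
      induction tab with
      | nil => rfl
      | cons k l c t ih =>
        simp only [gsum, ih, add_zero]
        rcases h with rfl | h
        · simp
        · simp [hv j h]
    have skip : (w = 0 ∨ n < j) → ORow.some acc = .some x →
        Rp us (b + 900 * tab.len) x (z + gsum v w dx dy j i s tab) := by
      intro h hx
      cases hx
      rw [zero h, add_zero]
      exact hacc.mono (by omega)
    cases h1 : Nat.ble 1 w with
    | false =>
      rw [h1] at hx
      refine skip (Or.inl ?_) hx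
      by_contra hh
      rw [Nat.ble_eq_true_of_le (by omega)] at h1; cases h1
    | true =>
      cases h2 : Nat.ble j n with
      | false =>
        rw [h1, h2] at hx
        refine skip (Or.inr ?_) hx
        by_contra hh
        rw [Nat.ble_eq_true_of_le (by omega)] at h2; cases h2
      | true =>
        rw [h1, h2] at hx
        have := Nat.le_of_ble_eq_true h2
        exact genL_sound hT (by omega) hi tab acc b z hacc x hx

/-- Meaning of `base`. -/
def bsum (n : ℕ) (v : ℕ → ℕ → ℕ → F31) (e i s : ℕ) : F31 :=
  0 + gsum v (min 1 e) 0 1 (e - 1) i s tab6 + gsum v (e - 1) 0 0 (e - 1) i s tab5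
  + gsum v (e + 1) 0 0 (e + 1) i s tab4 + gsum v 1 1 0 e i s tab3
  + gsum v ((n + 2 - e) * min 1 (e - 1)) 0 0 (e - 2) i s tab2 + gsum v (n - e) 0 0 e i s tab1

/-- The full equation `(e, i, s)`. -/
def fsum (n : ℕ) (v : ℕ → ℕ → ℕ → F31) (e i s : ℕ) : F31 :=
  bsum n v e i s + gsum v 1 1 0 e i s top3 + gsum v (min 1 e) 0 1 (e - 1) i s top6

theorem base_sound {us : List F31} {v : ℕ → ℕ → ℕ → F31} {T : Tr} (hT : Good us v T) {n : ℕ}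
    (hn : n < 8) (hv : ∀ j, n < j → v j = 0) {e i s : ℕ} (hi : i < 15) :
    OK us (900 * 55) (base n T e i s) (bsum n v e i s) := by
  have h0 : OK us 0 (ORow.some 0) 0 := by
    intro x hx; cases hx; exact Rp.zero us
  have := genT_sound hT hn hv (w := n - e) (dx := 0) (dy := 0) (j := e) (i := i) (s := s) (by omega) tab1
    (genT_sound hT hn hv (w := (n + 2 - e) * min 1 (e - 1)) (dx := 0) (dy := 0) (j := e - 2) (i := i) (s := s)
        (by omega) tab2
    (genT_sound hT hn hv (w := 1) (dx := 1) (dy := 0) (j := e) (i := i) (s := s) (by omega) tab3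
    (genT_sound hT hn hv (w := e + 1) (dx := 0) (dy := 0) (j := e + 1) (i := i) (s := s) (by omega) tab4
    (genT_sound hT hn hv (w := e - 1) (dx := 0) (dy := 0) (j := e - 1) (i := i) (s := s) (by omega) tab5
    (genT_sound hT hn hv (w := min 1 e) (dx := 0) (dy := 1) (j := e - 1) (i := i) (s := s) (by omega) tab6
      h0)))))
  exact this

theorem store_sound {us : List F31} {v : ℕ → ℕ → ℕ → F31} {T : Tr} (hT : Good us v T)
    {j I S cf b : ℕ} (hj : j < 8) (hI : I < 16) {a : ORow} {w : F31} (ha : OK us b a w)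
    (hb : 30 * b < 16777216) (h : (cf : F31) * v j I S + w = 0) :
    Good us v (store us.length T (jkey j I S) cf a) := by
  cases a with
  | none => trivial
  | some x =>
    have e : store us.length T (jkey j I S) cf (.some x) =
      force (Nat.mod (Nat.mul 30 (Nat.pow cf 29)) 31) fun c =>
      Bool.rec (motive := fun _ => Tr) Tr.leaf
        (force (norm us.length (Nat.mul c x)) fun y => tins (jkey j I S) y 11 (jkey j I S) T)
        (Nat.beq (Nat.mod (Nat.mul c cf) 31) 30) := rfl
    rw [e, force_eq, force_eq]
    have hc : (Nat.mod (Nat.mul 30 (Nat.pow cf 29)) 31) < 31 := Nat.mod_lt _ (by norm_num)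
    generalize (Nat.mod (Nat.mul 30 (Nat.pow cf 29)) 31) = c at hc
    cases h1 : Nat.beq (Nat.mod (Nat.mul c cf) 31) 30 with
    | false => trivial
    | true =>
      have h2 : c * cf % 31 = 30 := Nat.eq_of_beq_eq_true h1
      refine tins_sound ?_ _ _ _ hT
      rw [vkey_jkey v hj hI]
      have hcc : (c : F31) * cf = -1 := by
        rw [← Nat.cast_mul, ← cast_mod31, h2]; decide
      have hx := (Rp.zero us).addMul (ha x rfl) c
      have e3 : v j I S = 0 + c * w := by
        linear_combination -(c : F31) * h + (v j I S) * hcc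
      rw [e3]
      have := hx.norm (by nlinarith)
      simpa using this

section Loops

variable {us : List F31} {v : ℕ → ℕ → ℕ → F31} {n N : ℕ}

theorem stepF_sound {T : Tr} (hT : Good us v T) (hn : n < 7) (hN : N < 16)
    (hv : ∀ j, n < j → v j = 0) (heq : ∀ e i s, e ≤ n + 1 → i + s < N → fsum n v e i s = 0)
    {e i s : ℕ} (he : e ≤ n) (his : i + s < N) : Good us v (stepF us.length n T e i s) := by
  refine store_sound hT (by omega) (by omega) (genT_sound hT (by omega) hv (by omega) top6
    (base_sound hT (by omega) hv (by omega))) (by norm_num [top6, Tab.len]) ?_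
  have h := heq e i s (by omega) his
  rw [← h, fsum]
  simp [gsum, top3]
  ring

theorem stepB_sound {T : Tr} (hT : Good us v T) (hn : n < 7) (hN : N < 16)
    (hv : ∀ j, n < j → v j = 0) (heq : ∀ e i s, e ≤ n + 1 → i + s < N → fsum n v e i s = 0)
    {e i s : ℕ} (he : e ≤ n + 1) (he1 : 1 ≤ e) (his : i + s < N) :
    Good us v (stepB us.length n T e i s) := by
  refine store_sound hT (by show e - 1 < 8; omega) (by omega) (genT_sound hT (by omega) hv (by omega) top3
    (base_sound hT (by omega) hv (by omega))) (by norm_num [top3, Tab.len]) ?_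
  have h := heq e i s (by omega) his
  rw [← h, fsum]
  have : min 1 e = 1 := by omega
  simp [gsum, top6, this]
  ring

theorem fwdI_sound (hn : n < 7) (hN : N < 16)
    (hv : ∀ j, n < j → v j = 0) (heq : ∀ e i s, e ≤ n + 1 → i + s < N → fsum n v e i s = 0)
    {m e : ℕ} (hm : m < N) (he : e ≤ n) :
    ∀ c ≤ m + 1, ∀ T, Good us v T → Good us v (fwdI us.length n m e c T)
  | 0, _, T, hT => hT
  | c + 1, hc, T, hT => by
    have ih := fwdI_sound hn hN hv heq hm he c (by omega) T hT
    have e1 : fwdI us.length n m e (c + 1) T = Bool.rec (motive := fun _ => Tr)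
      (fwdI us.length n m e c T)
      (forceT (fwdI us.length n m e c T) fun T => stepF us.length n T e c (Nat.sub m c))
      (or (Nat.ble e c) (Nat.ble (Nat.add m e) (Nat.add c n))) := rfl
    rw [e1, forceT_eq]
    cases (or (Nat.ble e c) (Nat.ble (Nat.add m e) (Nat.add c n))) with
    | false => exact ih
    | true => exact stepF_sound ih hn hN hv heq he (by show c + (m - c) < N; omega)

theorem fwdE_sound (hn : n < 7) (hN : N < 16)
    (hv : ∀ j, n < j → v j = 0) (heq : ∀ e i s, e ≤ n + 1 → i + s < N → fsum n v e i s = 0)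
    {m : ℕ} (hm : m < N) :
    ∀ c ≤ n + 1, ∀ T, Good us v T → Good us v (fwdE us.length n m c T)
  | 0, _, T, hT => hT
  | c + 1, hc, T, hT => fwdI_sound hn hN hv heq hm (by omega) _ le_rfl _
      (fwdE_sound hn hN hv heq hm c (by omega) T hT)

theorem bwdI_sound (hn : n < 7) (hN : N < 16)
    (hv : ∀ j, n < j → v j = 0) (heq : ∀ e i s, e ≤ n + 1 → i + s < N → fsum n v e i s = 0)
    {m e : ℕ} (hm : m < N) (he : e ≤ n + 1) (he1 : 1 ≤ e) :
    ∀ c ≤ m + 1, ∀ T, Good us v T → Good us v (bwdI us.length n m e c T)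
  | 0, _, T, hT => hT
  | c + 1, hc, T, hT => by
    have ih := bwdI_sound hn hN hv heq hm he he1 c (by omega) T hT
    have e1 : bwdI us.length n m e (c + 1) T = Bool.rec (motive := fun _ => Tr)
      (bwdI us.length n m e c T)
      (forceT (bwdI us.length n m e c T) fun T => stepB us.length n T e c (Nat.sub m c))
      (and (Nat.blt c e) (Nat.blt (Nat.add c n) (Nat.add m e))) := rfl
    rw [e1, forceT_eq]
    cases (and (Nat.blt c e) (Nat.blt (Nat.add c n) (Nat.add m e))) with
    | false => exact ih
    | true => exact stepB_sound ih hn hN hv heq he he1 (by show c + (m - c) < N; omega)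

theorem bwdE_sound (hn : n < 7) (hN : N < 16)
    (hv : ∀ j, n < j → v j = 0) (heq : ∀ e i s, e ≤ n + 1 → i + s < N → fsum n v e i s = 0)
    {m : ℕ} (hm : m < N) :
    ∀ c ≤ n + 1, ∀ T, Good us v T → Good us v (bwdE us.length n m c T)
  | 0, _, T, hT => hT
  | c + 1, hc, T, hT => bwdI_sound hn hN hv heq hm (by show n + 1 - c ≤ n + 1; omega)
      (by show 1 ≤ n + 1 - c; omega) _ le_rfl _
      (bwdE_sound hn hN hv heq hm c (by omega) T hT)

theorem loopM_sound (hn : n < 7) (hN : N < 16)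
    (hv : ∀ j, n < j → v j = 0) (heq : ∀ e i s, e ≤ n + 1 → i + s < N → fsum n v e i s = 0) :
    ∀ c ≤ N, ∀ T, Good us v T → Good us v (loopM us.length n c T)
  | 0, _, T, hT => hT
  | c + 1, hc, T, hT => by
    have ih := loopM_sound hn hN hv heq c (by omega) T hT
    have e1 : loopM us.length n (c + 1) T = forceT (loopM us.length n c T) fun T =>
      bwdE us.length n c (Nat.succ n) (fwdE us.length n c (Nat.succ n) T) := rfl
    rw [e1, forceT_eq]
    exact bwdE_sound hn hN hv heq (by omega) _ le_rfl _
      (fwdE_sound hn hN hv heq (by omega) _ le_rfl _ ih)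

/-- Values of the parameters. -/
def parms (v : ℕ → ℕ → ℕ → F31) (L : List (ℕ × ℕ)) : List F31 := L.map fun p => v p.1 0 p.2

theorem Rp.shift {us : List F31} {b x : ℕ} {w : F31} (h : Rp us b x w) (u : F31) :
    Rp (u :: us) b (x * 16777216) w :=
  ⟨0, x, w, by omega, by ring, by simp, h⟩

theorem Rp.append (pre : List F31) {us : List F31} {b x : ℕ} {w : F31} (h : Rp us b x w) :
    Rp (pre ++ us) b (x * 16777216 ^ pre.length) w := by
  induction pre with
  | nil => simpa using h
  | cons u pre ih => 
    have := ih.shift u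
    rw [List.cons_append, List.length_cons, pow_succ, ← mul_assoc]
    exact this

theorem insFree_sound : ∀ (L : List (ℕ × ℕ)) (pre : List F31) (T : Tr),
    (∀ p ∈ L, p.1 < 8) → us = pre ++ parms v L → Good us v T →
    Good us v (insFree L (16777216 ^ pre.length) T)
  | [], _, T, _, _, hT => hT
  | (j, S) :: L, pre, T, hL, hus, hT => by
    rw [insFree]
    have := insFree_sound L (pre ++ [v j 0 S])
      (tins (jkey j 0 S) (16777216 ^ pre.length) 11 (jkey j 0 S) T)
      (fun p hp => hL p (List.mem_cons_of_mem _ hp)) (by rw [hus]; simp [parms])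
      (by
        refine tins_sound ?_ _ _ _ hT
        rw [vkey_jkey v (hL (j, S) (by simp)) (by norm_num), hus]
        have h1 : Rp (v j 0 S :: parms v L) 30 1 (v j 0 S) :=
          ⟨1, 0, 0, by norm_num, by norm_num, by simp, (Rp.zero _).mono (by norm_num)⟩
        have h2 := h1.append pre
        rw [one_mul] at h2
        exact h2)
    simpa [pow_succ] using this

theorem residual_sound {T : Tr} (hT : Good us v T) (hn : n < 7) (hN : N < 16)
    (hv : ∀ j, n < j → v j = 0) (heq : ∀ e i s, e ≤ n + 1 → i + s < N → fsum n v e i s = 0)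
    {i s : ℕ} (his : i + s < N) : Rp us 30 (residual us.length n T i s) 0 := by
  have h := genT_sound hT (w := min 1 (n + 1)) (dx := 0) (dy := 1) (j := n) (i := i) (s := s)
    (by omega) hv (by omega) top6 (genT_sound hT (w := 1) (dx := 1) (dy := 0) (j := n + 1) (i := i) (s := s)
      (by omega) hv (by omega) top3
    (base_sound hT (e := n + 1) (i := i) (s := s) (by omega) hv (by omega)))
  have hz := heq (n + 1) i s le_rfl his
  have hz' : bsum n v (n + 1) i s + gsum v 1 1 0 (n + 1) i s top3 +
    gsum v (min 1 (n + 1)) 0 1 n i s top6 = 0 := hz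
  rw [hz'] at h
  have e : residual us.length n T i s = ORow.rec (motive := fun _ => ℕ) 0
    (fun x => norm us.length x)
    (genT n T (min 1 (n + 1)) 0 1 n i s top6
      (genT n T 1 1 0 (n + 1) i s top3 (base n T (n + 1) i s))) := rfl
  rw [e]
  revert h
  generalize (genT n T (min 1 (n + 1)) 0 1 n i s top6
      (genT n T 1 1 0 (n + 1) i s top3 (base n T (n + 1) i s))) = a
  intro h
  cases a with
  | none => exact (Rp.zero _).mono (by norm_num)
  | some x => exact (h x rfl).norm (by norm_num [top3, top6, Tab.len])

theorem residuals_sound {T : Tr} (hT : Good us v T) (hn : n < 7) (hN : N < 16)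
    (hv : ∀ j, n < j → v j = 0) (heq : ∀ e i s, e ≤ n + 1 → i + s < N → fsum n v e i s = 0) :
    ∀ (L : List (ℕ × ℕ)) (f : List ℕ → Bool), (∀ p ∈ L, p.1 + p.2 < N) →
      residuals us.length n T L f = true →
      ∃ l, f l = true ∧ l.length = L.length ∧ ∀ x ∈ l, Rp us 30 x 0
  | [], f, _, h => ⟨[], h, rfl, by simp⟩
  | (i, s) :: L, f, hL, h => by
    rw [residuals, force_eq] at h
    obtain ⟨l, h1, h2, h3⟩ := residuals_sound hT hn hN hv heq L _
      (fun p hp => hL p (List.mem_cons_of_mem _ hp)) h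
    refine ⟨_ :: l, h1, by simp [h2], ?_⟩
    intro x hx
    rcases List.mem_cons.1 hx with rfl | hx
    · exact residual_sound hT hn hN hv heq (hL (i, s) (by simp))
    · exact h3 x hx

theorem comb_sound : ∀ (l : List ℕ) (c : ℕ), (∀ x ∈ l, Rp us 30 x 0) →
    Rp us (1000 * l.length) (comb l c) 0
  | [], _, _ => Rp.zero us
  | x :: l, c, h => by
    have h1 := (comb_sound l (c / 32) fun y hy => h y (List.mem_cons_of_mem _ hy)).addMul
      (h x (by simp)) (c % 32)
    have e : comb (x :: l) c = comb l (c / 32) + c % 32 * x := by rw [comb]; ring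
    rw [e]
    have := h1.mono (b' := 1000 * (x :: l).length) (by
      have : c % 32 < 32 := Nat.mod_lt _ (by norm_num)
      rw [List.length_cons]; omega)
    simpa using this

theorem units_sound {l : List ℕ} (hl : ∀ x ∈ l, Rp us 30 x 0) (hlen : l.length < 1000) :
    ∀ (L : List ℕ) (t : ℕ), units us.length l L t = true →
      ∀ k, t ≤ k → k < us.length → us.getD k 0 = 0
  | [], t, h, k, h1, h2 => by
    have : t = us.length := Nat.eq_of_beq_eq_true h
    omega
  | c :: L, t, h, k, h1, h2 => by
    rw [units, Bool.and_eq_true] at h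
    rcases h1.eq_or_lt with rfl | h1
    · exact ((comb_sound l c hl).unit (by omega) h.1).symm
    · exact units_sound hl hlen L (t + 1) h.2 k h1 h2

theorem Rp.eq_zero {b x : ℕ} {w : F31} (hus : ∀ u ∈ us, u = 0) (h : Rp us b x w) : w = 0 := by
  induction us generalizing x w with
  | nil => exact h.2
  | cons u us ih =>
    obtain ⟨f, x', w', h1, h2, h3, h4⟩ := h
    rw [h3, hus u (by simp), ih (fun u hu => hus u (List.mem_cons_of_mem _ hu)) h4]
    simp

theorem check_sound {cons : List (ℕ × ℕ)} {cert : List ℕ} (hn : n < 7) (hN : N < 16)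
    (hcons : ∀ p ∈ cons, p.1 + p.2 < N) (hlen : cons.length < 900)
    (hc : check n N cons cert = true)
    (hv : ∀ j, n < j → v j = 0) (heq : ∀ e i s, e ≤ n + 1 → i + s < N → fsum n v e i s = 0)
    (h0 : n % 2 = 0 → v 0 0 0 = 0) : ∀ j I S, j ≤ n → I + S ≤ N → v j I S = 0 := by
  obtain ⟨us, hus⟩ : ∃ us, us = parms v (freeList n) := ⟨_, rfl⟩
  have hD : (freeList n).length = us.length := by rw [hus, parms, List.length_map]
  have hfree : ∀ p ∈ freeList n, p.1 < 8 := by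
    intro p hp
    simp only [freeList, List.mem_flatMap, List.mem_map, List.mem_range] at hp
    obtain ⟨S, hS, j, hj, rfl⟩ := hp
    show j < 8
    omega
  have hG : Good us v (loopM us.length n N (insFree (freeList n) 1 Tr.leaf)) := by
    refine loopM_sound hn hN hv heq N le_rfl _ ?_
    have := insFree_sound (us := us) (v := v) (freeList n) [] Tr.leaf hfree (by simpa using hus) trivial
    simpa using this
  unfold check at hc
  simp only [hD] at hc
  generalize loopM us.length n N (insFree (freeList n) 1 Tr.leaf) = T at hG hc
  have hfin : present n N T = true ∧ residuals us.length n T cons (fun l =>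
      units us.length (bif Nat.beq (n % 2) 0 then 1 :: l else l) cert 0) = true := by
    cases T with
    | leaf => cases hc
    | tip _ _ => cases hc
    | node l r => exact Bool.and_eq_true _ _ ▸ hc
  obtain ⟨hp, hr⟩ := hfin
  obtain ⟨l, h1, h2, h3⟩ := residuals_sound hG hn hN hv heq cons _ hcons hr
  have husz : ∀ u ∈ us, u = 0 := by
    have hk : ∀ k, 0 ≤ k → k < us.length → us.getD k 0 = 0 := by
      by_cases hpar : n % 2 = 0
      · have e : Nat.beq (n % 2) 0 = true := by rw [hpar]; rfl
        simp only [e, cond_true] at h1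
        refine units_sound (l := 1 :: l) ?_ (by simp; omega) cert 0 h1
        intro x hx
        rcases List.mem_cons.1 hx with rfl | hx
        · have hf : ∃ L, freeList n = (0, 0) :: L := by
            simp [freeList, List.range_succ_eq_map]
          obtain ⟨L, hL⟩ := hf
          rw [hus, hL]
          exact ⟨1, 0, 0, by norm_num, by norm_num, by simp [h0 hpar],
            (Rp.zero _).mono (by norm_num)⟩
        · exact h3 x hx
      · have e : Nat.beq (n % 2) 0 = false := by
          rw [Bool.eq_false_iff]; intro h; exact hpar (Nat.eq_of_beq_eq_true h)
        simp only [e, cond_false] at h1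
        exact units_sound (l := l) h3 (by omega) cert 0 h1
    intro u hu
    obtain ⟨k, hk1, rfl⟩ := List.mem_iff_getElem.1 hu
    have := hk k (Nat.zero_le _) hk1
    simpa [hk1] using this
  intro j I S hj hIS
  have hq : ∃ x, tget (jkey j I S) 11 (jkey j I S) T = .some x := by
    simp only [present, List.all_eq_true, List.mem_range] at hp
    have := hp j (by omega) I (by omega) S (by omega)
    cases h : tget (jkey j I S) 11 (jkey j I S) T with
    | none => rw [h] at this; cases this
    | some x => exact ⟨x, rfl⟩
  obtain ⟨x, hx⟩ := hq
  have := tget_sound _ _ _ hG hx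
  rw [vkey_jkey v (by omega) (by omega)] at this
  exact this.eq_zero husz

end Loops

/-! ### Part 3: the jet system over a commutative ring -/

section JetSystem

variable {R : Type*} [CommRing R]

/-- One term of the jet system. -/
def term (τ : ℕ → ℕ → R) (w dx dy : ℕ) (f : ℕ → ℕ → R) (i s : ℕ) : R :=
  w * ∑ k ∈ range (i + 1), ∑ l ∈ range (s + 1),
    τ k l * (((1 + dx * (i - k)) * (1 + dy * (s - l)) : ℕ) : R) * f (i - k + dx) (s - l + dy)

/-- The jet system. -/
def rowval (n : ℕ) (τ : Fin 6 → ℕ → ℕ → R) (v : ℕ → ℕ → ℕ → R) (e i s : ℕ) : R :=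
  term (τ 0) (n - e) 0 0 (v e) i s
  + term (τ 1) ((n + 2 - e) * min 1 (e - 1)) 0 0 (v (e - 2)) i s
  + term (τ 2) 1 1 0 (v e) i s
  + term (τ 3) (e + 1) 0 0 (v (e + 1)) i s
  + term (τ 4) (e - 1) 0 0 (v (e - 1)) i s
  + term (τ 5) (min 1 e) 0 1 (v (e - 1)) i s

theorem term_sum {ι : Type*} (S : Finset ι) (c : ι → R) (g : ι → ℕ → ℕ → R) (τ : ℕ → ℕ → R)
    (w dx dy i s : ℕ) : term τ w dx dy (fun I J => ∑ p ∈ S, c p * g p I J) i s =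
      ∑ p ∈ S, c p * term τ w dx dy (g p) i s := by
  unfold term
  simp only [Finset.mul_sum]
  rw [Finset.sum_comm (s := S)]
  refine Finset.sum_congr rfl fun k _ => ?_
  rw [Finset.sum_comm (s := S)]
  refine Finset.sum_congr rfl fun l _ => Finset.sum_congr rfl fun p _ => ?_
  ring

theorem rowval_sum {ι : Type*} (S : Finset ι) (c : ι → R) (g : ι → ℕ → ℕ → ℕ → R)
    (n : ℕ) (τ : Fin 6 → ℕ → ℕ → R) (e i s : ℕ) :
    rowval n τ (fun j I J => ∑ p ∈ S, c p * g p j I J) e i s =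
      ∑ p ∈ S, c p * rowval n τ (g p) e i s := by
  unfold rowval
  simp only [term_sum, mul_add, Finset.sum_add_distrib]

theorem term_map {R' : Type*} [CommRing R'] (φ : R →+* R') (τ : ℕ → ℕ → R) (w dx dy : ℕ)
    (f : ℕ → ℕ → R) (i s : ℕ) : φ (term τ w dx dy f i s) =
      term (fun k l => φ (τ k l)) w dx dy (fun I J => φ (f I J)) i s := by
  simp [term]

theorem rowval_map {R' : Type*} [CommRing R'] (φ : R →+* R') (n : ℕ) (τ : Fin 6 → ℕ → ℕ → R)
    (v : ℕ → ℕ → ℕ → R) (e i s : ℕ) : φ (rowval n τ v e i s) =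
      rowval n (fun t k l => φ (τ t k l)) (fun j I J => φ (v j I J)) e i s := by
  simp [rowval, term_map]

theorem term_congr {τ : ℕ → ℕ → R} {w dx dy : ℕ} {f g : ℕ → ℕ → R} {i s : ℕ}
    (h : ∀ I J, I + J ≤ i + s + dx + dy → f I J = g I J) :
    term τ w dx dy f i s = term τ w dx dy g i s := by
  unfold term
  congr 1
  refine Finset.sum_congr rfl fun k _ => Finset.sum_congr rfl fun l _ => ?_
  rw [h _ _ (by omega)]

theorem rowval_congr {n : ℕ} {τ : Fin 6 → ℕ → ℕ → R} {v v' : ℕ → ℕ → ℕ → R} {e i s : ℕ}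
    (h : ∀ j I J, I + J ≤ i + s + 1 → v j I J = v' j I J) :
    rowval n τ v e i s = rowval n τ v' e i s := by
  unfold rowval
  congr 1; congr 1; congr 1; congr 1; congr 1
  all_goals exact term_congr fun I J hIJ => h _ _ _ (by omega)

end JetSystem

/-- A matrix that is injective modulo `31` is injective over the reals. -/
theorem lift_injective {ι κ : Type*} [Fintype ι] [Fintype κ] [DecidableEq ι] [DecidableEq κ]
    (M : Matrix κ ι ℤ)
    (h : ∀ v : ι → F31, (M.map (Int.cast : ℤ → F31)).mulVec v = 0 → v = 0) (v : ι → ℝ)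
    (hv : (M.map (Int.cast : ℤ → ℝ)).mulVec v = 0) : v = 0 := by
  haveI : Fact (Nat.Prime 31) := ⟨by norm_num⟩
  obtain ⟨L, hL⟩ : ∃ L : Matrix ι κ F31, L * M.map (Int.cast : ℤ → F31) = 1 := by
    have hinj : LinearMap.ker (Matrix.toLin' (M.map (Int.cast : ℤ → F31))) = ⊥ := by
      rw [LinearMap.ker_eq_bot']
      exact h
    obtain ⟨g, hg⟩ := LinearMap.exists_leftInverse_of_injective _ hinj
    refine ⟨LinearMap.toMatrix' g, ?_⟩
    have := congrArg LinearMap.toMatrix' hg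
    rw [LinearMap.toMatrix'_comp, LinearMap.toMatrix'_toLin', LinearMap.toMatrix'_id] at this
    exact this
  let L' : Matrix ι κ ℤ := L.map fun a => (a.val : ℤ)
  have hL' : L'.map (Int.cast : ℤ → F31) = L := by
    ext a b; simp [L']
  have hdet : (L' * M).det ≠ 0 := by
    intro h0
    have h1 : (((L' * M).det : ℤ) : F31) = 1 := by
      have e1 : (((L' * M).det : ℤ) : F31) = ((L' * M).map (Int.castRingHom F31)).det := by
        rw [← RingHom.mapMatrix_apply, ← RingHom.map_det]; rfl
      have e2 : (L' * M).map (Int.castRingHom F31) =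
          L'.map (Int.cast : ℤ → F31) * M.map (Int.cast : ℤ → F31) := by
        rw [Matrix.map_mul]; rfl
      rw [e1, e2, hL', hL, Matrix.det_one]
    rw [h0] at h1
    simp at h1
  have hdetR : ((L' * M).map (Int.castRingHom ℝ)).det ≠ 0 := by
    rw [← RingHom.mapMatrix_apply, ← RingHom.map_det]
    simpa using hdet
  have hz : ((L' * M).map (Int.castRingHom ℝ)).mulVec v = 0 := by
    rw [Matrix.map_mul, ← Matrix.mulVec_mulVec]
    have : (M.map (Int.castRingHom ℝ)).mulVec v = 0 := hv
    rw [this, Matrix.mulVec_zero]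
  exact Matrix.eq_zero_of_mulVec_eq_zero hdetR hz

/-- Integer tables. -/
abbrev ZTab := List (ℕ × ℕ × ℤ)

/-- The entry of a table. -/
def ztau (L : ZTab) (k l : ℕ) : ℤ :=
  (L.map fun p => if p.1 = k ∧ p.2.1 = l then p.2.2 else 0).sum

/-- The tables of the coefficients at the point `(2, 0)`. -/
def ztab : Fin 6 → ZTab
  | 0 => [(0,0,6),(1,0,23),(0,2,12),(2,0,28),(1,2,25),(3,0,13),(2,2,16),(4,0,2),(3,2,3)]
  | 1 => [(0,0,-6),(1,0,-7),(0,2,12),(2,0,-4),(1,2,11),(3,0,-1),(0,4,-6),(2,2,4),(1,4,-4),(3,2,1)]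
  | 2 => [(0,0,-36),(1,0,-132),(0,2,9),(2,0,-193),(1,2,24),(3,0,-144),(2,2,22),(4,0,-58),(3,2,8),
      (5,0,-12),(4,2,1),(6,0,-1)]
  | 3 => [(0,1,-27),(1,1,-72),(2,1,-66),(3,1,-24),(4,1,-3)]
  | 4 => [(0,1,-21),(1,1,-40),(0,3,12),(2,1,-26),(1,3,16),(3,1,-8),(2,3,4),(4,1,-1)]
  | 5 => [(0,0,-12),(1,0,-28),(0,2,15),(2,0,-23),(1,2,32),(3,0,-8),(0,4,-3),(2,2,24),(4,0,-1),
      (1,4,-4),(3,2,8),(2,4,-1),(4,2,1)]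

/-- The two kinds of tables agree. -/
def Match : ZTab → Tab → Bool
  | [], .nil => true
  | (k, l, c) :: L, .cons k' l' c' t =>
    decide (k = k' ∧ l = l' ∧ (c - c') % 31 = 0) && Match L t
  | _, _ => false

theorem gsum_eq (v : ℕ → ℕ → ℕ → F31) (w dx dy j i s : ℕ) : ∀ (L : ZTab) (tab : Tab),
    Match L tab = true →
    gsum v w dx dy j i s tab = term (fun k l => ((ztau L k l : ℤ) : F31)) w dx dy (v j) i s
  | [], .nil, _ => by simp [gsum, term, ztau]
  | [], .cons _ _ _ _, h => by simp [Match] at h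
  | _ :: _, .nil, h => by simp [Match] at h
  | (k, l, c) :: L, .cons k' l' c' t, h => by
    simp only [Match, Bool.and_eq_true, decide_eq_true_eq] at h
    obtain ⟨⟨rfl, rfl, hc⟩, h⟩ := h
    have hcc : (c : F31) = (c' : F31) := by
      have := (ZMod.intCast_zmod_eq_zero_iff_dvd (c - c') 31).2 (by omega)
      push_cast at this
      exact sub_eq_zero.1 this
    rw [gsum, gsum_eq v w dx dy j i s L t h]
    unfold term
    have e : ∀ a b, ((ztau ((k, l, c) :: L) a b : ℤ) : F31) =
      (if k = a ∧ l = b then (c' : F31) else 0) + ((ztau L a b : ℤ) : F31) := by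
      intro a b
      simp only [ztau, List.map_cons, List.sum_cons]
      push_cast
      rw [hcc]
    simp only [e, add_mul, Finset.sum_add_distrib, mul_add]
    congr 1
    have hite : ∀ a b, (if k = a ∧ l = b then (c' : F31) else 0) =
      if k = a then (if l = b then (c' : F31) else 0) else 0 := by
      intro a b; by_cases h1 : k = a <;> by_cases h2 : l = b <;> simp [h1, h2]
    simp only [hite, ite_mul, zero_mul, Finset.sum_ite_irrel, Finset.sum_const_zero,
      Finset.sum_ite_eq, Finset.mem_range]
    by_cases h1 : k ≤ i <;> by_cases h2 : l ≤ s <;>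
      simp [h1, h2, Nat.lt_succ_iff] <;> ring

theorem fsum_eq (n : ℕ) (v : ℕ → ℕ → ℕ → F31) (e i s : ℕ) :
    fsum n v e i s = rowval n (fun t k l => ((ztau (ztab t) k l : ℤ) : F31)) v e i s := by
  unfold rowval
  rw [← gsum_eq v _ _ _ _ _ _ (ztab 0) tab1 (by decide),
    ← gsum_eq v _ _ _ _ _ _ (ztab 1) tab2 (by decide),
    ← gsum_eq v _ _ _ _ _ _ (ztab 2) (.cons 0 0 26 tab3) (by decide),
    ← gsum_eq v _ _ _ _ _ _ (ztab 3) tab4 (by decide),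
    ← gsum_eq v _ _ _ _ _ _ (ztab 4) tab5 (by decide),
    ← gsum_eq v _ _ _ _ _ _ (ztab 5) (.cons 0 0 19 tab6) (by decide)]
  unfold fsum bsum
  rw [gsum.eq_2 v 1 1 0 e i s 0 0 26 tab3, gsum.eq_2 v _ 0 1 _ i s 0 0 19 tab6, top3, top6,
    gsum.eq_2, gsum.eq_2]
  simp only [gsum]
  ring

/-- The main algebraic fact: a real solution of the jet system at `(2, 0)` vanishes. -/
theorem jets_vanish {n N : ℕ} {cons : List (ℕ × ℕ)} {cert : List ℕ} (hn : n < 7) (hN : N < 16)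
    (hcons : ∀ p ∈ cons, p.1 + p.2 < N) (hlen : cons.length < 900)
    (hc : check n N cons cert = true) (v : ℕ → ℕ → ℕ → ℝ)
    (hv : ∀ j, n < j → v j = 0)
    (heq : ∀ e i s, e ≤ n + 1 → i + s < N →
      rowval n (fun t k l => ((ztau (ztab t) k l : ℤ) : ℝ)) v e i s = 0)
    (h0 : n % 2 = 0 → v 0 0 0 = 0) : ∀ j I S, I + S ≤ N → v j I S = 0 := by
  classical
  let s : Finset (ℕ × ℕ × ℕ) :=
    (range (n + 1) ×ˢ range (N + 1) ×ˢ range (N + 1)).filter fun p => p.2.1 + p.2.2 ≤ N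
  have hs : ∀ j I S, (j, I, S) ∈ s ↔ j ≤ n ∧ I + S ≤ N := by
    intro j I S
    simp only [s, Finset.mem_filter, Finset.mem_product, Finset.mem_range]
    omega
  let q : Finset (ℕ × ℕ × ℕ) :=
    (range (n + 2) ×ˢ range N ×ˢ range N).filter fun p => p.2.1 + p.2.2 < N
  have hq : ∀ e i a, (e, i, a) ∈ q ↔ e ≤ n + 1 ∧ i + a < N := by
    intro j I S
    simp only [q, Finset.mem_filter, Finset.mem_product, Finset.mem_range]
    omega
  let dl : (ℕ × ℕ × ℕ) → ℕ → ℕ → ℕ → ℤ := fun p j I S => if p = (j, I, S) then 1 else 0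
  let nrm : ℤ := if n % 2 = 0 then 1 else 0
  let M : Matrix (Option q) s ℤ := fun k p => match k with
    | none => nrm * dl p.1 0 0 0
    | some k => rowval n (fun t k l => ztau (ztab t) k l) (dl p.1) k.1.1 k.1.2.1 k.1.2.2
  -- evaluation of the matrix
  have hM : ∀ (R : Type) [CommRing R] (w : s → R) (v : ℕ → ℕ → ℕ → R),
      (∀ p : s, v p.1.1 p.1.2.1 p.1.2.2 = w p) → (∀ j, n < j → v j = 0) →
      (∀ k : q, (M.map (Int.cast : ℤ → R)).mulVec w (some k) =
        rowval n (fun t k l => ((ztau (ztab t) k l : ℤ) : R)) v k.1.1 k.1.2.1 k.1.2.2) ∧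
      (M.map (Int.cast : ℤ → R)).mulVec w none = (nrm : R) * v 0 0 0 := by
    intro R _ w v hw hv
    have hexp : ∀ j I S, I + S ≤ N →
        v j I S = ∑ p : s, w p * ((dl p.1 j I S : ℤ) : R) := by
      intro j I S hIS
      by_cases hj : j ≤ n
      · rw [Finset.sum_eq_single (⟨(j, I, S), (hs j I S).2 ⟨hj, hIS⟩⟩ : s)]
        · rw [← hw]; simp [dl]
        · intro p _ hp
          have : p.1 ≠ (j, I, S) := fun h => hp (Subtype.ext h)
          simp [dl, this]
        · simp
      · rw [hv j (by omega)]
        symm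
        refine Finset.sum_eq_zero fun p _ => ?_
        have : p.1 ≠ (j, I, S) := fun h => by
          have h2 := p.2; rw [h, hs] at h2; omega
        simp [dl, this]
    constructor
    · intro k
      have hk := (hq k.1.1 k.1.2.1 k.1.2.2).1 k.2
      rw [rowval_congr (v' := fun j I S => ∑ p : s, w p * ((dl p.1 j I S : ℤ) : R))
        (fun j I S h => hexp j I S (by omega)), rowval_sum]
      simp only [Matrix.mulVec, dotProduct, Matrix.map_apply]
      refine Finset.sum_congr rfl fun p _ => ?_
      rw [mul_comm]
      congr 1
      exact rowval_map (Int.castRingHom R) n _ _ _ _ _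
    · rw [hexp 0 0 0 (by omega)]
      simp only [Matrix.mulVec, dotProduct, Matrix.map_apply, Finset.mul_sum]
      refine Finset.sum_congr rfl fun p _ => ?_
      simp only [M]
      push_cast
      ring
  have hmod : ∀ w : s → F31, (M.map (Int.cast : ℤ → F31)).mulVec w = 0 → w = 0 := by
    intro w hw
    let v' : ℕ → ℕ → ℕ → F31 := fun j I S => if h : (j, I, S) ∈ s then w ⟨_, h⟩ else 0
    have h1 : ∀ p : s, v' p.1.1 p.1.2.1 p.1.2.2 = w p := by
      intro p; simp [v']
    have h2 : ∀ j, n < j → v' j = 0 := by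
      intro j hj; funext I S
      have : (j, I, S) ∉ s := by rw [hs]; omega
      simp [v', this]
    obtain ⟨h3, h4⟩ := hM F31 w v' h1 h2
    have := check_sound hn hN hcons hlen hc h2 (fun e i a he hia => by
      rw [fsum_eq, ← h3 ⟨(e, i, a), (hq e i a).2 ⟨he, hia⟩⟩, hw]; rfl)
      (fun hpar => by
        rw [hw] at h4
        have : nrm = 1 := by simp [nrm, hpar]
        rw [this] at h4
        simpa using h4.symm)
    funext p
    rw [← h1]
    have h5 := (hs p.1.1 p.1.2.1 p.1.2.2).1 p.2
    exact this _ _ _ h5.1 h5.2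
  let w : s → ℝ := fun p => v p.1.1 p.1.2.1 p.1.2.2
  obtain ⟨h3, h4⟩ := hM ℝ w v (fun _ => rfl) hv
  have hw : w = 0 := by
    refine lift_injective M hmod w ?_
    funext k
    cases k with
    | none =>
      rw [h4]
      by_cases hpar : n % 2 = 0
      · rw [h0 hpar]; simp
      · simp [nrm, hpar]
    | some k =>
      have hk := (hq k.1.1 k.1.2.1 k.1.2.2).1 k.2
      rw [h3, heq _ _ _ hk.1 hk.2]; rfl
  intro j I S hIS
  by_cases hj : j ≤ n
  · exact congrFun hw ⟨(j, I, S), (hs j I S).2 ⟨hj, hIS⟩⟩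
  · rw [hv j (by omega)]; rfl

/-! ### Part 4: the ring of smooth functions of two variables -/

/-- The domain in the `(x, y)` plane. -/
def U2 : Set (ℝ × ℝ) := {q | 1 < q.1 ∧ -1 < q.2 ∧ q.2 < 1}

theorem isOpen_U2 : IsOpen U2 := by
  refine IsOpen.inter (isOpen_lt continuous_const continuous_fst) ?_
  exact IsOpen.inter (isOpen_lt continuous_const continuous_snd)
    (isOpen_lt continuous_snd continuous_const)

theorem convex_U2 : Convex ℝ U2 := by
  have : U2 = Set.Ioi 1 ×ˢ Set.Ioo (-1) 1 := by
    ext q; simp [U2, Set.mem_prod]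
  rw [this]
  exact (convex_Ioi 1).prod (convex_Ioo _ _)

open Classical in
/-- Extension by zero. -/
def ext0 (f : U2 → ℝ) (q : ℝ × ℝ) : ℝ := if h : q ∈ U2 then f ⟨q, h⟩ else 0

theorem ext0_apply (f : U2 → ℝ) (q : U2) : ext0 f q.1 = f q := by
  simp [ext0]

theorem ext0_of_mem (f : U2 → ℝ) {q : ℝ × ℝ} (h : q ∈ U2) : ext0 f q = f ⟨q, h⟩ := by
  simp [ext0, h]

/-- The ring of smooth functions on `U2`. -/
def SF : Subalgebra ℝ (U2 → ℝ) where
  carrier := {f | ContDiffOn ℝ (⊤ : ℕ∞) (ext0 f) U2}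
  mul_mem' {a b} ha hb := (ContDiffOn.mul ha hb).congr fun q hq => by simp [ext0_of_mem _ hq]
  add_mem' {a b} ha hb := (ContDiffOn.add ha hb).congr fun q hq => by simp [ext0_of_mem _ hq]
  algebraMap_mem' r := (contDiffOn_const (c := r)).congr fun q hq => by
    simp [ext0_of_mem _ hq]

/-- The smooth function determined by a function on the plane. -/
def mkSF (f : ℝ × ℝ → ℝ) (hf : ContDiffOn ℝ (⊤ : ℕ∞) f U2) : SF :=
  ⟨fun q => f q.1, ContDiffOn.congr hf fun q hq => by simp [ext0_of_mem _ hq]⟩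

/-- Evaluation at a point. -/
def evq (q : U2) : SF →+* ℝ := (Pi.evalRingHom (fun _ : U2 => ℝ) q).comp SF.val.toRingHom

theorem evq_apply (q : U2) (f : SF) : evq q f = f.1 q := rfl

theorem SF_ext {f g : SF} (h : ∀ q, evq q f = evq q g) : f = g :=
  Subtype.ext (funext h)

theorem evq_mk (q : U2) (f : ℝ × ℝ → ℝ) (hf : ContDiffOn ℝ (⊤ : ℕ∞) f U2) :
    evq q (mkSF f hf) = f q.1 := rfl

theorem SF_diff (f : SF) (q : U2) : DifferentiableAt ℝ (ext0 f.1) q.1 :=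
  (ContDiffOn.differentiableOn f.2 (by simp)).differentiableAt (isOpen_U2.mem_nhds q.2)

/-- The directional derivative. -/
def dir (w : ℝ × ℝ) : Derivation ℝ SF SF where
  toFun f := ⟨fun q => fderiv ℝ (ext0 f.1) q.1 w, by
    have h : ContDiffOn ℝ (⊤ : ℕ∞) (fun q => fderiv ℝ (ext0 f.1) q w) U2 :=
      (ContDiffOn.fderiv_of_isOpen f.2 isOpen_U2 (m := (⊤ : ℕ∞)) (by simp)).clm_apply
        contDiffOn_const
    exact h.congr fun q hq => by simp [ext0_of_mem _ hq]⟩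
  map_add' f g := by
    refine Subtype.ext (funext fun q => ?_)
    have : ext0 (f + g).1 =ᶠ[nhds q.1] fun p => ext0 f.1 p + ext0 g.1 p := by
      filter_upwards [isOpen_U2.mem_nhds q.2] with p hp
      simp [ext0_of_mem _ hp]
    show fderiv ℝ (ext0 (f + g).1) q.1 w = fderiv ℝ (ext0 f.1) q.1 w + fderiv ℝ (ext0 g.1) q.1 w
    rw [this.fderiv_eq, fderiv_fun_add (SF_diff f q) (SF_diff g q)]
    rfl
  map_smul' c f := by
    refine Subtype.ext (funext fun q => ?_)
    have : ext0 (c • f).1 =ᶠ[nhds q.1] fun p => c • ext0 f.1 p := by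
      filter_upwards [isOpen_U2.mem_nhds q.2] with p hp
      simp [ext0_of_mem _ hp]
    show fderiv ℝ (ext0 (c • f).1) q.1 w = c • fderiv ℝ (ext0 f.1) q.1 w
    rw [this.fderiv_eq, fderiv_fun_const_smul (SF_diff f q)]
    rfl
  map_one_eq_zero' := by
    refine Subtype.ext (funext fun q => ?_)
    have : ext0 (1 : SF).1 =ᶠ[nhds q.1] fun p => 1 := by
      filter_upwards [isOpen_U2.mem_nhds q.2] with p hp
      simp [ext0_of_mem _ hp]
    show fderiv ℝ (ext0 (1 : SF).1) q.1 w = 0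
    rw [this.fderiv_eq]
    simp
  leibniz' f g := by
    refine Subtype.ext (funext fun q => ?_)
    have : ext0 (f * g).1 =ᶠ[nhds q.1] fun p => ext0 f.1 p * ext0 g.1 p := by
      filter_upwards [isOpen_U2.mem_nhds q.2] with p hp
      simp [ext0_of_mem _ hp]
    show fderiv ℝ (ext0 (f * g).1) q.1 w =
      f.1 q * fderiv ℝ (ext0 g.1) q.1 w + g.1 q * fderiv ℝ (ext0 f.1) q.1 w
    rw [this.fderiv_eq, fderiv_fun_mul (SF_diff f q) (SF_diff g q)]
    simp [ext0_apply]

theorem evq_dir (q : U2) (w : ℝ × ℝ) (f : SF) : evq q (dir w f) = fderiv ℝ (ext0 f.1) q.1 w := rfl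

theorem dir_comm (v w : ℝ × ℝ) (f : SF) : dir v (dir w f) = dir w (dir v f) := by
  refine SF_ext fun q => ?_
  have key : ∀ v w : ℝ × ℝ, evq q (dir v (dir w f)) = fderiv ℝ (fderiv ℝ (ext0 f.1)) q.1 v w := by
    intro v w
    rw [evq_dir]
    have : ext0 (dir w f).1 =ᶠ[nhds q.1] fun p => fderiv ℝ (ext0 f.1) p w := by
      filter_upwards [isOpen_U2.mem_nhds q.2] with p hp
      simp only [ext0_of_mem _ hp]
      rfl
    rw [this.fderiv_eq, fderiv_clm_apply]
    · simp
    · have h : ContDiffOn ℝ 1 (fderiv ℝ (ext0 f.1)) U2 :=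
        ContDiffOn.fderiv_of_isOpen (n := (⊤ : ℕ∞)) f.2 isOpen_U2 (by norm_cast)
      exact (h.differentiableOn (by simp)).differentiableAt (isOpen_U2.mem_nhds q.2)
    · fun_prop
  rw [key, key]
  have hc : ContDiffAt ℝ (⊤ : ℕ∞) (ext0 f.1) q.1 := ContDiffOn.contDiffAt f.2 (isOpen_U2.mem_nhds q.2)
  exact (hc.isSymmSndFDerivAt (by simpa using WithTop.coe_le_coe.2 (le_top : (2 : ℕ∞) ≤ ⊤))) v w

/-- Units. -/
theorem exists_inv (f : SF) (h : ∀ q, evq q f ≠ 0) : ∃ g : SF, f * g = 1 := by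
  refine ⟨⟨fun q => (f.1 q)⁻¹, ?_⟩, ?_⟩
  · have : ContDiffOn ℝ (⊤ : ℕ∞) (fun q => (ext0 f.1 q)⁻¹) U2 :=
      ContDiffOn.inv f.2 fun q hq => by
        rw [ext0_of_mem _ hq]; exact h ⟨q, hq⟩
    exact this.congr fun q hq => by simp [ext0_of_mem _ hq]
  · exact SF_ext fun q => mul_inv_cancel₀ (h q)

/-- Partial derivatives. -/
abbrev dX : Derivation ℝ SF SF := dir (1, 0)
/-- Partial derivatives. -/
abbrev dY : Derivation ℝ SF SF := dir (0, 1)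

theorem evq_dir_eq (q : U2) (w : ℝ × ℝ) (f : SF) :
    evq q (dir w f) = w.1 * evq q (dX f) + w.2 * evq q (dY f) := by
  simp only [evq_dir]
  have : w = w.1 • ((1 : ℝ), (0 : ℝ)) + w.2 • ((0 : ℝ), (1 : ℝ)) := by
    ext <;> simp
  conv_lhs => rw [this]
  rw [map_add, map_smul, map_smul, smul_eq_mul, smul_eq_mul]

/-- The coordinate `x`. -/
def cx : SF := mkSF Prod.fst contDiffOn_fst
/-- The coordinate `y`. -/
def cy : SF := mkSF Prod.snd contDiffOn_snd

theorem evq_cx (q : U2) : evq q cx = q.1.1 := rfl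
theorem evq_cy (q : U2) : evq q cy = q.1.2 := rfl

theorem dir_mk (w : ℝ × ℝ) (f : ℝ × ℝ → ℝ) (hf) (q : U2) :
    evq q (dir w (mkSF f hf)) = fderiv ℝ f q.1 w := by
  rw [evq_dir]
  have : ext0 (mkSF f hf).1 =ᶠ[nhds q.1] f := by
    filter_upwards [isOpen_U2.mem_nhds q.2] with p hp
    simp only [ext0_of_mem _ hp]
    rfl
  rw [this.fderiv_eq]

theorem dir_cx (w : ℝ × ℝ) : dir w cx = algebraMap ℝ SF w.1 := by
  refine SF_ext fun q => ?_
  rw [cx, dir_mk, fderiv_fst]; rfl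

theorem dir_cy (w : ℝ × ℝ) : dir w cy = algebraMap ℝ SF w.2 := by
  refine SF_ext fun q => ?_
  rw [cy, dir_mk, fderiv_snd]; rfl

theorem dX_cx : dX cx = 1 := by rw [dir_cx]; simp
theorem dX_cy : dX cy = 0 := by rw [dir_cy]; simp
theorem dY_cx : dY cx = 0 := by rw [dir_cx]; simp
theorem dY_cy : dY cy = 1 := by rw [dir_cy]; simp

/-! ### Taylor coefficients -/

/-- One-variable Taylor coefficients along a derivation. -/
def tay (d : Derivation ℝ SF SF) : ℕ → SF →ₗ[ℝ] SF
  | 0 => LinearMap.id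
  | k + 1 => ((k + 1 : ℝ)⁻¹) • (tay d k ∘ₗ d.toLinearMap)

theorem tay_succ (d : Derivation ℝ SF SF) (k : ℕ) (f : SF) :
    tay d k (d f) = ((k + 1 : ℕ) : SF) * tay d (k + 1) f := by
  have h : ((k : ℝ) + 1) ≠ 0 := by positivity
  have e : ((k + 1 : ℕ) : SF) = algebraMap ℝ SF (k + 1) := by simp
  rw [e, ← Algebra.smul_def]
  simp [tay, smul_smul, h]

theorem natmul_cancel {k : ℕ} {f g : SF} (h : ((k + 1 : ℕ) : SF) * f = ((k + 1 : ℕ) : SF) * g) :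
    f = g := by
  refine SF_ext fun q => ?_
  have := congrArg (evq q) h
  rw [map_mul, map_mul, map_natCast] at this
  exact mul_left_cancel₀ (by positivity) this

theorem tay_mul (d : Derivation ℝ SF SF) : ∀ (k : ℕ) (f g : SF),
    tay d k (f * g) = ∑ p ∈ range (k + 1), tay d p f * tay d (k - p) g
  | 0, f, g => by simp [tay]
  | k + 1, f, g => by
    refine natmul_cancel (k := k) ?_
    rw [← tay_succ, Derivation.leibniz, map_add, smul_eq_mul, smul_eq_mul, tay_mul, tay_mul]
    have e1 : ∑ p ∈ range (k + 1), tay d p f * tay d (k - p) (d g) =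
        ∑ p ∈ range (k + 2), ((k + 1 - p : ℕ) : SF) * (tay d p f * tay d (k + 1 - p) g) := by
      rw [Finset.sum_range_succ _ (k + 1)]
      simp only [Nat.sub_self, Nat.cast_zero, zero_mul, add_zero]
      refine Finset.sum_congr rfl fun p hp => ?_
      have hp := Finset.mem_range.1 hp
      rw [tay_succ, show k + 1 - p = k - p + 1 by omega]
      ring
    have e2 : ∑ p ∈ range (k + 1), tay d p g * tay d (k - p) (d f) =
        ∑ p ∈ range (k + 2), (p : SF) * (tay d p f * tay d (k + 1 - p) g) := by
      rw [← Finset.sum_range_reflect _ (k + 2), Finset.sum_range_succ _ (k + 1)]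
      simp only [show k + 2 - 1 - (k + 1) = 0 by omega, Nat.cast_zero, zero_mul, add_zero]
      refine Finset.sum_congr rfl fun p hp => ?_
      have hp := Finset.mem_range.1 hp
      rw [tay_succ, show k + 2 - 1 - p = k - p + 1 by omega, show k + 1 - (k - p + 1) = p by omega]
      ring
    rw [e1, e2, ← Finset.sum_add_distrib, Finset.mul_sum]
    refine Finset.sum_congr rfl fun p hp => ?_
    have hp := Finset.mem_range.1 hp
    rw [← add_mul, ← Nat.cast_add, show k + 1 - p + p = k + 1 by omega]

theorem tay_comm (v w : ℝ × ℝ) : ∀ (k : ℕ) (f : SF), tay (dir v) k (dir w f) = dir w (tay (dir v) k f)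
  | 0, f => rfl
  | k + 1, f => by
    refine natmul_cancel (k := k) ?_
    rw [← tay_succ, dir_comm, tay_comm v w k, tay_succ, Derivation.leibniz]
    simp

/-- Two-variable Taylor coefficients. -/
def TT (i s : ℕ) : SF →ₗ[ℝ] SF := tay dX i ∘ₗ tay dY s

theorem TT_zero (f : SF) : TT 0 0 f = f := rfl

theorem TT_dY (i s : ℕ) (f : SF) : TT i s (dY f) = ((s + 1 : ℕ) : SF) * TT i (s + 1) f := by
  rw [TT, LinearMap.comp_apply, tay_succ, ← nsmul_eq_mul, map_nsmul, nsmul_eq_mul]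
  rfl

theorem TT_dX (i s : ℕ) (f : SF) : TT i s (dX f) = ((i + 1 : ℕ) : SF) * TT (i + 1) s f := by
  rw [TT, LinearMap.comp_apply, tay_comm, tay_succ]
  rfl

theorem TT_mul (i s : ℕ) (f g : SF) : TT i s (f * g) =
    ∑ k ∈ range (i + 1), ∑ l ∈ range (s + 1), TT k l f * TT (i - k) (s - l) g := by
  rw [TT, LinearMap.comp_apply, tay_mul, map_sum, Finset.sum_comm]
  refine Finset.sum_congr rfl fun l _ => ?_
  rw [tay_mul]
  rfl

/-- Derivatives of Taylor coefficients. -/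
theorem dY_TT (i s : ℕ) (f : SF) : dY (TT i s f) = ((s + 1 : ℕ) : SF) * TT i (s + 1) f := by
  rw [← TT_dY, TT, LinearMap.comp_apply, LinearMap.comp_apply, tay_comm, tay_comm]

theorem dX_TT (i s : ℕ) (f : SF) : dX (TT i s f) = ((i + 1 : ℕ) : SF) * TT (i + 1) s f := by
  rw [← TT_dX, TT, LinearMap.comp_apply, LinearMap.comp_apply, ← tay_comm, ← tay_comm]

theorem term_eq (c f : SF) (w i s : ℕ) :
    term (fun k l => TT k l c) w 0 0 (fun I J => TT I J f) i s = TT i s ((w : SF) * (c * f)) := by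
  rw [← nsmul_eq_mul, map_nsmul, nsmul_eq_mul, TT_mul]
  simp [term]

theorem term_eq_dX (c f : SF) (w i s : ℕ) :
    term (fun k l => TT k l c) w 1 0 (fun I J => TT I J f) i s = TT i s ((w : SF) * (c * dX f)) := by
  rw [← nsmul_eq_mul, map_nsmul, nsmul_eq_mul, TT_mul]
  simp only [TT_dX, term]
  congr 1
  refine Finset.sum_congr rfl fun k _ => Finset.sum_congr rfl fun l _ => ?_
  push_cast
  ring_nf

theorem term_eq_dY (c f : SF) (w i s : ℕ) :
    term (fun k l => TT k l c) w 0 1 (fun I J => TT I J f) i s = TT i s ((w : SF) * (c * dY f)) := by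
  rw [← nsmul_eq_mul, map_nsmul, nsmul_eq_mul, TT_mul]
  simp only [TT_dY, term]
  congr 1
  refine Finset.sum_congr rfl fun k _ => Finset.sum_congr rfl fun l _ => ?_
  push_cast
  ring_nf

/-- The differential system. -/
def PDE (n : ℕ) (c : Fin 6 → SF) (A : ℕ → SF) (e : ℕ) : SF :=
  ((n - e : ℕ) : SF) * (c 0 * A e) + (((n + 2 - e) * min 1 (e - 1) : ℕ) : SF) * (c 1 * A (e - 2))
  + ((1 : ℕ) : SF) * (c 2 * dX (A e)) + ((e + 1 : ℕ) : SF) * (c 3 * A (e + 1))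
  + ((e - 1 : ℕ) : SF) * (c 4 * A (e - 1)) + ((min 1 e : ℕ) : SF) * (c 5 * dY (A (e - 1)))

theorem rowval_eq (n : ℕ) (c : Fin 6 → SF) (A : ℕ → SF) (e i s : ℕ) :
    rowval n (fun t k l => TT k l (c t)) (fun j I J => TT I J (A j)) e i s =
      TT i s (PDE n c A e) := by
  simp only [rowval, term_eq, term_eq_dX, term_eq_dY, PDE, map_add]

/-! ### Part 5: triviality of the integrals of the reduced system -/

theorem all_jets_vanish {n : ℕ} (hn1 : 1 ≤ n) (hn : n ≤ 6) (v : ℕ → ℕ → ℕ → ℝ)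
    (hv : ∀ j, n < j → v j = 0)
    (heq : ∀ e i s, e ≤ n + 1 →
      rowval n (fun t k l => ((ztau (ztab t) k l : ℤ) : ℝ)) v e i s = 0)
    (h0 : n % 2 = 0 → v 0 0 0 = 0) (j I S : ℕ) (hIS : I + S ≤ n) : v j I S = 0 := by
  interval_cases n
  · exact jets_vanish (by norm_num) (by norm_num) (by decide) (by decide) check1 v hv
      (fun e i s he _ => heq e i s he) h0 j I S (by omega)
  · exact jets_vanish (by norm_num) (by norm_num) (by decide) (by decide) check2 v hv
      (fun e i s he _ => heq e i s he) h0 j I S (by omega)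
  · exact jets_vanish (by norm_num) (by norm_num) (by decide) (by decide) check3 v hv
      (fun e i s he _ => heq e i s he) h0 j I S (by omega)
  · exact jets_vanish (by norm_num) (by norm_num) (by decide) (by decide) check4 v hv
      (fun e i s he _ => heq e i s he) h0 j I S (by omega)
  · exact jets_vanish (by norm_num) (by norm_num) (by decide) (by decide) check5 v hv
      (fun e i s he _ => heq e i s he) h0 j I S (by omega)
  · exact jets_vanish (by norm_num) (by norm_num) (by decide) (by decide) check6 v hv
      (fun e i s he _ => heq e i s he) h0 j I S (by omega)

/-- `x² - 1`. -/
def sX : SF := cx ^ 2 - 1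
/-- `1 - y²`. -/
def sY : SF := 1 - cy ^ 2
/-- `x² - y²`. -/
def sS : SF := cx ^ 2 - cy ^ 2
/-- Half of the logarithmic derivative of the conformal factor, cleared of denominators. -/
def sM : SF := 3 * cx * sX - (4 * cx - 2) * sS

/-- The coefficients of the differential system. -/
def cc : Fin 6 → SF
  | 0 => sX * (sM + cx * sS)
  | 1 => sM * sY
  | 2 => -(sX ^ 2 * sS)
  | 3 => -(3 * cy * sX ^ 2)
  | 4 => -(3 * cy * sX * sY) - cy * sX * sS
  | 5 => -(sX * sY * sS)

/-- The base point. -/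
def q0 : U2 := ⟨(2, 0), by norm_num [U2]⟩

/-- The polynomial given by a table. -/
def tabSF (L : ZTab) : SF :=
  (L.map fun p => (p.2.2 : SF) * ((cx - 2) ^ p.1 * cy ^ p.2.1)).sum

theorem cc_eq (t : Fin 6) : cc t = tabSF (ztab t) := by
  have key : ∀ (R : Type) [CommRing R] (x y : R) (t : Fin 6),
      (match t with
        | 0 => (x ^ 2 - 1) * ((3 * x * (x ^ 2 - 1) - (4 * x - 2) * (x ^ 2 - y ^ 2))
            + x * (x ^ 2 - y ^ 2))
        | 1 => (3 * x * (x ^ 2 - 1) - (4 * x - 2) * (x ^ 2 - y ^ 2)) * (1 - y ^ 2)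
        | 2 => -((x ^ 2 - 1) ^ 2 * (x ^ 2 - y ^ 2))
        | 3 => -(3 * y * (x ^ 2 - 1) ^ 2)
        | 4 => -(3 * y * (x ^ 2 - 1) * (1 - y ^ 2)) - y * (x ^ 2 - 1) * (x ^ 2 - y ^ 2)
        | 5 => -((x ^ 2 - 1) * (1 - y ^ 2) * (x ^ 2 - y ^ 2)) : R) =
      ((ztab t).map fun p => (p.2.2 : R) * ((x - 2) ^ p.1 * y ^ p.2.1)).sum := by
    intro R _ x y t
    fin_cases t <;> simp only [ztab, List.map_cons, List.map_nil, List.sum_cons, List.sum_nil] <;>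
      push_cast <;> ring
  rw [tabSF, ← key SF cx cy t]
  fin_cases t <;> rfl

theorem tay_pow (d : Derivation ℝ SF SF) (u g : SF) (hu : d u = 1) (hg : d g = 0) :
    ∀ k a : ℕ, tay d k (g * u ^ a) = (a.choose k : SF) * (g * u ^ (a - k))
  | 0, a => by simp [tay]
  | k + 1, a => by
    refine natmul_cancel (k := k) ?_
    rw [← tay_succ, Derivation.leibniz, Derivation.leibniz_pow, hu, hg]
    have : g • a • u ^ (a - 1) • (1 : SF) + u ^ a • (0 : SF) = a • (g * u ^ (a - 1)) := by
      simp only [smul_eq_mul, nsmul_eq_mul]; ring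
    rw [this, map_nsmul, tay_pow d u g hu hg k (a - 1), nsmul_eq_mul, ← mul_assoc,
      ← mul_assoc ((k + 1 : ℕ) : SF), ← Nat.cast_mul, ← Nat.cast_mul]
    cases a with
    | zero => simp
    | succ a =>
      rw [mul_comm (k + 1), ← Nat.add_one_mul_choose_eq]
      simp

theorem TT_mono (k l a b : ℕ) : evq q0 (TT k l ((cx - 2) ^ a * cy ^ b)) =
    if a = k ∧ b = l then 1 else 0 := by
  have h1 : dY ((cx - 2) ^ a) = 0 := by
    rw [Derivation.leibniz_pow, map_sub, dY_cx]
    have : dY (2 : SF) = 0 := by exact_mod_cast Derivation.map_natCast dY 2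
    simp [this]
  have h2 : dX (cx - 2) = 1 := by
    have : dX (2 : SF) = 0 := by exact_mod_cast Derivation.map_natCast dX 2
    rw [map_sub, dX_cx, this, sub_zero]
  have h3 : dX (cy ^ (b - l)) = 0 := by
    rw [Derivation.leibniz_pow, dX_cy]; simp
  rw [TT, LinearMap.comp_apply, tay_pow dY cy _ dY_cy h1, ← nsmul_eq_mul, map_nsmul,
    mul_comm ((cx - 2) ^ a), tay_pow dX (cx - 2) _ h2 h3]
  simp only [nsmul_eq_mul, map_mul, map_natCast, map_pow, map_sub, evq_cx, evq_cy, q0, map_ofNat,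
    sub_self]
  rcases lt_trichotomy a k with h | rfl | h
  · rw [Nat.choose_eq_zero_of_lt h, if_neg (by omega)]; simp
  · rcases lt_trichotomy b l with h | rfl | h
    · rw [Nat.choose_eq_zero_of_lt h, if_neg (by omega)]; simp
    · simp
    · rw [zero_pow (M₀ := ℝ) (show b - l ≠ 0 by omega), if_neg (by omega)]; simp
  · rw [zero_pow (M₀ := ℝ) (show a - k ≠ 0 by omega), if_neg (by omega)]; simp

theorem TT_cc (t : Fin 6) (k l : ℕ) : evq q0 (TT k l (cc t)) = ((ztau (ztab t) k l : ℤ) : ℝ) := by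
  rw [cc_eq]
  induction ztab t with
  | nil => simp [tabSF, ztau]
  | cons p L ih =>
    simp only [tabSF, ztau, List.map_cons, List.sum_cons, map_add] at ih ⊢
    rw [ih, ← zsmul_eq_mul, map_zsmul, zsmul_eq_mul, map_mul, TT_mono, map_intCast]
    push_cast
    congr 1
    split_ifs <;> simp

/-- Uniqueness for linear systems. -/
theorem ode {ι : Type*} [Fintype ι] (g : ι → SF) (a b : U2)
    (hd : ∀ w p, dir w (g p) ∈ Ideal.span (Set.range g)) (h0 : ∀ p, evq a (g p) = 0) (p : ι) :
    evq b (g p) = 0 := by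
  let w : ℝ × ℝ := b.1 - a.1
  let γ : ℝ → ℝ × ℝ := fun t => a.1 + t • w
  have hγ : ∀ t ∈ Set.Icc (0 : ℝ) 1, γ t ∈ U2 := by
    intro t ht
    have := convex_U2.add_smul_sub_mem a.2 b.2 ht
    exact this
  have hγc : Continuous γ := by fun_prop
  have hγd : ∀ t, HasDerivAt γ w t := by
    intro t
    have := ((hasDerivAt_id t).smul_const w).const_add a.1
    rw [one_smul] at this
    exact this
  have hc : ∀ p, ∃ c : ι → SF, ∑ i, c i • g i = dir w (g p) := fun p =>
    (Submodule.mem_span_range_iff_exists_fun SF).1 (hd w p)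
  choose c hc using hc
  have hbd : ∀ p i, ∃ C, ∀ t ∈ Set.Icc (0 : ℝ) 1, ‖ext0 (c p i).1 (γ t)‖ ≤ C := by
    intro p i
    refine isCompact_Icc.exists_bound_of_continuousOn ?_
    have h1 : ContinuousOn (ext0 (c p i).1) U2 := ContDiffOn.continuousOn (c p i).2
    exact h1.comp hγc.continuousOn hγ
  choose C hC using hbd
  have hCnn : ∀ p i, 0 ≤ C p i := fun p i =>
    (norm_nonneg _).trans (hC p i 0 (by simp))
  let f : ℝ → ι → ℝ := fun t p => ext0 (g p).1 (γ t)
  let f' : ℝ → ι → ℝ := fun t p => ext0 (dir w (g p)).1 (γ t)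
  have hder : ∀ t ∈ Set.Icc (0 : ℝ) 1, HasDerivAt f (f' t) t := by
    intro t ht
    rw [hasDerivAt_pi]
    intro p
    have h1 := (SF_diff (g p) ⟨γ t, hγ t ht⟩).hasFDerivAt.comp_hasDerivAt t (hγd t)
    have h2 : f' t p = fderiv ℝ (ext0 (g p).1) (γ t) w := ext0_of_mem _ (hγ t ht)
    rw [h2]
    exact h1
  have hb : ∀ t ∈ Set.Icc (0 : ℝ) 1, ‖f' t‖ ≤ (∑ p, ∑ i, C p i) * ‖f t‖ + 0 := by
    intro t ht
    rw [add_zero, pi_norm_le_iff_of_nonneg (by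
      refine mul_nonneg (Finset.sum_nonneg fun p _ => Finset.sum_nonneg fun i _ => hCnn p i)
        (norm_nonneg _))]
    intro p
    have e : f' t p = ∑ i, ext0 (c p i).1 (γ t) * f t i := by
      simp only [f', f, ext0_of_mem _ (hγ t ht)]
      have := congrArg (evq ⟨γ t, hγ t ht⟩) (hc p)
      simp only [map_sum, smul_eq_mul, map_mul] at this
      exact this.symm
    rw [e]
    calc ‖∑ i, ext0 (c p i).1 (γ t) * f t i‖ ≤ ∑ i, ‖ext0 (c p i).1 (γ t) * f t i‖ :=
          norm_sum_le _ _
      _ ≤ ∑ i, C p i * ‖f t‖ := by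
          refine Finset.sum_le_sum fun i _ => ?_
          rw [norm_mul]
          exact mul_le_mul (hC p i t ht) (norm_le_pi_norm _ _) (norm_nonneg _) (hCnn p i)
      _ = (∑ i, C p i) * ‖f t‖ := by rw [Finset.sum_mul]
      _ ≤ _ := by
          refine mul_le_mul_of_nonneg_right ?_ (norm_nonneg _)
          exact Finset.single_le_sum (f := fun p => ∑ i, C p i)
            (fun p _ => Finset.sum_nonneg fun i _ => hCnn p i) (Finset.mem_univ p)
  have hfa : ‖f 0‖ ≤ 0 := by
    have : f 0 = 0 := by
      funext p
      simp only [f, γ, zero_smul, add_zero, ext0_apply]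
      exact h0 p
    rw [this, norm_zero]
  have := norm_le_gronwallBound_of_norm_deriv_right_le (f := f) (f' := f') (a := 0) (b := 1)
    (fun t ht => (hder t ht).continuousAt.continuousWithinAt)
    (fun t ht => (hder t ⟨ht.1, ht.2.le⟩).hasDerivWithinAt) hfa
    (fun t ht => hb t ⟨ht.1, ht.2.le⟩) 1 (by simp)
  rw [gronwallBound_ε0_δ0] at this
  have h1 : f 1 = 0 := norm_le_zero_iff.1 this
  have h2 := congrFun h1 p
  simp only [f, γ, w, one_smul, add_sub_cancel, ext0_apply] at h2
  exact h2

section TopOrder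

variable {R : Type*} [CommRing R]

theorem term_low {τ : ℕ → ℕ → R} {w : ℕ} {f : ℕ → ℕ → R} {i s : ℕ}
    (h : ∀ I J, I + J ≤ i + s → f I J = 0) : term τ w 0 0 f i s = 0 := by
  unfold term
  rw [Finset.sum_eq_zero, mul_zero]
  intro k _
  refine Finset.sum_eq_zero fun l _ => ?_
  rw [h _ _ (by omega), mul_zero]

theorem term_topX {τ : ℕ → ℕ → R} {w : ℕ} {f : ℕ → ℕ → R} {i s : ℕ}
    (h : ∀ I J, I + J ≤ i + s → f I J = 0) :
    term τ w 1 0 f i s = w * (τ 0 0 * ((i + 1 : ℕ) : R) * f (i + 1) s) := by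
  unfold term
  rw [Finset.sum_eq_single 0, Finset.sum_eq_single 0]
  · congr 2
    · simp [add_comm]
  · intro l _ hl
    by_cases hs : l ≤ s
    · rw [h _ _ (by omega), mul_zero]
    · have := Finset.mem_range.1 ‹_›; omega
  · simp
  · intro k hk hk0
    have := Finset.mem_range.1 hk
    refine Finset.sum_eq_zero fun l _ => ?_
    rw [h _ _ (by omega), mul_zero]
  · simp

theorem term_topY {τ : ℕ → ℕ → R} {w : ℕ} {f : ℕ → ℕ → R} {i s : ℕ}
    (h : ∀ I J, I + J ≤ i + s → f I J = 0) :
    term τ w 0 1 f i s = w * (τ 0 0 * ((s + 1 : ℕ) : R) * f i (s + 1)) := by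
  unfold term
  rw [Finset.sum_eq_single 0, Finset.sum_eq_single 0]
  · congr 2
    · simp [add_comm]
  · intro l hl hl0
    have := Finset.mem_range.1 hl
    rw [h _ _ (by omega), mul_zero]
  · simp
  · intro k hk hk0
    have := Finset.mem_range.1 hk
    refine Finset.sum_eq_zero fun l hl => ?_
    rw [h _ _ (by omega), mul_zero]
  · simp

/-- If all jets of order `≤ n` vanish, so do the jets of order `n + 1`. -/
theorem top_vanish {n : ℕ} {τ : Fin 6 → ℕ → ℕ → R} {v : ℕ → ℕ → ℕ → R}
    (hu2 : ∀ k x, τ 2 0 0 * ((k + 1 : ℕ) : R) * x = 0 → x = 0)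
    (hu5 : ∀ k x, τ 5 0 0 * ((k + 1 : ℕ) : R) * x = 0 → x = 0)
    (hv : ∀ j, n < j → v j = 0) (hlow : ∀ j I S, I + S ≤ n → v j I S = 0)
    (heq : ∀ e i s, e ≤ n + 1 → i + s = n → rowval n τ v e i s = 0)
    (j I S : ℕ) (hIS : I + S = n + 1) : v j I S = 0 := by
  have key : ∀ e i s, e ≤ n + 1 → i + s = n →
      τ 2 0 0 * ((i + 1 : ℕ) : R) * v e (i + 1) s +
        ((min 1 e : ℕ) : R) * (τ 5 0 0 * ((s + 1 : ℕ) : R) * v (e - 1) i (s + 1)) = 0 := by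
    intro e i s he his
    have h := heq e i s he his
    have hl : ∀ j I J, I + J ≤ i + s → v j I J = 0 := fun j I J h => hlow j I J (by omega)
    simp only [rowval, term_low (hl _), term_topX (hl _), term_topY (hl _)] at h
    simpa using h
  have fwd : ∀ e I S, e ≤ n → e + 1 ≤ I → I + S = n + 1 → v e I S = 0 := by
    intro e
    induction e with
    | zero =>
      intro I S _ h1 h2
      obtain ⟨i, rfl⟩ : ∃ i, I = i + 1 := ⟨I - 1, by omega⟩
      have := key 0 i S (by omega) (by omega)
      exact hu2 i _ (by simpa using this)
    | succ e ih =>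
      intro I S h0 h1 h2
      obtain ⟨i, rfl⟩ : ∃ i, I = i + 1 := ⟨I - 1, by omega⟩
      have := key (e + 1) i S (by omega) (by omega)
      rw [show e + 1 - 1 = e by omega, ih i (S + 1) (by omega) (by omega) (by omega)] at this
      exact hu2 i _ (by simpa using this)
  have bwd : ∀ d I S, d ≤ n → I ≤ n - d → I + S = n + 1 → v (n - d) I S = 0 := by
    intro d
    induction d with
    | zero =>
      intro I S _ h1 h2
      obtain ⟨s, rfl⟩ : ∃ s, S = s + 1 := ⟨S - 1, by omega⟩
      have := key (n + 1) I s (by omega) (by omega)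
      rw [hv (n + 1) (by omega)] at this
      exact hu5 s _ (by simpa using this)
    | succ d ih =>
      intro I S h0 h1 h2
      obtain ⟨s, rfl⟩ : ∃ s, S = s + 1 := ⟨S - 1, by omega⟩
      have := key (n - d) I s (by omega) (by omega)
      rw [ih (I + 1) s (by omega) (by omega) (by omega), show min 1 (n - d) = 1 by omega] at this
      rw [show n - (d + 1) = n - d - 1 by omega]
      exact hu5 s _ (by simpa using this)
  by_cases hj : n < j
  · rw [hv j hj]; rfl
  · by_cases h : j + 1 ≤ I
    · exact fwd j I S (by omega) h hIS
    · have := bwd (n - j) I S (by omega) (by omega) hIS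
      rwa [show n - (n - j) = j by omega] at this

end TopOrder

theorem evq_sX_pos (q : U2) : 0 < evq q sX := by
  have := q.2.1
  simp only [sX, map_sub, map_pow, map_one, evq_cx]
  nlinarith

theorem evq_sY_pos (q : U2) : 0 < evq q sY := by
  have := q.2.2
  simp only [sY, map_sub, map_pow, map_one, evq_cy]
  nlinarith

theorem evq_sS_pos (q : U2) : 0 < evq q sS := by
  have h1 := evq_sX_pos q
  have h2 := evq_sY_pos q
  simp only [sX, sY, sS, map_sub, map_pow, map_one] at *
  linarith

theorem nat_inv (k : ℕ) : ∃ g : SF, ((k + 1 : ℕ) : SF) * g = 1 :=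
  exists_inv _ fun q => by rw [map_natCast]; positivity

/-- The reduced system has only the trivial solution. -/
theorem PDE_trivial {n : ℕ} (hn1 : 1 ≤ n) (hn : n ≤ 6) (A : ℕ → SF) (hA : ∀ j, n < j → A j = 0)
    (hP : ∀ e, e ≤ n + 1 → PDE n cc A e = 0) (h0 : n % 2 = 0 → evq q0 (A 0) = 0) (j : ℕ) :
    A j = 0 := by
  let v : ℕ → ℕ → ℕ → SF := fun j I S => TT I S (A j)
  have hv : ∀ j, n < j → v j = 0 := by
    intro j hj; funext I S; simp [v, hA j hj]
  have hrow : ∀ e i s, e ≤ n + 1 → rowval n (fun t k l => TT k l (cc t)) v e i s = 0 := by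
    intro e i s he
    rw [rowval_eq, hP e he, map_zero]
  have hjet : ∀ j I S, I + S ≤ n → evq q0 (v j I S) = 0 := by
    refine all_jets_vanish hn1 hn (fun j I S => evq q0 (v j I S)) ?_ ?_ h0
    · intro j hj; funext I S; simp [hv j hj]
    · intro e i s he
      have := congrArg (evq q0) (hrow e i s he)
      rw [rowval_map] at this
      simpa only [TT_cc, map_zero] using this
  let ι := Fin (n + 1) × Fin (n + 1) × Fin (n + 1)
  let g : ι → SF := fun p => if p.2.1.1 + p.2.2.1 ≤ n then v p.1 p.2.1 p.2.2 else 0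
  have hlow : ∀ j I S, I + S ≤ n → v j I S ∈ Ideal.span (Set.range g) := by
    intro j I S h
    by_cases hj : j ≤ n
    · refine Ideal.subset_span ⟨(⟨j, by omega⟩, ⟨I, by omega⟩, ⟨S, by omega⟩), ?_⟩
      simp [g, h]
    · rw [hv j (by omega)]; exact Ideal.zero_mem _
  have unit_cancel : ∀ (c : SF), (∀ q, evq q c ≠ 0) → ∀ (k : ℕ) (x : SF ⧸ Ideal.span (Set.range g)),
      Ideal.Quotient.mk (Ideal.span (Set.range g)) c * ((k + 1 : ℕ) : SF ⧸ _) * x = 0 → x = 0 := by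
    intro c hc k x hx
    obtain ⟨c', hc'⟩ := exists_inv c hc
    obtain ⟨k', hk'⟩ := nat_inv k
    let ψ := Ideal.Quotient.mk (Ideal.span (Set.range g))
    have h1 : ψ c * ψ c' = 1 := by rw [← map_mul, hc', map_one]
    have h2 : ((k + 1 : ℕ) : SF ⧸ Ideal.span (Set.range g)) * ψ k' = 1 := by
      rw [← map_natCast ψ, ← map_mul, hk', map_one]
    calc x = (ψ c * ψ c') * (((k + 1 : ℕ) : SF ⧸ Ideal.span (Set.range g)) * ψ k') * x := by
          rw [h1, h2]; ring
      _ = ψ c' * ψ k' * (ψ c * ((k + 1 : ℕ) : SF ⧸ Ideal.span (Set.range g)) * x) := by ring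
      _ = 0 := by rw [hx, mul_zero]
  have htop : ∀ j I S, I + S ≤ n + 1 → v j I S ∈ Ideal.span (Set.range g) := by
    intro j I S h
    by_cases h' : I + S ≤ n
    · exact hlow j I S h'
    · rw [← Ideal.Quotient.eq_zero_iff_mem]
      refine top_vanish (n := n)
        (τ := fun t k l => Ideal.Quotient.mk (Ideal.span (Set.range g)) (TT k l (cc t)))
        (v := fun j I S => Ideal.Quotient.mk (Ideal.span (Set.range g)) (v j I S))
        ?_ ?_ ?_ ?_ ?_ j I S (by omega)
      · refine unit_cancel _ fun q => ?_
        have h1 := evq_sX_pos q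
        have h2 := evq_sS_pos q
        rw [TT_zero, cc, map_neg, map_mul, map_pow]
        exact neg_ne_zero.2 (by positivity)
      · refine unit_cancel _ fun q => ?_
        have h1 := evq_sX_pos q
        have h2 := evq_sS_pos q
        have h3 := evq_sY_pos q
        rw [TT_zero, cc, map_neg, map_mul, map_mul]
        exact neg_ne_zero.2 (by positivity)
      · intro j hj; funext I S; simp [hv j hj]
      · intro j I S h
        rw [Ideal.Quotient.eq_zero_iff_mem]
        exact hlow j I S h
      · intro e i s he _
        rw [← rowval_map, hrow e i s he, map_zero]
  have hd : ∀ w p, dir w (g p) ∈ Ideal.span (Set.range g) := by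
    intro w p
    simp only [g]
    split_ifs with h
    · have e : dir w (v p.1 p.2.1 p.2.2) =
          algebraMap ℝ SF w.1 * dX (v p.1 p.2.1 p.2.2) +
          algebraMap ℝ SF w.2 * dY (v p.1 p.2.1 p.2.2) := by
        refine SF_ext fun q => ?_
        rw [evq_dir_eq, map_add, map_mul, map_mul]
        rfl
      rw [e]
      refine Ideal.add_mem _ (Ideal.mul_mem_left _ _ ?_) (Ideal.mul_mem_left _ _ ?_)
      · rw [dX_TT]
        exact Ideal.mul_mem_left _ _ (htop _ _ _ (by omega))
      · rw [dY_TT]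
        exact Ideal.mul_mem_left _ _ (htop _ _ _ (by omega))
    · rw [map_zero]; exact Ideal.zero_mem _
  have hz : ∀ p, evq q0 (g p) = 0 := by
    intro p
    simp only [g]
    split_ifs with h
    · exact hjet _ _ _ h
    · exact map_zero _
  by_cases hj : j ≤ n
  · refine SF_ext fun q => ?_
    have := ode g q0 q hd hz (⟨j, by omega⟩, 0, 0)
    simpa [g, v, TT_zero] using this
  · exact hA j (by omega)

/-! ### Part 6: calculus on the phase space -/

open Function in
theorem pd_of_hasDerivAt {F : PhasePt → ℝ} {z : PhasePt} {i : Fin 8} {d : ℝ}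
    (hF : DifferentiableAt ℝ F z) (h : HasDerivAt (fun s => F (update z i s)) d (z i)) :
    pd i F z = d := by
  have h1 : HasDerivAt (fun s => F (update z i s)) (fderiv ℝ F z (Pi.single i 1)) (z i) := by
    have h2 := hasDerivAt_update z i (z i)
    have h3 : HasFDerivAt F (fderiv ℝ F z) (update z i (z i)) := by
      rw [update_eq_self]; exact hF.hasFDerivAt
    exact h3.comp_hasDerivAt (z i) h2
  exact h1.unique h

open Function in
theorem hasDerivAt_pd {F : PhasePt → ℝ} {z : PhasePt} (i : Fin 8)
    (hF : DifferentiableAt ℝ F z) : HasDerivAt (fun s => F (update z i s)) (pd i F z) (z i) := by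
  have h2 := hasDerivAt_update z i (z i)
  have h3 : HasFDerivAt F (fderiv ℝ F z) (update z i (z i)) := by
    rw [update_eq_self]; exact hF.hasFDerivAt
  exact h3.comp_hasDerivAt (z i) h2

open Function in
theorem pd_congr_tang {F G : PhasePt → ℝ} {z : PhasePt} {i : Fin 8}
    (hF : DifferentiableAt ℝ F z) (hG : DifferentiableAt ℝ G z)
    (h : ∀ᶠ s in nhds (z i), F (update z i s) = G (update z i s)) : pd i F z = pd i G z :=
  pd_of_hasDerivAt hF ((hasDerivAt_pd i hG).congr_of_eventuallyEq h)

theorem isOpen_TStar : IsOpen TStar := by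
  refine IsOpen.inter (isOpen_lt continuous_const (continuous_apply 0)) ?_
  exact IsOpen.inter (isOpen_lt continuous_const (continuous_apply 1))
    (isOpen_lt (continuous_apply 1) continuous_const)

/-- Smooth functions on the phase space. -/
def Sm (F : PhasePt → ℝ) : Prop := ContDiffOn ℝ (⊤ : ℕ∞) F TStar

theorem Sm.diff {F : PhasePt → ℝ} (h : Sm F) {z : PhasePt} (hz : z ∈ TStar) :
    DifferentiableAt ℝ F z :=
  (ContDiffOn.differentiableOn h (by simp)).differentiableAt (isOpen_TStar.mem_nhds hz)

theorem Sm.add {F G : PhasePt → ℝ} (hF : Sm F) (hG : Sm G) : Sm (fun z => F z + G z) :=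
  ContDiffOn.add hF hG

theorem Sm.mul {F G : PhasePt → ℝ} (hF : Sm F) (hG : Sm G) : Sm (fun z => F z * G z) :=
  ContDiffOn.mul hF hG

theorem Sm.pow {F : PhasePt → ℝ} (hF : Sm F) (n : ℕ) : Sm (fun z => F z ^ n) :=
  ContDiffOn.pow hF n

theorem Sm.coord (i : Fin 8) : Sm (fun z => z i) := (contDiff_apply ℝ ℝ i).contDiffOn

theorem Sm.const (c : ℝ) : Sm (fun _ => c) := contDiffOn_const

theorem Sm.congr {F G : PhasePt → ℝ} (hF : Sm F) (h : ∀ z ∈ TStar, F z = G z) : Sm G :=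
  ContDiffOn.congr hF fun z hz => (h z hz).symm

theorem Sm.pd {F : PhasePt → ℝ} (hF : Sm F) (i : Fin 8) : Sm (pd i F) :=
  (ContDiffOn.fderiv_of_isOpen hF isOpen_TStar (m := (⊤ : ℕ∞)) (by simp)).clm_apply
    contDiffOn_const

section Brackets

variable {F G H : PhasePt → ℝ} {z : PhasePt}

theorem pd_add (i : Fin 8) (hF : DifferentiableAt ℝ F z) (hG : DifferentiableAt ℝ G z) :
    pd i (fun z => F z + G z) z = pd i F z + pd i G z := by
  simp only [pd, fderiv_fun_add hF hG]
  rfl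

theorem pd_mul (i : Fin 8) (hF : DifferentiableAt ℝ F z) (hG : DifferentiableAt ℝ G z) :
    pd i (fun z => F z * G z) z = F z * pd i G z + G z * pd i F z := by
  simp only [pd, fderiv_fun_mul hF hG]
  rfl

theorem pd_const (i : Fin 8) (c : ℝ) : pd i (fun _ => c) z = 0 := by
  simp [pd]

theorem pd_coord (i j : Fin 8) : pd i (fun z => z j) z = if i = j then 1 else 0 := by
  have : HasFDerivAt (fun z : PhasePt => z j) (ContinuousLinearMap.proj (R := ℝ) j) z :=
    (ContinuousLinearMap.proj (R := ℝ) (φ := fun _ : Fin 8 => ℝ) j).hasFDerivAt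
  simp only [pd, this.fderiv]
  simp [Pi.single_apply, eq_comm]

theorem pois_add (hF : DifferentiableAt ℝ F z) (hG : DifferentiableAt ℝ G z) :
    pois H (fun z => F z + G z) z = pois H F z + pois H G z := by
  simp only [pois, pd_add _ hF hG]; ring

theorem pois_mul (hF : DifferentiableAt ℝ F z) (hG : DifferentiableAt ℝ G z) :
    pois H (fun z => F z * G z) z = F z * pois H G z + G z * pois H F z := by
  simp only [pois, pd_mul _ hF hG]; ring

theorem pois_const (c : ℝ) : pois H (fun _ => c) z = 0 := by
  simp only [pois, pd_const]; ring

theorem pois_self : pois F F z = 0 := by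
  simp only [pois]; ring

theorem pois_pow (hF : DifferentiableAt ℝ F z) (h : pois H F z = 0) (n : ℕ) :
    pois H (fun z => F z ^ n) z = 0 := by
  induction n with
  | zero => simpa using pois_const (H := H) (z := z) 1
  | succ n ih =>
    simp only [pow_succ]
    rw [pois_mul (F := fun z => F z ^ n) (hF.fun_pow n) hF, ih, h]; ring

end Brackets

/-- The base point of a phase space point. -/
def bp (z : PhasePt) : ℝ × ℝ := (z 0, z 1)

theorem bp_mem {z : PhasePt} (hz : z ∈ TStar) : bp z ∈ U2 := hz

/-- Monomials in the momenta. -/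
def mono (f : SF) (i j k m : ℕ) (z : PhasePt) : ℝ :=
  ext0 f.1 (bp z) * z 4 ^ i * z 5 ^ j * z 6 ^ k * z 7 ^ m

theorem Sm.base (f : SF) : Sm (fun z => ext0 f.1 (bp z)) := by
  have hb : ContDiff ℝ (⊤ : ℕ∞) bp := (contDiff_apply ℝ ℝ 0).prodMk (contDiff_apply ℝ ℝ 1)
  exact ContDiffOn.comp (t := U2) f.2 hb.contDiffOn fun z hz => bp_mem hz

theorem Sm.mono (f : SF) (i j k m : ℕ) : Sm (mono f i j k m) :=
  (((((Sm.base f).mul ((Sm.coord 4).pow i)).mul ((Sm.coord 5).pow j)).mul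
    ((Sm.coord 6).pow k)).mul ((Sm.coord 7).pow m))

/-- Homogeneous polynomials in the momenta with coefficients depending on `x, y` only. -/
inductive Cl : ℕ → (PhasePt → ℝ) → Prop
  | zero (n : ℕ) : Cl n (fun _ => 0)
  | mono (f : SF) (i j k m n : ℕ) (h : i + j + k + m = n) : Cl n (mono f i j k m)
  | add {n : ℕ} {F G : PhasePt → ℝ} : Cl n F → Cl n G → Cl n (fun z => F z + G z)
  | congr {n : ℕ} {F G : PhasePt → ℝ} : Cl n F → (∀ z ∈ TStar, F z = G z) → Cl n G

theorem Cl.sm {n : ℕ} {F : PhasePt → ℝ} (h : Cl n F) : Sm F := by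
  induction h with
  | zero n => exact Sm.const 0
  | mono f i j k m n h => exact Sm.mono f i j k m
  | add _ _ h1 h2 => exact h1.add h2
  | congr _ h h1 => exact h1.congr h

theorem Cl.mul_mono {n : ℕ} {F : PhasePt → ℝ} (h : Cl n F) (f : SF) (i j k m : ℕ) :
    Cl (n + (i + j + k + m)) (fun z => F z * ZV.mono f i j k m z) := by
  induction h with
  | zero n => exact (Cl.zero _).congr fun z _ => by simp
  | mono f' i' j' k' m' n h =>
    refine (Cl.mono (f' * f) (i' + i) (j' + j) (k' + k) (m' + m) _ (by omega)).congr ?_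
    intro z hz
    simp only [ZV.mono, ext0_of_mem _ (bp_mem hz), pow_add]
    simp only [Subalgebra.coe_mul, Pi.mul_apply]
    ring
  | add _ _ h1 h2 => exact (h1.add h2).congr fun z _ => by ring
  | congr _ h h1 => exact h1.congr fun z hz => by rw [h z hz]

theorem Cl.mul {n n' : ℕ} {F G : PhasePt → ℝ} (h : Cl n F) (h' : Cl n' G) :
    Cl (n + n') (fun z => F z * G z) := by
  induction h' with
  | zero n => exact (Cl.zero _).congr fun z _ => by simp
  | mono f i j k m n h => subst h; exact Cl.mul_mono ‹_› _ _ _ _ _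
  | add _ _ h1 h2 => exact (h1.add h2).congr fun z _ => by ring
  | congr _ h h1 => exact h1.congr fun z hz => by rw [h z hz]

theorem Cl.const (c : ℝ) : Cl 0 (fun _ => c) :=
  (Cl.mono (algebraMap ℝ SF c) 0 0 0 0 0 rfl).congr fun z hz => by
    simp [ZV.mono, ext0_of_mem _ (bp_mem hz)]

theorem Cl.smul {n : ℕ} {F : PhasePt → ℝ} (h : Cl n F) (c : ℝ) : Cl n (fun z => c * F z) := by
  have := (Cl.const c).mul h
  rwa [zero_add] at this

theorem Cl.pow {n : ℕ} {F : PhasePt → ℝ} (h : Cl n F) (l : ℕ) : Cl (n * l) (fun z => F z ^ l) := by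
  induction l with
  | zero => simpa using Cl.const 1
  | succ l ih => simpa only [pow_succ, mul_add, mul_one] using ih.mul h

theorem Cl.z6 : Cl 1 (fun z => z 6) :=
  (Cl.mono 1 0 0 1 0 1 rfl).congr fun z hz => by
    simp [ZV.mono, ext0_of_mem _ (bp_mem hz)]

theorem Cl.z7 : Cl 1 (fun z => z 7) :=
  (Cl.mono 1 0 0 0 1 1 rfl).congr fun z hz => by
    simp [ZV.mono, ext0_of_mem _ (bp_mem hz)]

theorem update_mem {z : PhasePt} (hz : z ∈ TStar) {i : Fin 8} (hi : i ≠ 0) (hi' : i ≠ 1) (s : ℝ) :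
    Function.update z i s ∈ TStar := by
  simpa [TStar, Function.update_of_ne hi.symm, Function.update_of_ne hi'.symm] using hz

theorem update_mem_ev {z : PhasePt} (hz : z ∈ TStar) (i : Fin 8) :
    ∀ᶠ s in nhds (z i), Function.update z i s ∈ TStar := by
  have h : ContinuousAt (fun s => Function.update z i s) (z i) :=
    (continuous_const.update i continuous_id).continuousAt
  refine h.eventually (isOpen_TStar.mem_nhds ?_)
  simpa using hz

theorem Cl.pd_base {n : ℕ} {F : PhasePt → ℝ} (h : Cl n F) {z : PhasePt} (hz : z ∈ TStar) :
    pd 2 F z = 0 ∧ pd 3 F z = 0 := by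
  have key : ∀ i : Fin 8, i = 2 ∨ i = 3 → ∀ s, ∀ w ∈ TStar, F (Function.update w i s) = F w := by
    induction h with
    | zero n => intros; rfl
    | mono f i j k m n h =>
      intro i hi s w _
      rcases hi with rfl | rfl <;> simp [ZV.mono, bp]
    | add _ _ h1 h2 => intro i hi s w hw; simp only [h1 i hi s w hw, h2 i hi s w hw]
    | congr _ h h1 =>
      intro i hi s w hw
      rw [← h w hw, ← h _ (update_mem hw (by rcases hi with rfl | rfl <;> decide)
        (by rcases hi with rfl | rfl <;> decide) s), h1 i hi s w hw]
  have k2 : ∀ i : Fin 8, i = 2 ∨ i = 3 → pd i F z = 0 := by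
    intro i hi
    refine pd_of_hasDerivAt (h.sm.diff hz) ?_
    have : (fun s => F (Function.update z i s)) = fun _ => F z := funext fun s => key i hi s z hz
    rw [this]
    exact hasDerivAt_const _ _
  exact ⟨k2 2 (Or.inl rfl), k2 3 (Or.inr rfl)⟩

/-- The value of a smooth function at the base point. -/
theorem base_hasDerivAt0 (f : SF) {z : PhasePt} (hz : z ∈ TStar) :
    HasDerivAt (fun s => ext0 f.1 (s, z 1)) (ext0 (dX f).1 (bp z)) (z 0) := by
  have h1 := (SF_diff f ⟨bp z, hz⟩).hasFDerivAt
  have h2 : HasDerivAt (fun s : ℝ => (s, z 1)) ((1 : ℝ), (0 : ℝ)) (z 0) :=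
    (hasDerivAt_id (z 0)).prodMk (hasDerivAt_const _ _)
  have h3 := HasFDerivAt.comp_hasDerivAt (z 0) h1 h2
  rw [ext0_of_mem _ (bp_mem hz)]
  exact h3

theorem base_hasDerivAt1 (f : SF) {z : PhasePt} (hz : z ∈ TStar) :
    HasDerivAt (fun s => ext0 f.1 (z 0, s)) (ext0 (dY f).1 (bp z)) (z 1) := by
  have h1 := (SF_diff f ⟨bp z, hz⟩).hasFDerivAt
  have h2 : HasDerivAt (fun s : ℝ => (z 0, s)) ((0 : ℝ), (1 : ℝ)) (z 1) :=
    (hasDerivAt_const _ _).prodMk (hasDerivAt_id (z 1))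
  have h3 := HasFDerivAt.comp_hasDerivAt (z 1) h1 h2
  rw [ext0_of_mem _ (bp_mem hz)]
  exact h3

theorem pd0_mono (f : SF) (i j k m : ℕ) {z : PhasePt} (hz : z ∈ TStar) :
    pd 0 (mono f i j k m) z = mono (dX f) i j k m z := by
  refine pd_of_hasDerivAt ((Sm.mono f i j k m).diff hz) ?_
  have := ((((base_hasDerivAt0 f hz).mul_const (z 4 ^ i)).mul_const (z 5 ^ j)).mul_const
    (z 6 ^ k)).mul_const (z 7 ^ m)
  simpa [mono, bp] using this

theorem pd1_mono (f : SF) (i j k m : ℕ) {z : PhasePt} (hz : z ∈ TStar) :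
    pd 1 (mono f i j k m) z = mono (dY f) i j k m z := by
  refine pd_of_hasDerivAt ((Sm.mono f i j k m).diff hz) ?_
  have := ((((base_hasDerivAt1 f hz).mul_const (z 4 ^ i)).mul_const (z 5 ^ j)).mul_const
    (z 6 ^ k)).mul_const (z 7 ^ m)
  simpa [mono, bp] using this

theorem pd4_mono (f : SF) (i j k m : ℕ) {z : PhasePt} (hz : z ∈ TStar) :
    pd 4 (mono f i j k m) z = i * mono f (i - 1) j k m z := by
  refine pd_of_hasDerivAt ((Sm.mono f i j k m).diff hz) ?_
  have := (((((hasDerivAt_pow i (z 4)).const_mul (ext0 f.1 (bp z)))).mul_const (z 5 ^ j)).mul_const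
    (z 6 ^ k)).mul_const (z 7 ^ m)
  simp only [mono, bp] at this ⊢
  refine HasDerivAt.congr_deriv (HasDerivAt.congr_of_eventuallyEq this ?_) (by ring)
  exact Filter.Eventually.of_forall fun s => by simp

theorem pd5_mono (f : SF) (i j k m : ℕ) {z : PhasePt} (hz : z ∈ TStar) :
    pd 5 (mono f i j k m) z = j * mono f i (j - 1) k m z := by
  refine pd_of_hasDerivAt ((Sm.mono f i j k m).diff hz) ?_
  have := ((((hasDerivAt_pow j (z 5)).const_mul (ext0 f.1 (bp z) * z 4 ^ i))).mul_const
    (z 6 ^ k)).mul_const (z 7 ^ m)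
  simp only [mono, bp] at this ⊢
  refine HasDerivAt.congr_deriv (HasDerivAt.congr_of_eventuallyEq this ?_) (by ring)
  exact Filter.Eventually.of_forall fun s => by simp

/-! ### Part 7: the Hamiltonian and the classification -/

theorem evq_cxp (q : U2) : evq q (cx + 1) ≠ 0 := by
  have := q.2.1
  rw [map_add, map_one, evq_cx]; linarith

theorem evq_cxm (q : U2) : evq q (cx - 1) ≠ 0 := by
  have := q.2.1
  rw [map_sub, map_one, evq_cx]; linarith

/-- `1 / (x + 1)`. -/
def ip : SF := Classical.choose (exists_inv (cx + 1) evq_cxp)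
/-- `1 / (x - 1)`. -/
def im : SF := Classical.choose (exists_inv (cx - 1) evq_cxm)
/-- `1 / (1 - y²)`. -/
def iY : SF := Classical.choose (exists_inv sY fun q => (evq_sY_pos q).ne')

theorem ip_mul : (cx + 1) * ip = 1 := Classical.choose_spec (exists_inv (cx + 1) evq_cxp)
theorem im_mul : (cx - 1) * im = 1 := Classical.choose_spec (exists_inv (cx - 1) evq_cxm)
theorem iY_mul : sY * iY = 1 := Classical.choose_spec (exists_inv sY fun q => (evq_sY_pos q).ne')

/-- The conformal factor. -/
def cm : SF := sS ^ 3 * ip ^ 6 * im ^ 2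
/-- Coefficients of the Hamiltonian. -/
def hX : SF := cm * sX
/-- Coefficients of the Hamiltonian. -/
def hY : SF := cm * sY

theorem evq_ip (q : U2) : evq q ip = (q.1.1 + 1)⁻¹ := by
  have := congrArg (evq q) ip_mul
  rw [map_mul, map_add, map_one, evq_cx] at this
  exact eq_inv_of_mul_eq_one_right this

theorem evq_im (q : U2) : evq q im = (q.1.1 - 1)⁻¹ := by
  have := congrArg (evq q) im_mul
  rw [map_mul, map_sub, map_one, evq_cx] at this
  exact eq_inv_of_mul_eq_one_right this

theorem evq_iY (q : U2) : evq q iY = (1 - q.1.2 ^ 2)⁻¹ := by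
  have := congrArg (evq q) iY_mul
  rw [map_mul, map_one, sY, map_sub, map_one, map_pow, evq_cy] at this
  exact eq_inv_of_mul_eq_one_right this

theorem ext0_evq (f : SF) {z : PhasePt} (hz : z ∈ TStar) :
    ext0 f.1 (bp z) = evq ⟨bp z, hz⟩ f := ext0_of_mem _ (bp_mem hz)

/-- The Hamiltonian as a quadratic form in the momenta. -/
def HamQ (z : PhasePt) : ℝ :=
  ((1 / 2) * mono hX 2 0 0 0 z + (1 / 2) * mono hY 0 2 0 0 z) +
    ((1 / 2) * mono ((cx - 1) * ip ^ 3 * iY) 0 0 2 0 z +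
      (-(1 / 2)) * mono ((cx + 1) ^ 2 * im ^ 2) 0 0 0 2 z)

theorem HamQ_cl : Cl 2 HamQ :=
  (((Cl.mono _ 2 0 0 0 2 rfl).smul _).add ((Cl.mono _ 0 2 0 0 2 rfl).smul _)).add
    (((Cl.mono _ 0 0 2 0 2 rfl).smul _).add ((Cl.mono _ 0 0 0 2 2 rfl).smul _))

theorem HamQ_eq {z : PhasePt} (hz : z ∈ TStar) : HamQ z = Ham z := by
  obtain ⟨h1, h2, h3⟩ := hz
  have hx1 : z 0 - 1 ≠ 0 := by linarith
  have hx2 : z 0 + 1 ≠ 0 := by linarith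
  have hy : 1 - z 1 ^ 2 ≠ 0 := by nlinarith
  have hX0 : z 0 ^ 2 - 1 ≠ 0 := by nlinarith
  have hS : z 0 ^ 2 - z 1 ^ 2 ≠ 0 := by nlinarith
  simp only [HamQ, mono, ext0_evq _ (show z ∈ TStar from ⟨h1, h2, h3⟩), hX, hY, cm, sX, sY, sS,
    map_mul, map_pow, map_sub, map_add, map_one, evq_cx, evq_cy, evq_ip, evq_im, evq_iY]
  simp only [bp, Ham]
  have e : z 0 ^ 2 - 1 = (z 0 - 1) * (z 0 + 1) := by ring
  have e1 : (((z 0 ^ 2 - 1) * z 4 ^ 2 + (1 - z 1 ^ 2) * z 5 ^ 2) /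
      (((z 0 + 1) / (z 0 - 1)) ^ 2 * ((z 0 ^ 2 - 1) ^ 4 / (z 0 ^ 2 - z 1 ^ 2) ^ 3))) =
      (z 0 ^ 2 - z 1 ^ 2) ^ 3 * (z 0 + 1)⁻¹ ^ 6 * (z 0 - 1)⁻¹ ^ 2 *
      ((z 0 ^ 2 - 1) * z 4 ^ 2 + (1 - z 1 ^ 2) * z 5 ^ 2) := by
    rw [e]; field_simp
  have e2 : z 6 ^ 2 / (((z 0 + 1) / (z 0 - 1)) ^ 2 * ((z 0 ^ 2 - 1) * (1 - z 1 ^ 2))) =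
      (z 0 - 1) * (z 0 + 1)⁻¹ ^ 3 * (1 - z 1 ^ 2)⁻¹ * z 6 ^ 2 := by
    rw [e]; field_simp
  have e3 : ((z 0 + 1) / (z 0 - 1)) ^ 2 * z 7 ^ 2 = (z 0 + 1) ^ 2 * (z 0 - 1)⁻¹ ^ 2 * z 7 ^ 2 := by
    field_simp
  rw [e1, e2, e3]
  ring

theorem Ham_cl : Cl 2 Ham := HamQ_cl.congr fun _ hz => HamQ_eq hz

/-- The part of the phase space on which some of the momenta `p_φ, p_t` vanish. -/
def WW (s : Finset (Fin 8)) : Set PhasePt := {z | z ∈ TStar ∧ ∀ i ∈ s, z i = 0}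

theorem pois_Ham_eq {n : ℕ} {F : PhasePt → ℝ} (hF : Cl n F) {z : PhasePt} (hz : z ∈ TStar) :
    pois Ham F z = (pd 0 Ham z * pd 4 F z - pd 4 Ham z * pd 0 F z) +
      (pd 1 Ham z * pd 5 F z - pd 5 Ham z * pd 1 F z) := by
  simp only [pois, (hF.pd_base hz).1, (hF.pd_base hz).2, (Ham_cl.pd_base hz).1,
    (Ham_cl.pd_base hz).2]
  ring

theorem pd_tang {s : Finset (Fin 8)} {n n' : ℕ} {F G : PhasePt → ℝ} (hF : Cl n F) (hG : Cl n' G)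
    (h : ∀ z ∈ WW s, F z = G z) {z : PhasePt} (hz : z ∈ WW s) (i : Fin 8) (hi : i ∉ s) :
    pd i F z = pd i G z := by
  refine pd_congr_tang (hF.sm.diff hz.1) (hG.sm.diff hz.1) ?_
  filter_upwards [update_mem_ev hz.1 i] with t ht
  refine h _ ⟨ht, fun j hj => ?_⟩
  rw [Function.update_of_ne (show j ≠ i from fun h => hi (h ▸ hj))]
  exact hz.2 j hj

theorem pois_congr {s : Finset (Fin 8)} (hs : s ⊆ {6, 7}) {n n' : ℕ} {F G : PhasePt → ℝ}
    (hF : Cl n F) (hG : Cl n' G) (h : ∀ z ∈ WW s, F z = G z) {z : PhasePt} (hz : z ∈ WW s) :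
    pois Ham F z = pois Ham G z := by
  have hi : ∀ i : Fin 8, i ≠ 6 → i ≠ 7 → i ∉ s := fun i h6 h7 hi => by
    have := hs hi
    simp [h6, h7] at this
  rw [pois_Ham_eq hF hz.1, pois_Ham_eq hG hz.1,
    pd_tang hF hG h hz 0 (hi 0 (by decide) (by decide)),
    pd_tang hF hG h hz 1 (hi 1 (by decide) (by decide)),
    pd_tang hF hG h hz 4 (hi 4 (by decide) (by decide)),
    pd_tang hF hG h hz 5 (hi 5 (by decide) (by decide))]

theorem pois_z {v : Fin 8} (hv : v = 6 ∨ v = 7) {z : PhasePt} (hz : z ∈ TStar) :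
    pois Ham (fun z => z v) z = 0 := by
  rcases hv with rfl | rfl
  · simp [pois, pd_coord, (Ham_cl.pd_base hz).1]
  · simp [pois, pd_coord, (Ham_cl.pd_base hz).2]

/-- Trivial integrals. -/
def TrivS (n : ℕ) : Submodule ℝ (PhasePt → ℝ) :=
  Submodule.span ℝ {F | ∃ l k m : ℕ, 2 * l + k + m = n ∧ F = fun z => Ham z ^ l * z 6 ^ k * z 7 ^ m}

theorem triv_gen (l k m : ℕ) :
    (fun z => Ham z ^ l * z 6 ^ k * z 7 ^ m) ∈ TrivS (2 * l + k + m) :=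
  Submodule.subset_span ⟨l, k, m, rfl, rfl⟩

theorem gen_cl (l k m : ℕ) : Cl (2 * l + k + m) (fun z => Ham z ^ l * z 6 ^ k * z 7 ^ m) := by
  have := ((Ham_cl.pow l).mul (Cl.z6.pow k)).mul (Cl.z7.pow m)
  simpa only [one_mul] using this

theorem gen_pois (l k m : ℕ) {z : PhasePt} (hz : z ∈ TStar) :
    pois Ham (fun z => Ham z ^ l * z 6 ^ k * z 7 ^ m) z = 0 := by
  have hH := Ham_cl.sm.diff hz
  have h6 := Cl.z6.sm.diff hz
  have h7 := Cl.z7.sm.diff hz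
  have h1 : DifferentiableAt ℝ (fun z => Ham z ^ l) z := hH.fun_pow l
  have h2 : DifferentiableAt ℝ (fun z : PhasePt => z 6 ^ k) z := h6.fun_pow k
  have h3 : DifferentiableAt ℝ (fun z : PhasePt => z 7 ^ m) z := h7.fun_pow m
  rw [pois_mul (F := fun z => Ham z ^ l * z 6 ^ k) (h1.fun_mul h2) h3,
    pois_mul (F := fun z => Ham z ^ l) h1 h2, pois_pow hH pois_self, pois_pow h6 (pois_z (Or.inl rfl) hz),
    pois_pow h7 (pois_z (Or.inr rfl) hz)]
  ring

theorem triv_props {n : ℕ} {G : PhasePt → ℝ} (hG : G ∈ TrivS n) :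
    Cl n G ∧ ∀ z ∈ TStar, pois Ham G z = 0 := by
  induction hG using Submodule.span_induction with
  | mem F h =>
    obtain ⟨l, k, m, rfl, rfl⟩ := h
    exact ⟨gen_cl l k m, fun z hz => gen_pois l k m hz⟩
  | zero => exact ⟨Cl.zero n, fun z _ => pois_const 0⟩
  | add F G _ _ h1 h2 =>
    refine ⟨h1.1.add h2.1, fun z hz => ?_⟩
    rw [show F + G = fun z => F z + G z from rfl, pois_add (h1.1.sm.diff hz) (h2.1.sm.diff hz),
      h1.2 z hz, h2.2 z hz, add_zero]
  | smul c F _ h1 =>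
    refine ⟨h1.1.smul c, fun z hz => ?_⟩
    rw [show c • F = fun z => c * F z from rfl,
      pois_mul (F := fun _ => c) (differentiableAt_const c) (h1.1.sm.diff hz), h1.2 z hz, pois_const]
    ring

theorem triv_mul {n : ℕ} {G : PhasePt → ℝ} (hG : G ∈ TrivS n) {v : Fin 8} (hv : v = 6 ∨ v = 7) :
    (fun z => z v * G z) ∈ TrivS (n + 1) := by
  induction hG using Submodule.span_induction with
  | mem F h =>
    obtain ⟨l, k, m, rfl, rfl⟩ := h
    rcases hv with rfl | rfl
    · refine Submodule.subset_span ⟨l, k + 1, m, by ring, ?_⟩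
      funext z; ring
    · refine Submodule.subset_span ⟨l, k, m + 1, by ring, ?_⟩
      funext z; ring
  | zero =>
    have e : (fun z : PhasePt => z v * (0 : PhasePt → ℝ) z) = 0 := by funext z; simp
    rw [e]; exact zero_mem _
  | add F G _ _ h1 h2 =>
    have := (TrivS (n + 1)).add_mem h1 h2
    convert this using 1
    funext z; simp [mul_add]
  | smul c F _ h1 =>
    have := (TrivS (n + 1)).smul_mem c h1
    convert this using 1
    funext z; simp; ring

/-- The classification claim on a part of the phase space. -/
def Claim (s : Finset (Fin 8)) (n : ℕ) : Prop :=
  ∀ F, Cl n F → (∀ z ∈ WW s, pois Ham F z = 0) → ∃ G ∈ TrivS n, ∀ z ∈ WW s, F z = G z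

theorem Cl.split {n : ℕ} {F : PhasePt → ℝ} (h : Cl n F) {v : Fin 8} (hv : v = 6 ∨ v = 7) :
    ∃ F0 F1 : PhasePt → ℝ, (∀ z ∈ TStar, F z = F0 z + z v * F1 z) ∧
      (∀ z ∈ TStar, F0 z = F0 (Function.update z v 0)) ∧ Cl (n - 1) F1 ∧
      (n = 0 → ∀ z, F1 z = 0) := by
  induction h with
  | zero n => exact ⟨fun _ => 0, fun _ => 0, by simp, by simp, Cl.zero _, by simp⟩
  | mono f i j k m n h =>
    rcases hv with rfl | rfl
    · cases k with
      | zero =>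
        exact ⟨ZV.mono f i j 0 m, fun _ => 0, by simp, by simp [ZV.mono, bp], Cl.zero _, by simp⟩
      | succ k =>
        refine ⟨fun _ => 0, ZV.mono f i j k m, ?_, by simp, Cl.mono f i j k m _ (by omega),
          by omega⟩
        intro z _; simp only [ZV.mono]; ring
    · cases m with
      | zero =>
        exact ⟨ZV.mono f i j k 0, fun _ => 0, by simp, by simp [ZV.mono, bp], Cl.zero _, by simp⟩
      | succ m =>
        refine ⟨fun _ => 0, ZV.mono f i j k m, ?_, by simp, Cl.mono f i j k m _ (by omega),
          by omega⟩
        intro z _; simp only [ZV.mono]; ring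
  | add _ _ h1 h2 =>
    obtain ⟨F0, F1, h1, h1', h1'', h1z⟩ := h1
    obtain ⟨G0, G1, h2, h2', h2'', h2z⟩ := h2
    refine ⟨fun z => F0 z + G0 z, fun z => F1 z + G1 z, ?_, ?_, h1''.add h2'', ?_⟩
    · intro z hz; simp only [h1 z hz, h2 z hz]; ring
    · intro z hz; simp only [← h1' z hz, ← h2' z hz]
    · intro hn z; simp only [h1z hn, h2z hn, add_zero]
  | congr _ h h1 =>
    obtain ⟨F0, F1, h1, h1', h1'', h1z⟩ := h1
    exact ⟨F0, F1, fun z hz => by rw [← h z hz, h1 z hz], h1', h1'', h1z⟩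

theorem Cl.sub {n : ℕ} {F G : PhasePt → ℝ} (hF : Cl n F) (hG : Cl n G) :
    Cl n (fun z => F z - G z) :=
  (hF.add (hG.smul (-1))).congr fun z _ => by ring

theorem pois_sub {n : ℕ} {F G : PhasePt → ℝ} (hF : Cl n F) (hG : Cl n G) {z : PhasePt}
    (hz : z ∈ TStar) : pois Ham (fun z => F z - G z) z = pois Ham F z - pois Ham G z := by
  have e : (fun z => F z - G z) = fun z => F z + (-1) * G z := by funext z; ring
  rw [e, pois_add (G := fun z => (-1) * G z) (hF.sm.diff hz) ((hG.smul (-1)).sm.diff hz),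
    pois_mul (F := fun _ => -1) (differentiableAt_const _) (hG.sm.diff hz), pois_const]
  ring

/-- The inductive step. -/
theorem claim_step {s : Finset (Fin 8)} (hs : s ⊆ {6, 7}) {v : Fin 8} (hv : v = 6 ∨ v = 7)
    (hvs : v ∉ s) (h : ∀ n, n ≤ 6 → Claim (insert v s) n) : ∀ n, n ≤ 6 → Claim s n := by
  have hv0 : v ≠ 0 := by rcases hv with rfl | rfl <;> decide
  have hv1 : v ≠ 1 := by rcases hv with rfl | rfl <;> decide
  have hupd : ∀ z ∈ WW s, ∀ t, Function.update z v t ∈ WW s := by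
    intro z hz t
    refine ⟨update_mem hz.1 hv0 hv1 t, fun i hi => ?_⟩
    rw [Function.update_of_ne (show i ≠ v from fun h => hvs (h ▸ hi))]
    exact hz.2 i hi
  intro n
  induction n with
  | zero =>
    intro hn F hF hp
    obtain ⟨G, hG, hFG⟩ := h 0 hn F hF fun z hz =>
      hp z ⟨hz.1, fun i hi => hz.2 i (Finset.mem_insert_of_mem hi)⟩
    obtain ⟨F0, F1, h1, h1', h1'', h1z⟩ := (hF.sub (triv_props hG).1).split hv
    refine ⟨G, hG, fun z hz => ?_⟩
    have e1 := h1 z hz.1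
    have e2 := h1 _ (hupd z hz 0).1
    rw [hFG _ ⟨(hupd z hz 0).1, fun i hi => by
      rcases Finset.mem_insert.1 hi with rfl | hi
      · simp
      · exact (hupd z hz 0).2 i hi⟩, ← h1' z hz.1] at e2
    rw [h1z rfl] at e1 e2
    linarith
  | succ n ih =>
    intro hn F hF hp
    obtain ⟨G, hG, hFG⟩ := h (n + 1) hn F hF fun z hz =>
      hp z ⟨hz.1, fun i hi => hz.2 i (Finset.mem_insert_of_mem hi)⟩
    have hFsub := hF.sub (triv_props hG).1
    obtain ⟨F0, F1, h1, h1', h1'', -⟩ := hFsub.split hv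
    rw [Nat.add_sub_cancel] at h1''
    have hval : ∀ z ∈ WW s, F z - G z = z v * F1 z := by
      intro z hz
      have e1 := h1 z hz.1
      have e2 := h1 _ (hupd z hz 0).1
      rw [hFG _ ⟨(hupd z hz 0).1, fun i hi => by
        rcases Finset.mem_insert.1 hi with rfl | hi
        · simp
        · exact (hupd z hz 0).2 i hi⟩, ← h1' z hz.1] at e2
      simp only [Function.update_self] at e2
      linarith
    have hzv : Cl 1 (fun z => z v) := by
      rcases hv with rfl | rfl
      · exact Cl.z6
      · exact Cl.z7
    have hmulz : ∀ z ∈ WW s, z v * pois Ham F1 z = 0 := by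
      intro z hz
      have e := pois_congr hs hFsub (hzv.mul h1'') hval hz
      rw [pois_sub hF (triv_props hG).1 hz.1, hp z hz, (triv_props hG).2 z hz.1,
        pois_mul (hzv.sm.diff hz.1) (h1''.sm.diff hz.1), pois_z hv hz.1] at e
      linarith
    have hp1 : ∀ z ∈ WW s, pois Ham F1 z = 0 := by
      intro z hz
      by_cases hzv0 : z v = 0
      · have hcont : Sm (pois Ham F1) := by
          have hH := Ham_cl.sm
          have hF1 := h1''.sm
          have hm : ∀ i j : Fin 8, Sm (fun z => pd i Ham z * pd j F1 z - pd j Ham z * pd i F1 z) :=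
            fun i j => ContDiffOn.sub ((hH.pd i).mul (hF1.pd j)) ((hH.pd j).mul (hF1.pd i))
          exact (((hm 0 4).add (hm 1 5)).add (hm 2 6)).add (hm 3 7)
        have hc : ContinuousAt (fun t => pois Ham F1 (Function.update z v t)) 0 := by
          have c1 : ContinuousAt (fun t => Function.update z v t) 0 :=
            (continuous_const.update v continuous_id).continuousAt
          have c2 : ContinuousAt (pois Ham F1) (Function.update z v 0) :=
            (hcont.diff (hupd z hz 0).1).continuousAt
          exact ContinuousAt.comp (g := pois Ham F1) c2 c1
        have hev : ∀ t ≠ (0 : ℝ), pois Ham F1 (Function.update z v t) = 0 := by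
          intro t ht
          have := hmulz _ (hupd z hz t)
          rw [Function.update_self] at this
          exact (mul_eq_zero.1 this).resolve_left ht
        have l1 : Filter.Tendsto (fun t => pois Ham F1 (Function.update z v t)) (nhdsWithin 0 {0}ᶜ)
            (nhds (pois Ham F1 (Function.update z v 0))) := hc.tendsto.mono_left nhdsWithin_le_nhds
        have l2 : Filter.Tendsto (fun t => pois Ham F1 (Function.update z v t)) (nhdsWithin 0 {0}ᶜ)
            (nhds 0) := by
          refine tendsto_const_nhds.congr' ?_
          filter_upwards [self_mem_nhdsWithin] with t ht
          exact (hev t ht).symm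
        have := tendsto_nhds_unique l1 l2
        have e : Function.update z v 0 = z := by rw [← hzv0, Function.update_eq_self]
        rwa [e] at this
      · exact (mul_eq_zero.1 (hmulz z hz)).resolve_left hzv0
    obtain ⟨G1, hG1, hFG1⟩ := ih (by omega) F1 h1'' hp1
    refine ⟨_, (TrivS (n + 1)).add_mem hG (triv_mul hG1 hv), fun z hz => ?_⟩
    have := hval z hz
    rw [hFG1 z hz] at this
    simp only [Pi.add_apply]
    linarith

/-! ### Part 8: the reduced system -/

theorem sX_fac : sX = (cx - 1) * (cx + 1) := by rw [sX]; ring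

theorem dX_sS : dX sS = 2 * cx := by
  simp only [sS, map_sub, Derivation.leibniz_pow, dX_cx, dX_cy, nsmul_eq_mul, smul_eq_mul]
  push_cast; ring

theorem dY_sS : dY sS = -(2 * cy) := by
  simp only [sS, map_sub, Derivation.leibniz_pow, dY_cx, dY_cy, nsmul_eq_mul, smul_eq_mul]
  push_cast; ring

theorem dX_sX : dX sX = 2 * cx := by
  simp only [sX, map_sub, Derivation.leibniz_pow, dX_cx, nsmul_eq_mul, smul_eq_mul,
    Derivation.map_one_eq_zero]
  push_cast; ring

theorem dY_sX : dY sX = 0 := by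
  simp only [sX, map_sub, Derivation.leibniz_pow, dY_cx, nsmul_eq_mul, smul_eq_mul,
    Derivation.map_one_eq_zero]
  push_cast; ring

theorem dX_sY : dX sY = 0 := by
  simp only [sY, map_sub, Derivation.leibniz_pow, dX_cy, nsmul_eq_mul, smul_eq_mul,
    Derivation.map_one_eq_zero]
  push_cast; ring

theorem dY_sY : dY sY = -(2 * cy) := by
  simp only [sY, map_sub, Derivation.leibniz_pow, dY_cy, nsmul_eq_mul, smul_eq_mul,
    Derivation.map_one_eq_zero]
  push_cast; ring

theorem d_ip (w : ℝ × ℝ) : dir w ip = -(dir w cx * ip ^ 2) := by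
  have h := congrArg (dir w) ip_mul
  simp only [Derivation.leibniz, map_add, Derivation.map_one_eq_zero, smul_eq_mul] at h
  linear_combination ip * h - dir w ip * ip_mul

theorem d_im (w : ℝ × ℝ) : dir w im = -(dir w cx * im ^ 2) := by
  have h := congrArg (dir w) im_mul
  simp only [Derivation.leibniz, map_sub, Derivation.map_one_eq_zero, smul_eq_mul] at h
  linear_combination im * h - dir w im * im_mul

theorem dX_cm : sX * sS * dX cm = 2 * sM * cm := by
  simp only [cm, Derivation.leibniz, Derivation.leibniz_pow, nsmul_eq_mul, smul_eq_mul, d_ip, d_im,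
    dX_cx, dX_sS, sM]
  rw [sX_fac]
  push_cast
  linear_combination (-6 * sS ^ 4 * ip ^ 6 * im ^ 2 * (cx - 1)) * ip_mul +
    (-2 * sS ^ 4 * ip ^ 6 * im ^ 2 * (cx + 1)) * im_mul

theorem dY_cm : sX * sS * dY cm = -(6 * cy * sX * cm) := by
  simp only [cm, Derivation.leibniz, Derivation.leibniz_pow, nsmul_eq_mul, smul_eq_mul, d_ip, d_im,
    dY_cx, dY_sS]
  push_cast
  ring

theorem dX_hX : sX * sS * dX hX = 2 * cm * cc 0 := by
  simp only [hX, Derivation.leibniz, smul_eq_mul, dX_sX, cc]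
  linear_combination sX * dX_cm

theorem dX_hY : sX * sS * dX hY = 2 * cm * cc 1 := by
  simp only [hY, Derivation.leibniz, smul_eq_mul, dX_sY, cc]
  linear_combination sY * dX_cm

theorem dY_hX : sX * sS * dY hX = 2 * cm * cc 3 := by
  simp only [hX, Derivation.leibniz, smul_eq_mul, dY_sX, cc]
  linear_combination sX * dY_cm

theorem dY_hY : sX * sS * dY hY = 2 * cm * cc 4 := by
  simp only [hY, Derivation.leibniz, smul_eq_mul, dY_sY, cc]
  linear_combination sY * dY_cm

theorem cm2 : -(sX * sS * hX) = cm * cc 2 := by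
  simp only [hX, cc]; ring

theorem cm5 : -(sX * sS * hY) = cm * cc 5 := by
  simp only [hY, cc]; ring

theorem evq_cm (q : U2) : evq q cm ≠ 0 := by
  have h1 := evq_cxp q
  have h2 := evq_cxm q
  simp only [cm, map_mul, map_pow, evq_ip, evq_im]
  rw [map_add, map_one, evq_cx] at h1
  rw [map_sub, map_one, evq_cx] at h2
  have := (evq_sS_pos q).ne'
  positivity

/-- A polynomial in `p_x, p_y`. -/
def FA (n : ℕ) (A : ℕ → SF) (z : PhasePt) : ℝ := ∑ j ∈ range (n + 1), mono (A j) (n - j) j 0 0 z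

theorem cl_sum {n : ℕ} {ι : Type*} (s : Finset ι) (F : ι → PhasePt → ℝ) (h : ∀ i ∈ s, Cl n (F i)) :
    Cl n (fun z => ∑ i ∈ s, F i z) := by
  classical
  induction s using Finset.induction_on with
  | empty => simpa using Cl.zero n
  | insert a s ha ih =>
    simp only [Finset.sum_insert ha]
    exact (h a (Finset.mem_insert_self _ _)).add
      (ih fun i hi => h i (Finset.mem_insert_of_mem hi))

theorem FA_cl (n : ℕ) (A : ℕ → SF) : Cl n (FA n A) :=
  cl_sum _ _ fun j hj => Cl.mono _ _ _ _ _ _ (by have := Finset.mem_range.1 hj; omega)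

theorem mono_zero (i j k m : ℕ) {z : PhasePt} (hz : z ∈ TStar) : mono 0 i j k m z = 0 := by
  rw [mono, ext0_evq _ hz, map_zero]; ring

theorem Cl.restrict {n : ℕ} {F : PhasePt → ℝ} (h : Cl n F) :
    ∃ A : ℕ → SF, (∀ j, n < j → A j = 0) ∧ ∀ z ∈ WW {6, 7}, F z = FA n A z := by
  induction h with
  | zero n =>
    exact ⟨fun _ => 0, fun _ _ => rfl, fun z hz => by simp [FA, mono_zero _ _ _ _ hz.1]⟩
  | mono f i j k m n h =>
    by_cases hkm : k = 0 ∧ m = 0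
    · obtain ⟨rfl, rfl⟩ := hkm
      refine ⟨fun j' => if j' = j then f else 0, fun j' hj' => if_neg (by omega), fun z hz => ?_⟩
      rw [FA, Finset.sum_eq_single j]
      · simp only [if_true]; rw [show n - j = i by omega]
      · intro b _ hb; rw [if_neg hb, mono_zero _ _ _ _ hz.1]
      · intro hj; exact absurd (Finset.mem_range.2 (by omega)) hj
    · refine ⟨fun _ => 0, fun _ _ => rfl, fun z hz => ?_⟩
      have h6 : z 6 = 0 := hz.2 6 (by simp)
      have h7 : z 7 = 0 := hz.2 7 (by simp)
      have : ZV.mono f i j k m z = 0 := by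
        rw [ZV.mono, h6, h7]
        by_cases hk : k = 0
        · have hm : m ≠ 0 := fun hm => hkm ⟨hk, hm⟩
          simp [hm]
        · simp [hk]
      simp [this, FA, mono_zero _ _ _ _ hz.1]
  | add _ _ h1 h2 =>
    obtain ⟨A, hA, hA'⟩ := h1
    obtain ⟨B, hB, hB'⟩ := h2
    refine ⟨fun j => A j + B j, fun j hj => by simp only [hA j hj, hB j hj, add_zero], fun z hz => ?_⟩
    simp only [hA' z hz, hB' z hz, FA, ← Finset.sum_add_distrib]
    refine Finset.sum_congr rfl fun j _ => ?_
    simp only [ZV.mono, ext0_evq _ hz.1, map_add]; ring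
  | congr _ h h1 =>
    obtain ⟨A, hA, hA'⟩ := h1
    exact ⟨A, hA, fun z hz => by rw [← h z hz.1, hA' z hz]⟩

theorem pd_sum {ι : Type*} (s : Finset ι) (F : ι → PhasePt → ℝ) {z : PhasePt} (i : Fin 8)
    (h : ∀ j ∈ s, DifferentiableAt ℝ (F j) z) :
    pd i (fun z => ∑ j ∈ s, F j z) z = ∑ j ∈ s, pd i (F j) z := by
  simp only [pd, fderiv_fun_sum h]
  simp

theorem pd_FA (n : ℕ) (A : ℕ → SF) {z : PhasePt} (hz : z ∈ TStar) (i : Fin 8) :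
    pd i (FA n A) z = ∑ j ∈ range (n + 1), pd i (mono (A j) (n - j) j 0 0) z :=
  pd_sum _ _ i fun _ _ => (Sm.mono _ _ _ _ _).diff hz

/-- The Hamiltonian of the reduced system. -/
def HR (z : PhasePt) : ℝ := (1 / 2) * mono hX 2 0 0 0 z + (1 / 2) * mono hY 0 2 0 0 z

theorem HR_cl : Cl 2 HR := ((Cl.mono _ 2 0 0 0 2 rfl).smul _).add ((Cl.mono _ 0 2 0 0 2 rfl).smul _)

theorem HR_eq {z : PhasePt} (hz : z ∈ WW {6, 7}) : Ham z = HR z := by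
  have h6 : z 6 = 0 := hz.2 6 (by simp)
  have h7 : z 7 = 0 := hz.2 7 (by simp)
  rw [← HamQ_eq hz.1, HamQ, HR]
  simp [mono, h6, h7]

theorem pd_HR {z : PhasePt} (hz : z ∈ WW {6, 7}) {i : Fin 8} (hi : i ∉ ({6, 7} : Finset (Fin 8))) :
    pd i Ham z = (1 / 2) * pd i (mono hX 2 0 0 0) z + (1 / 2) * pd i (mono hY 0 2 0 0) z := by
  rw [pd_tang Ham_cl HR_cl (fun z hz => HR_eq hz) hz i hi]
  have h1 := (Sm.mono hX 2 0 0 0).diff hz.1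
  have h2 := (Sm.mono hY 0 2 0 0).diff hz.1
  have c : DifferentiableAt ℝ (fun _ : PhasePt => (1 / 2 : ℝ)) z := differentiableAt_const _
  unfold HR
  rw [pd_add (F := fun z => (1 / 2) * mono hX 2 0 0 0 z) i (c.fun_mul h1) (c.fun_mul h2),
    pd_mul (F := fun _ => (1 / 2 : ℝ)) i c h1, pd_mul (F := fun _ => (1 / 2 : ℝ)) i c h2, pd_const]
  ring

/-- A point of the phase space. -/
def zpt (q : U2) (T : ℝ) : PhasePt := ![q.1.1, q.1.2, 0, 0, 1, T, 0, 0]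

theorem zpt_mem (q : U2) (T : ℝ) : zpt q T ∈ WW {6, 7} := by
  refine ⟨q.2, fun i hi => ?_⟩
  simp only [Finset.mem_insert, Finset.mem_singleton] at hi
  rcases hi with rfl | rfl <;> rfl

theorem mono_zpt (f : SF) (i j : ℕ) (q : U2) (T : ℝ) : mono f i j 0 0 (zpt q T) = evq q f * T ^ j := by
  have h : bp (zpt q T) = q.1 := rfl
  simp only [mono, h, ext0_apply, evq_apply]
  simp [zpt]

theorem pois_zpt (n : ℕ) (A : ℕ → SF) (q : U2) (T : ℝ) :
    2 * pois Ham (FA n A) (zpt q T) =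
      (evq q (dX hX) + evq q (dX hY) * T ^ 2) *
        (∑ j ∈ range (n + 1), ((n - j : ℕ) : ℝ) * (evq q (A j) * T ^ j)) -
      2 * evq q hX * (∑ j ∈ range (n + 1), evq q (dX (A j)) * T ^ j) +
      (evq q (dY hX) + evq q (dY hY) * T ^ 2) *
        (∑ j ∈ range (n + 1), (j : ℝ) * (evq q (A j) * T ^ (j - 1))) -
      2 * evq q hY * T * (∑ j ∈ range (n + 1), evq q (dY (A j)) * T ^ j) := by
  have hz := zpt_mem q T
  rw [pois_Ham_eq (FA_cl n A) hz.1, pd_HR hz (i := 0) (by decide), pd_HR hz (i := 1) (by decide),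
    pd_HR hz (i := 4) (by decide), pd_HR hz (i := 5) (by decide), pd_FA n A hz.1, pd_FA n A hz.1,
    pd_FA n A hz.1, pd_FA n A hz.1]
  simp only [pd0_mono _ _ _ _ _ hz.1, pd1_mono _ _ _ _ _ hz.1, pd4_mono _ _ _ _ _ hz.1,
    pd5_mono _ _ _ _ _ hz.1, mono_zpt]
  simp only [Nat.cast_ofNat, Nat.cast_zero, pow_zero, show 2 - 1 = 1 from rfl, pow_one]
  ring

open Polynomial in
theorem PDE_of_pois {n : ℕ} {A : ℕ → SF} (hA : ∀ j, n < j → A j = 0)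
    (h : ∀ z ∈ WW {6, 7}, pois Ham (FA n A) z = 0) (e : ℕ) : PDE n cc A e = 0 := by
  refine SF_ext fun q => ?_
  have hcm := evq_cm q
  have hXS : evq q sX * evq q sS ≠ 0 := mul_ne_zero (evq_sX_pos q).ne' (evq_sS_pos q).ne'
  let P : ℝ[X] := ∑ j ∈ range (n + 1), C (evq q (A j)) * X ^ j
  let Px : ℝ[X] := ∑ j ∈ range (n + 1), C (evq q (dX (A j))) * X ^ j
  let Py : ℝ[X] := ∑ j ∈ range (n + 1), C (evq q (dY (A j))) * X ^ j
  have cf : ∀ (a : ℕ → ℝ), (∀ j, n < j → a j = 0) → ∀ k,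
      (∑ j ∈ range (n + 1), C (a j) * X ^ j : ℝ[X]).coeff k = a k := by
    intro a ha k
    rw [finsetSum_coeff]
    simp only [coeff_C_mul, coeff_X_pow, mul_ite, mul_one, mul_zero]
    rw [Finset.sum_ite_eq]
    split_ifs with hk
    · rfl
    · exact (ha k (by simpa using hk)).symm
  have cP : ∀ k, P.coeff k = evq q (A k) := cf _ fun j hj => by rw [hA j hj, map_zero]
  have cPx : ∀ k, Px.coeff k = evq q (dX (A k)) := cf _ fun j hj => by rw [hA j hj, map_zero, map_zero]
  have cPy : ∀ k, Py.coeff k = evq q (dY (A k)) := cf _ fun j hj => by rw [hA j hj, map_zero, map_zero]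
  let c : Fin 6 → ℝ := fun t => evq q (cc t)
  let N : ℝ[X] := C (n : ℝ) * P - X * derivative P
  let Q : ℝ[X] := C (c 0) * N + X ^ 2 * (C (c 1) * N) + C (c 2) * Px + C (c 3) * derivative P +
    X ^ 2 * (C (c 4) * derivative P) + X * (C (c 5) * Py)
  have hQ : Q = 0 := by
    refine Polynomial.funext fun T => ?_
    have e0 := congrArg (evq q) dX_hX
    have e1 := congrArg (evq q) dX_hY
    have e2 := congrArg (evq q) cm2
    have e3 := congrArg (evq q) dY_hX
    have e4 := congrArg (evq q) dY_hY
    have e5 := congrArg (evq q) cm5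
    simp only [map_mul, map_neg, map_ofNat] at e0 e1 e2 e3 e4 e5
    have hp := pois_zpt n A q T
    rw [h _ (zpt_mem q T), mul_zero] at hp
    have evP' : (derivative P).eval T = ∑ j ∈ range (n + 1), (j : ℝ) * (evq q (A j) * T ^ (j - 1)) := by
      simp only [P, derivative_sum, derivative_C_mul_X_pow, eval_finsetSum, eval_mul, eval_C,
        eval_pow, eval_X]
      exact Finset.sum_congr rfl fun j _ => by ring
    have evN : N.eval T = ∑ j ∈ range (n + 1), ((n - j : ℕ) : ℝ) * (evq q (A j) * T ^ j) := by
      simp only [N, eval_sub, eval_mul, eval_C, eval_X, evP']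
      simp only [P, eval_finsetSum, eval_mul, eval_C, eval_pow, eval_X, Finset.mul_sum]
      rw [← Finset.sum_sub_distrib]
      refine Finset.sum_congr rfl fun j hj => ?_
      rw [Nat.cast_sub (by have := Finset.mem_range.1 hj; omega)]
      rcases j with _ | j
      · simp
      · simp only [Nat.add_sub_cancel]; ring
    have evx : Px.eval T = ∑ j ∈ range (n + 1), evq q (dX (A j)) * T ^ j := by
      simp only [Px, eval_finsetSum, eval_mul, eval_C, eval_pow, eval_X]
    have evy : Py.eval T = ∑ j ∈ range (n + 1), evq q (dY (A j)) * T ^ j := by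
      simp only [Py, eval_finsetSum, eval_mul, eval_C, eval_pow, eval_X]
    rw [← evN, ← evP', ← evx, ← evy] at hp
    have : 2 * evq q cm * Q.eval T = 0 := by
      simp only [Q, eval_add, eval_mul, eval_C, eval_pow, eval_X, c]
      generalize N.eval T = vN at *
      generalize (derivative P).eval T = vP at *
      generalize Px.eval T = vx at *
      generalize Py.eval T = vy at *
      linear_combination (-(evq q sX * evq q sS)) * hp - vN * e0 - T ^ 2 * vN * e1 - 2 * vx * e2 -
        vP * e3 - T ^ 2 * vP * e4 - 2 * T * vy * e5
    rw [eval_zero]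
    exact (mul_eq_zero.1 this).resolve_left (mul_ne_zero two_ne_zero hcm)
  have hc : Q.coeff e = 0 := by rw [hQ, coeff_zero]
  have cN : ∀ k, N.coeff k = ((n - k : ℕ) : ℝ) * evq q (A k) := by
    intro k
    simp only [N, coeff_sub, coeff_C_mul, cP]
    rcases k with _ | k
    · simp
    · rw [coeff_X_mul, coeff_derivative, cP]
      by_cases hk : k + 1 ≤ n
      · rw [Nat.cast_sub hk]; push_cast; ring
      · rw [hA (k + 1) (by omega)]; simp
  simp only [PDE, map_add, map_mul, map_natCast, map_zero]
  simp only [Q, coeff_add, coeff_C_mul, coeff_X_pow_mul', cN, cPx, coeff_derivative, cP] at hc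
  rcases e with _ | _ | e
  · simp [c] at hc ⊢
    linarith
  · rw [coeff_X_mul] at hc
    simp [c, cPy] at hc ⊢
    linarith
  · rw [coeff_X_mul] at hc
    simp only [coeff_C_mul, cPy, show 2 ≤ e + 1 + 1 by omega, if_true, coeff_derivative, cP, cN,
      Nat.add_sub_cancel, show e + 1 + 1 - 2 = e by omega, show min 1 (e + 1) = 1 by omega,
      show min 1 (e + 1 + 1) = 1 by omega, show n + 2 - (e + 1 + 1) = n - e by omega,
      show e + 1 + 1 - 1 = e + 1 by omega, mul_one, c] at hc ⊢
    push_cast at hc ⊢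
    linarith

/-- The reduced integrals that vanish at one point vanish. -/
theorem reduced_zero {n : ℕ} (hn : n ≤ 6) {F : PhasePt → ℝ} (hF : Cl n F)
    (hp : ∀ z ∈ WW {6, 7}, pois Ham F z = 0) (h0 : n % 2 = 0 → F (zpt q0 0) = 0) :
    ∀ z ∈ WW {6, 7}, F z = 0 := by
  obtain ⟨A, hA, hFA⟩ := hF.restrict
  have hP := PDE_of_pois hA fun z hz => by
    rw [← pois_congr (Finset.Subset.refl _) hF (FA_cl n A) hFA hz, hp z hz]
  have hA0 : n % 2 = 0 → evq q0 (A 0) = 0 := by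
    intro he
    rw [← h0 he, hFA _ (zpt_mem q0 0), FA, Finset.sum_eq_single 0]
    · rw [mono_zpt]; simp
    · intro j _ hj; rw [mono_zpt]; simp [hj]
    · simp
  have hall : ∀ j, A j = 0 := by
    rcases Nat.eq_zero_or_pos n with rfl | hn1
    · intro j
      rcases Nat.eq_zero_or_pos j with rfl | hj
      · have p0 := hP 0
        have p1 := hP 1
        simp [PDE, hA 1 (by omega), hA 2 (by omega)] at p0 p1
        have d0 : dX (A 0) = 0 := by
          refine SF_ext fun q => ?_
          have := congrArg (evq q) p0
          have hx := (evq_sX_pos q).ne'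
          have hs := (evq_sS_pos q).ne'
          simp only [cc, map_mul, map_neg, map_pow, map_zero] at this
          have h2 : -(evq q sX ^ 2 * evq q sS) ≠ 0 := neg_ne_zero.2 (by positivity)
          rw [map_zero]
          exact (mul_eq_zero.1 this).resolve_left h2
        have d1 : dY (A 0) = 0 := by
          refine SF_ext fun q => ?_
          have := congrArg (evq q) p1
          have hx := (evq_sX_pos q).ne'
          have hy := (evq_sY_pos q).ne'
          have hs := (evq_sS_pos q).ne'
          simp only [cc, map_mul, map_neg, map_zero] at this
          have h2 : -(evq q sX * evq q sY * evq q sS) ≠ 0 := neg_ne_zero.2 (by positivity)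
          rw [map_zero]
          exact (mul_eq_zero.1 this).resolve_left h2
        refine SF_ext fun q => ?_
        rw [map_zero]
        refine ode (fun _ : Unit => A 0) q0 q (fun w _ => ?_) (fun _ => hA0 rfl) ()
        have : dir w (A 0) = 0 := by
          refine SF_ext fun q => ?_
          rw [evq_dir_eq, d0, d1]; simp
        rw [this]; exact zero_mem _
      · exact hA j hj
    · exact PDE_trivial hn1 hn A hA (fun e _ => hP e) hA0
  intro z hz
  rw [hFA z hz, FA]
  exact Finset.sum_eq_zero fun j _ => by rw [hall, mono_zero _ _ _ _ hz.1]

theorem claim_base (n : ℕ) (hn : n ≤ 6) : Claim {6, 7} n := by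
  intro F hF hp
  rcases Nat.mod_two_eq_zero_or_one n with he | ho
  · obtain ⟨l, rfl⟩ : ∃ l, n = 2 * l := ⟨n / 2, by omega⟩
    have hH : Ham (zpt q0 0) ≠ 0 := by
      have h0 : zpt q0 0 0 = 2 := rfl
      have h1 : zpt q0 0 1 = 0 := rfl
      have h4 : zpt q0 0 4 = 1 := rfl
      have h5 : zpt q0 0 5 = 0 := rfl
      have h6 : zpt q0 0 6 = 0 := rfl
      have h7 : zpt q0 0 7 = 0 := rfl
      rw [Ham, h0, h1, h4, h5, h6, h7]
      norm_num
    let c : ℝ := F (zpt q0 0) / Ham (zpt q0 0) ^ l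
    have hg : (fun z : PhasePt => Ham z ^ l * z 6 ^ 0 * z 7 ^ 0) ∈ TrivS (2 * l) := triv_gen l 0 0
    have hG := (TrivS (2 * l)).smul_mem c hg
    refine ⟨_, hG, fun z hz => ?_⟩
    refine sub_eq_zero.1 (reduced_zero hn (hF.sub (triv_props hG).1) ?_ ?_ z hz)
    · intro z hz
      rw [pois_sub hF (triv_props hG).1 hz.1, hp z hz, (triv_props hG).2 z hz.1, sub_zero]
    · intro _
      simp only [Pi.smul_apply, smul_eq_mul, pow_zero, mul_one, c]
      field_simp
      ring
  · exact ⟨0, zero_mem _, reduced_zero hn hF hp fun h => by omega⟩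

theorem claim_all : Claim ∅ 6 :=
  claim_step (v := 7) (by simp) (Or.inr rfl) (by simp)
    (claim_step (v := 6) (s := insert 7 ∅) (by decide) (Or.inl rfl) (by decide)
      fun n hn => claim_base n hn) 6 le_rfl

/-! ### Part 9: from general integrals to the class `Cl`, and the dimension count -/

theorem Cl.hom {n : ℕ} {F : PhasePt → ℝ} (h : Cl n F) : IsHomPolyMom n F := by
  induction h with
  | zero n =>
    exact ⟨fun _ _ _ _ _ => 0, fun _ _ _ _ => contDiffOn_const, fun z _ => by simp⟩
  | mono f i j k m n h =>
    have hb : ContDiffOn ℝ (⊤ : ℕ∞) (fun w : Fin 4 → ℝ => ext0 f.1 (w 0, w 1)) Ubase := by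
      have hb : ContDiff ℝ (⊤ : ℕ∞) (fun w : Fin 4 → ℝ => (w 0, w 1)) :=
        (contDiff_apply ℝ ℝ 0).prodMk (contDiff_apply ℝ ℝ 1)
      exact ContDiffOn.comp (t := U2) f.2 hb.contDiffOn fun w hw => hw
    refine ⟨fun i' j' k' m' w => if i' = i ∧ j' = j ∧ k' = k ∧ m' = m then
      ext0 f.1 (w 0, w 1) else 0, fun i' j' k' m' => ?_, fun z _ => ?_⟩
    · by_cases hh : i' = i ∧ j' = j ∧ k' = k ∧ m' = m
      · simp only [hh, and_self, if_true]
        exact hb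
      · simp only [hh, if_false]
        exact contDiffOn_const
    · rw [Finset.sum_eq_single i, Finset.sum_eq_single j, Finset.sum_eq_single k,
        Finset.sum_eq_single m]
      · rw [if_pos h]
        simp only [and_self, if_true]
        rfl
      · intro b _ hb; simp [hb]
      · intro hb; exact absurd (Finset.mem_range.2 (by omega)) hb
      · intro b _ hb; simp [hb]
      · intro hb; exact absurd (Finset.mem_range.2 (by omega)) hb
      · intro b _ hb; simp [hb]
      · intro hb; exact absurd (Finset.mem_range.2 (by omega)) hb
      · intro b _ hb; simp [hb]
      · intro hb; exact absurd (Finset.mem_range.2 (by omega)) hb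
  | add _ _ h1 h2 =>
    obtain ⟨c, hc, hc'⟩ := h1
    obtain ⟨d, hd, hd'⟩ := h2
    refine ⟨fun i j k m w => c i j k m w + d i j k m w,
      fun i j k m => (hc i j k m).add (hd i j k m), fun z hz => ?_⟩
    simp only [hc' z hz, hd' z hz, ← Finset.sum_add_distrib]
    refine Finset.sum_congr rfl fun i _ => Finset.sum_congr rfl fun j _ =>
      Finset.sum_congr rfl fun k _ => Finset.sum_congr rfl fun m _ => ?_
    split_ifs <;> ring
  | congr _ h h1 =>
    obtain ⟨c, hc, hc'⟩ := h1
    exact ⟨c, hc, fun z hz => by rw [← h z hz, hc' z hz]⟩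

theorem const_coord {I : PhasePt → ℝ} (hI : Sm I) {v : Fin 8} (hv : v = 2 ∨ v = 3)
    (h : ∀ z ∈ TStar, pd v I z = 0) {z : PhasePt} (hz : z ∈ TStar) :
    I (Function.update z v 0) = I z := by
  have hm : ∀ s, Function.update z v s ∈ TStar := fun s =>
    update_mem hz (by rcases hv with rfl | rfl <;> decide) (by rcases hv with rfl | rfl <;> decide) s
  have hd : ∀ s, HasDerivAt (fun s => I (Function.update z v s)) 0 s := by
    intro s
    have := hasDerivAt_pd v (hI.diff (hm s))
    rw [h _ (hm s)] at this
    simpa only [Function.update_idem, Function.update_self] using this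
  have := is_const_of_deriv_eq_zero (fun s => (hd s).differentiableAt) (fun s => (hd s).deriv) 0 (z v)
  simpa using this

theorem pois_Pphi (I : PhasePt → ℝ) (z : PhasePt) : pois Pphi I z = -pd 2 I z := by
  have h : Pphi = fun z => z 6 := rfl
  rw [h]
  simp [pois, pd_coord]

theorem pois_Ptm (I : PhasePt → ℝ) (z : PhasePt) : pois Ptm I z = -pd 3 I z := by
  have h : Ptm = fun z => z 7 := rfl
  rw [h]
  simp [pois, pd_coord]

theorem cl_of_hom {n : ℕ} {I : PhasePt → ℝ} (hI : Sm I) (hh : IsHomPolyMom n I)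
    (h2 : ∀ z ∈ TStar, pois Pphi I z = 0) (h3 : ∀ z ∈ TStar, pois Ptm I z = 0) : Cl n I := by
  obtain ⟨c, hc, hc'⟩ := hh
  have hb : ∀ i j k m, ContDiffOn ℝ (⊤ : ℕ∞) (fun q : ℝ × ℝ => c i j k m ![q.1, q.2, 0, 0]) U2 := by
    intro i j k m
    have hb : ContDiff ℝ (⊤ : ℕ∞) (fun q : ℝ × ℝ => (![q.1, q.2, 0, 0] : Fin 4 → ℝ)) := by
      rw [contDiff_pi]
      intro i
      fin_cases i
      · exact contDiff_fst
      · exact contDiff_snd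
      · exact contDiff_const
      · exact contDiff_const
    exact ContDiffOn.comp (t := Ubase) (hc i j k m) hb.contDiffOn fun w hw => hw
  let f : ℕ → ℕ → ℕ → ℕ → SF := fun i j k m => mkSF _ (hb i j k m)
  have key : Cl n (fun z => ∑ i ∈ Finset.range (n+1), ∑ j ∈ Finset.range (n+1),
      ∑ k ∈ Finset.range (n+1), ∑ m ∈ Finset.range (n+1),
        (if i + j + k + m = n then mono (f i j k m) i j k m z else 0)) := by
    refine cl_sum _ _ fun i _ => cl_sum _ _ fun j _ => cl_sum _ _ fun k _ => cl_sum _ _ fun m _ => ?_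
    split_ifs with h
    · exact Cl.mono _ _ _ _ _ _ h
    · exact Cl.zero n
  refine key.congr fun z hz => ?_
  have hz2 := update_mem hz (i := 2) (by decide) (by decide) 0
  have hz3 := update_mem hz2 (i := 3) (by decide) (by decide) 0
  have e2 := const_coord hI (Or.inl rfl) (fun z hz => by
    have := h2 z hz; rw [pois_Pphi] at this; linarith) hz
  have e3 := const_coord hI (Or.inr rfl) (fun z hz => by
    have := h3 z hz; rw [pois_Ptm] at this; linarith) hz2
  rw [← e2, ← e3, hc' _ hz3]
  have hbase : basePt (Function.update (Function.update z 2 0) 3 0) = ![z 0, z 1, 0, 0] := by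
    funext i
    fin_cases i <;> simp [basePt, Function.update]
  rw [hbase]
  refine Finset.sum_congr rfl fun i _ => Finset.sum_congr rfl fun j _ =>
      Finset.sum_congr rfl fun k _ => Finset.sum_congr rfl fun m _ => ?_
  split_ifs
  · have : ext0 (f i j k m).1 (bp z) = c i j k m ![z 0, z 1, 0, 0] := by
      rw [ext0_of_mem _ (bp_mem hz)]; rfl
    rw [mono, this]
    simp
  · rfl

/-- The index set of the basis of trivial integrals. -/
abbrev Ix := Σ l : Fin 4, Fin (7 - 2 * l.1)

/-- The basis of trivial integrals. -/
def bas (i : Ix) (z : PhasePt) : ℝ := Ham z ^ i.1.1 * z 6 ^ i.2.1 * z 7 ^ (6 - 2 * i.1.1 - i.2.1)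

theorem bas_mem (i : Ix) : bas i ∈ TrivS 6 := by
  have h1 := i.1.2
  have h2 := i.2.2
  exact Submodule.subset_span ⟨i.1.1, i.2.1, 6 - 2 * i.1.1 - i.2.1, by omega, rfl⟩

theorem triv_le : TrivS 6 = Submodule.span ℝ (Set.range bas) := by
  refine le_antisymm (Submodule.span_le.2 ?_) (Submodule.span_le.2 ?_)
  · rintro F ⟨l, k, m, h, rfl⟩
    refine Submodule.subset_span ⟨⟨⟨l, by omega⟩, ⟨k, by simp only; omega⟩⟩, ?_⟩
    funext z
    simp only [bas]
    rw [show 6 - 2 * l - k = m by omega]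
  · rintro F ⟨i, rfl⟩
    exact bas_mem i

theorem integral_triv {I : PhasePt → ℝ} (hI : Sm I) (hh : IsHomPolyMom 6 I)
    (h1 : ∀ z ∈ TStar, pois Ham I z = 0)
    (h2 : ∀ z ∈ TStar, pois Pphi I z = 0) (h3 : ∀ z ∈ TStar, pois Ptm I z = 0) :
    ∃ G ∈ TrivS 6, ∀ z ∈ TStar, I z = G z := by
  obtain ⟨G, hG, h⟩ := claim_all I (cl_of_hom hI hh h2 h3) fun z hz => h1 z hz.1
  exact ⟨G, hG, fun z hz => h z ⟨hz, by simp⟩⟩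

theorem bas_sum (c : Ix → ℝ) (z : PhasePt) : ∑ i, c i * bas i z =
    ∑ l : Fin 4, (∑ k : Fin (7 - 2 * l.1), c ⟨l, k⟩ * z 6 ^ k.1 * z 7 ^ (6 - 2 * l.1 - k.1)) *
      Ham z ^ l.1 := by
  rw [Fintype.sum_sigma]
  refine Finset.sum_congr rfl fun l _ => ?_
  rw [Finset.sum_mul]
  refine Finset.sum_congr rfl fun k _ => ?_
  simp only [bas]; ring

theorem classified {I : PhasePt → ℝ} (hI : ∃ G ∈ TrivS 6, ∀ z ∈ TStar, I z = G z) :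
    ∃ (a : ℝ) (b v e : ℕ → ℝ), ∀ z ∈ TStar,
      I z = a * (Ham z)^3
        + (Ham z)^2 * (∑ i ∈ Finset.range 3, b i * (z 6)^i * (z 7)^(2-i))
        + (Ham z) * (∑ j ∈ Finset.range 5, v j * (z 6)^j * (z 7)^(4-j))
        + ∑ k ∈ Finset.range 7, e k * (z 6)^k * (z 7)^(6-k) := by
  obtain ⟨G, hG, h⟩ := hI
  rw [triv_le, Submodule.mem_span_range_iff_exists_fun] at hG
  obtain ⟨c, rfl⟩ := hG
  let d : Fin 4 → ℕ → ℝ := fun l k => if hk : k < 7 - 2 * l.1 then c ⟨l, ⟨k, hk⟩⟩ else 0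
  refine ⟨d 3 0, d 2, d 1, d 0, fun z hz => ?_⟩
  have hs : ∀ l : Fin 4, ∑ k : Fin (7 - 2 * l.1), c ⟨l, k⟩ * z 6 ^ k.1 * z 7 ^ (6 - 2 * l.1 - k.1) =
      ∑ k ∈ range (7 - 2 * l.1), d l k * z 6 ^ k * z 7 ^ (6 - 2 * l.1 - k) := by
    intro l
    rw [Finset.sum_range]
    refine Finset.sum_congr rfl fun k _ => ?_
    simp only [d, dif_pos k.2]
  have e : (∑ i, c i • bas i) z = ∑ i, c i * bas i z := by simp [Finset.sum_apply]
  rw [h z hz, e, bas_sum]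
  simp only [hs]
  rw [Fin.sum_univ_four]
  simp only [show ((3 : Fin 4) : ℕ) = 3 from rfl, show ((2 : Fin 4) : ℕ) = 2 from rfl,
    show ((1 : Fin 4) : ℕ) = 1 from rfl, show ((0 : Fin 4) : ℕ) = 0 from rfl]
  norm_num [Finset.sum_range_one]
  ring

open Polynomial in
theorem poly_zero {n : ℕ} (a : Fin n → ℝ) (S : Set ℝ) (hS : S.Infinite)
    (h : ∀ x ∈ S, ∑ i, a i * x ^ i.1 = 0) (i : Fin n) : a i = 0 := by
  let P : ℝ[X] := ∑ i, C (a i) * X ^ i.1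
  have hP : P = 0 := by
    refine eq_zero_of_infinite_isRoot P (hS.mono fun x hx => ?_)
    simp only [Set.mem_ofPred_eq, IsRoot, P, eval_finsetSum, eval_mul, eval_C, eval_pow, eval_X]
    exact h x hx
  have : P.coeff i.1 = a i := by
    simp only [P, finsetSum_coeff, coeff_C_mul, coeff_X_pow, mul_ite, mul_one, mul_zero]
    rw [Finset.sum_eq_single i]
    · simp
    · intro b _ hb
      rw [if_neg fun h => hb (Fin.ext h.symm)]
    · simp
  rw [← this, hP, coeff_zero]

/-- Restriction to the phase space. -/
def res : (PhasePt → ℝ) →ₗ[ℝ] (↥TStar → ℝ) := LinearMap.funLeft ℝ ℝ Subtype.val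

theorem res_apply (F : PhasePt → ℝ) (z : ↥TStar) : res F z = F z.1 := rfl

theorem exists_pt (p h : ℝ) (hp : p ^ 2 < h) : ∃ z ∈ TStar, z 6 = p ∧ z 7 = 1 ∧ Ham z = h := by
  let r : ℝ := (2 * h - p ^ 2 / 27 + 9) * (243 / 64)
  have hr : 0 ≤ r := by
    have := sq_nonneg p
    simp only [r]; nlinarith
  let z : PhasePt := ![2, 0, 0, 0, √r, 0, p, 1]
  have h0 : z 0 = 2 := rfl
  have h1 : z 1 = 0 := rfl
  have h4 : z 4 = √r := rfl
  have h5 : z 5 = 0 := rfl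
  have h6 : z 6 = p := rfl
  have h7 : z 7 = 1 := rfl
  refine ⟨z, ?_, h6, h7, ?_⟩
  · simp only [TStar, Set.mem_ofPred_eq, h0, h1]; norm_num
  · rw [Ham, h0, h1, h4, h5, h6, h7, Real.sq_sqrt hr]
    simp only [r]; ring

theorem bas_indep : LinearIndependent ℝ (fun i => res (bas i)) := by
  rw [Fintype.linearIndependent_iff]
  intro c hc
  have hc' : ∀ z ∈ TStar, ∑ i, c i * bas i z = 0 := by
    intro z hz
    have := congrFun hc ⟨z, hz⟩
    simpa [Finset.sum_apply, res_apply] using this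
  have h1 : ∀ (p : ℝ) (l : Fin 4), ∑ k : Fin (7 - 2 * l.1), c ⟨l, k⟩ * p ^ k.1 = 0 := by
    intro p
    refine poly_zero _ (Set.Ioi (p ^ 2)) (Set.Ioi_infinite _) fun h hh => ?_
    obtain ⟨z, hz, h6, h7, hH⟩ := exists_pt p h hh
    have := hc' z hz
    rw [bas_sum, h6, h7, hH] at this
    simpa using this
  rintro ⟨l, k⟩
  exact poly_zero (fun k => c ⟨l, k⟩) Set.univ Set.infinite_univ (fun p _ => h1 p l) k

theorem card_Ix : Fintype.card Ix = 16 := by decide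

end ZV

/-- every homogeneous degree-6 integral commuting with `p_φ, p_t` has the
trivial form; the space of such integrals is exactly 16-dimensional. -/
theorem degree_six_homogeneous_integrals_classified :
    (∀ I : PhasePt → ℝ, ContDiffOn ℝ (⊤ : ℕ∞) I TStar → IsHomPolyMom 6 I →
      (∀ z ∈ TStar, pois Ham I z = 0) →
      (∀ z ∈ TStar, pois Pphi I z = 0) →
      (∀ z ∈ TStar, pois Ptm I z = 0) →
      ∃ (a : ℝ) (b v e : ℕ → ℝ), ∀ z ∈ TStar,
      I z = a * (Ham z)^3
        + (Ham z)^2 * (∑ i ∈ Finset.range 3, b i * (z 6)^i * (z 7)^(2-i))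
        + (Ham z) * (∑ j ∈ Finset.range 5, v j * (z 6)^j * (z 7)^(4-j))
        + ∑ k ∈ Finset.range 7, e k * (z 6)^k * (z 7)^(6-k)) ∧
    (∃ V : Submodule ℝ (↥TStar → ℝ),
      (V : Set (↥TStar → ℝ)) =
        {f | ∃ I : PhasePt → ℝ, ContDiffOn ℝ (⊤ : ℕ∞) I TStar ∧ IsHomPolyMom 6 I ∧
          (∀ z ∈ TStar, pois Ham I z = 0 ∧ pois Pphi I z = 0 ∧ pois Ptm I z = 0) ∧
          ∀ z : ↥TStar, f z = I z.1} ∧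
      Module.finrank ℝ V = 16) := by
  refine ⟨fun I hI hh h1 h2 h3 => ZV.classified (ZV.integral_triv hI hh h1 h2 h3),
    Submodule.span ℝ (Set.range fun i => ZV.res (ZV.bas i)), ?_, ?_⟩
  · have hspan : Submodule.span ℝ (Set.range fun i => ZV.res (ZV.bas i)) =
        (ZV.TrivS 6).map ZV.res := by
      rw [ZV.triv_le, Submodule.map_span, ← Set.range_comp]
      rfl
    rw [hspan]
    ext f
    constructor
    · rintro ⟨G, hG, rfl⟩
      have hG := ZV.triv_props hG
      refine ⟨G, hG.1.sm, hG.1.hom, fun z hz => ⟨hG.2 z hz, ?_, ?_⟩, fun z => rfl⟩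
      · rw [ZV.pois_Pphi, (hG.1.pd_base hz).1, neg_zero]
      · rw [ZV.pois_Ptm, (hG.1.pd_base hz).2, neg_zero]
    · rintro ⟨I, hI, hh, hp, hf⟩
      obtain ⟨G, hG, h⟩ := ZV.integral_triv hI hh (fun z hz => (hp z hz).1)
        (fun z hz => (hp z hz).2.1) (fun z hz => (hp z hz).2.2)
      refine ⟨G, hG, funext fun z => ?_⟩
      rw [hf z, h z.1 z.2]
      rfl
  · rw [finrank_span_eq_card ZV.bas_indep, ZV.card_Ix]

end
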